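/- Let Y be a locally contractible paracompact Hausdorff space and let (V_α)_{α∈A} be a locally finite indexed open covering of Y that is closed under finite nonempty intersections (whenever V_α ∩ V_β ≠ ∅ there is γ ∈ A with V_γ = V_α ∩ V_β). Suppose that for every α ∈ A there is given a covering map p_α : U_α → V_α with U_α contractible. Let 𝔘 be the small category whose objects are the elements of A and in which a morphism α → β is a continuous map f : U_α → U_β satisfying p_β ∘ f = p_α (so in particular V_α ⊆ V_β). Then Y is homotopy equivalent to the classifying space |B𝔘|. -/

import Mathlib

open CategoryTheory

/-- The category `𝔘` associated to a family of covering maps `p α : U α → V α` over the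
members of an indexed open covering `V : A → Set Y`: objects are the indices and a morphism
`α → β` is a continuous map `U α → U β` commuting with the projections to `Y`. -/
def coveringSpacesCategory {Y : Type} [TopologicalSpace Y] {A : Type} (V : A → Set Y)
    (U : A → Type) [∀ α, TopologicalSpace (U α)] (p : ∀ α, U α → V α) : Category A where
  Hom α β := {f : C(U α, U β) // ∀ x, ((p β (f x) : Y)) = ((p α x : Y))}
  id α := ⟨ContinuousMap.id _, fun _ => rfl⟩
  comp f g := ⟨g.1.comp f.1, fun x => by
    rw [ContinuousMap.comp_apply, g.2, f.2]⟩
  id_comp f := Subtype.ext (f.1.comp_id)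
  comp_id f := Subtype.ext (f.1.id_comp)
  assoc f g h := Subtype.ext (ContinuousMap.comp_assoc _ _ _).symm

section Realization

open Simplicial Opposite

/-- The characteristic map `Δⁿ → |K|` of the simplex `σ`. -/
noncomputable def realPt {K : SSet.{0}} {n : ℕ} (σ : K.obj (op ⦋n⦌)) :
    C(stdSimplex ℝ (Fin (n + 1)), SSet.toTop.obj K) :=
  TopCat.toSSetObjEquiv _ (op ⦋n⦌) ((sSetTopAdj.unit.app K).app (op ⦋n⦌) σ)

theorem realPt_map {K : SSet.{0}} {n m : ℕ} (σ : K.obj (op ⦋n⦌)) (θ : ⦋m⦌ ⟶ ⦋n⦌)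
    (w : stdSimplex ℝ (Fin (m + 1))) :
    realPt σ (stdSimplex.map θ w) = realPt (K.map θ.op σ) w := by
  have h := NatTrans.naturality_apply (sSetTopAdj.unit.app K) θ.op σ
  unfold realPt
  erw [h]
  rfl

/-- The continuous map out of a realization glued from a natural family of maps on simplices. -/
theorem exists_realDesc {K : SSet.{0}} {Z : Type} [TopologicalSpace Z]
    (g : ∀ (n : ℕ), K.obj (op ⦋n⦌) → C(stdSimplex ℝ (Fin (n + 1)), Z))
    (hg : ∀ (n m : ℕ) (θ : ⦋m⦌ ⟶ ⦋n⦌) (σ : K.obj (op ⦋n⦌)) (w : stdSimplex ℝ (Fin (m + 1))),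
      g n σ (stdSimplex.map θ w) = g m (K.map θ.op σ) w) :
    ∃ f : C(SSet.toTop.obj K, Z), ∀ (n : ℕ) (σ : K.obj (op ⦋n⦌)) w, f (realPt σ w) = g n σ w := by
  let T : K ⟶ TopCat.toSSet.obj (TopCat.of Z) :=
    { app := fun n => ↾fun σ => (TopCat.toSSetObjEquiv (TopCat.of Z) n).symm (g n.unop.len σ)
      naturality := by
        intro n m θ
        ext σ
        apply (TopCat.toSSetObjEquiv (TopCat.of Z) m).injective
        ext w
        have := hg n.unop.len m.unop.len θ.unop σ w
        exact this.symm }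
  refine ⟨((sSetTopAdj.homEquiv K (TopCat.of Z)).symm T).hom, fun n σ w => ?_⟩
  have h : (sSetTopAdj.homEquiv K (TopCat.of Z))
      ((sSetTopAdj.homEquiv K (TopCat.of Z)).symm T) = T :=
    Equiv.apply_symm_apply _ _
  rw [Adjunction.homEquiv_unit] at h
  have h2 := congrArg (fun t => TopCat.toSSetObjEquiv (TopCat.of Z) (op ⦋n⦌) (t.app (op ⦋n⦌) σ) w) h
  exact h2

theorem realization_hom_ext {K : SSet.{0}} {Z : Type} [TopologicalSpace Z]
    {f g : C(SSet.toTop.obj K, Z)}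
    (h : ∀ (n : ℕ) (σ : K.obj (op ⦋n⦌)) w, f (realPt σ w) = g (realPt σ w)) : f = g := by
  have : (TopCat.ofHom f : SSet.toTop.obj K ⟶ TopCat.of Z) = TopCat.ofHom g := by
    apply (sSetTopAdj.homEquiv K (TopCat.of Z)).injective
    rw [Adjunction.homEquiv_unit, Adjunction.homEquiv_unit]
    ext n σ
    apply (TopCat.toSSetObjEquiv (TopCat.of Z) n).injective
    ext w
    exact h n.unop.len σ w
  exact congrArg (fun t : SSet.toTop.obj K ⟶ TopCat.of Z => t.hom) this

theorem exists_realPt_eq {K : SSet.{0}} (z : SSet.toTop.obj K) :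
    ∃ (n : ℕ) (σ : K.obj (op ⦋n⦌)) (w : stdSimplex ℝ (Fin (n + 1))), realPt σ w = z := by
  let P : Type := ULift Prop
  let _ : TopologicalSpace P := ⊤
  let f : C(SSet.toTop.obj K, P) := ⟨fun z => ⟨∃ (n : ℕ) (σ : K.obj (op ⦋n⦌))
    (w : stdSimplex ℝ (Fin (n + 1))), realPt σ w = z⟩, continuous_top⟩
  let g : C(SSet.toTop.obj K, P) := ⟨fun _ => ⟨True⟩, continuous_top⟩
  have h : f = g := realization_hom_ext fun n σ w =>
    ULift.ext _ _ (eq_true ⟨n, σ, w, rfl⟩)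
  have := congrArg (fun k => (k z).down) h
  exact of_eq_true this

/-- **Section principle.** Data over the simplices of `K` that can be extended over a simplex
from its boundary, and transported along degeneracies, can be chosen coherently. -/
theorem exists_coherent_filling {K : SSet.{0}} {E : ℕ → Type} (π : ∀ n, E n → K.obj (op ⦋n⦌))
    (R : ∀ {m n : ℕ}, (⦋m⦌ ⟶ ⦋n⦌) → E n → E m → Prop)
    (hR : ∀ {m n : ℕ} (θ : ⦋m⦌ ⟶ ⦋n⦌) (x : E n) (y : E m), R θ x y →
      π m y = K.map θ.op (π n x))
    (ext : ∀ (n : ℕ) (σ : K.obj (op ⦋n⦌))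
      (b : ∀ m (θ : ⦋m⦌ ⟶ ⦋n⦌), ¬ Function.Surjective θ → E m),
      (∀ {m} (θ : ⦋m⦌ ⟶ ⦋n⦌) (h : ¬ Function.Surjective θ), π m (b m θ h) = K.map θ.op σ) →
      (∀ {m k} (θ : ⦋m⦌ ⟶ ⦋n⦌) (μ : ⦋k⦌ ⟶ ⦋m⦌) (h : ¬ Function.Surjective θ)
        (h' : ¬ Function.Surjective (μ ≫ θ)), R μ (b m θ h) (b k (μ ≫ θ) h')) →
      ∃ x : E n, π n x = σ ∧
        ∀ {m} (θ : ⦋m⦌ ⟶ ⦋n⦌) (h : ¬ Function.Surjective θ), R θ x (b m θ h))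
    (pull : ∀ {m n : ℕ} (θ : ⦋m⦌ ⟶ ⦋n⦌) (x : E n), Function.Surjective θ →
      ∃ y : E m, R θ x y ∧ ∀ {k} (μ : ⦋k⦌ ⟶ ⦋m⦌) (z : E k), R (μ ≫ θ) x z → R μ y z) :
    ∃ s : ∀ n, K.obj (op ⦋n⦌) → E n, (∀ n σ, π n (s n σ) = σ) ∧
      ∀ {m n : ℕ} (θ : ⦋m⦌ ⟶ ⦋n⦌) (σ : K.obj (op ⦋n⦌)), R θ (s n σ) (s m (K.map θ.op σ)) := by
  let T : SSet.{0} :=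
    { obj := fun n => {g : ∀ m : ℕ, (⦋m⦌ ⟶ n.unop) → E m //
        ∀ (m k : ℕ) (θ : ⦋m⦌ ⟶ n.unop) (μ : ⦋k⦌ ⟶ ⦋m⦌), R μ (g m θ) (g k (μ ≫ θ))}
      map := fun {n n'} ν => ↾fun g => ⟨fun m θ => g.1 m (θ ≫ ν.unop), fun m k θ μ => by
        have := g.2 m k (θ ≫ ν.unop) μ
        rwa [← Category.assoc] at this⟩
      map_id := fun n => by
        ext g m θ; simp
      map_comp := fun {a b c} f g => by
        ext g m θ; simp }
  let P : T ⟶ K :=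
    { app := fun n => ↾fun g => π n.unop.len (g.1 n.unop.len (𝟙 n.unop))
      naturality := fun {n n'} ν => by
        ext g
        have h1 := hR ν.unop _ _ (g.2 n.unop.len n'.unop.len (𝟙 _) ν.unop)
        have h2 : ν.unop ≫ 𝟙 n.unop = 𝟙 n'.unop ≫ ν.unop := by simp
        rw [h2] at h1
        exact h1 }
  have hrlp : SSet.modelCategoryQuillen.I.rlp P := by
    intro A B i hi
    obtain ⟨n⟩ := hi
    constructor
    intro t b sq
    let bd : ∀ m (θ : ⦋m⦌ ⟶ ⦋n⦌), ¬ Function.Surjective θ →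
        ((SSet.boundary n : SSet.Subcomplex _).toSSet).obj (op ⦋m⦌) :=
      fun m θ h => ⟨SSet.stdSimplex.objEquiv.symm θ, h⟩
    have hbd : ∀ {m k} (θ : ⦋m⦌ ⟶ ⦋n⦌) (μ : ⦋k⦌ ⟶ ⦋m⦌) (h : ¬ Function.Surjective θ)
        (h' : ¬ Function.Surjective (μ ≫ θ)) (l : ℕ) (ν : ⦋l⦌ ⟶ ⦋k⦌),
        (t.app _ (bd k (μ ≫ θ) h')).1 l ν = (t.app _ (bd m θ h)).1 l (ν ≫ μ) := by
      intro m k θ μ h h' l ν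
      have h1 : t.app _ (bd k (μ ≫ θ) h') = T.map μ.op (t.app _ (bd m θ h)) :=
        NatTrans.naturality_apply t μ.op (bd m θ h)
      rw [h1]
      rfl
    have hsq : ∀ {m} (θ : ⦋m⦌ ⟶ ⦋n⦌) (h : ¬ Function.Surjective θ),
        π m ((t.app _ (bd m θ h)).1 m (𝟙 _)) = K.map θ.op (SSet.yonedaEquiv b) := by
      intro m θ h
      have h1 := congrArg (fun k => k.app (op ⦋m⦌) (bd m θ h)) sq.w
      refine Eq.trans h1 ?_
      have h2 := SSet.yonedaEquiv_symm_app_objEquiv_symm (SSet.yonedaEquiv b) (m := op ⦋m⦌) θ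
      rw [Equiv.symm_apply_apply] at h2
      exact h2
    obtain ⟨x, hx, hxb⟩ := ext n (SSet.yonedaEquiv b)
      (fun m θ h => (t.app _ (bd m θ h)).1 m (𝟙 _)) hsq (fun {m k} θ μ h h' => by
        rw [hbd θ μ h h']
        have := (t.app _ (bd m θ h)).2 m k (𝟙 _) μ
        simpa using this)
    choose pl hpl hpl' using @pull
    classical
    let g : ∀ m : ℕ, (⦋m⦌ ⟶ ⦋n⦌) → E m := fun m θ =>
      if h : Function.Surjective θ then pl θ x h else (t.app _ (bd m θ h)).1 m (𝟙 _)
    have hg0 : ∀ {m} (θ : ⦋m⦌ ⟶ ⦋n⦌), R θ x (g m θ) := by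
      intro m θ
      by_cases h : Function.Surjective θ
      · simp only [g, dif_pos h]; exact hpl θ x h
      · simp only [g, dif_neg h]; exact hxb θ h
    have hg : ∀ (m k : ℕ) (θ : ⦋m⦌ ⟶ ⦋n⦌) (μ : ⦋k⦌ ⟶ ⦋m⦌), R μ (g m θ) (g k (μ ≫ θ)) := by
      intro m k θ μ
      by_cases h : Function.Surjective θ
      · have := hpl' θ x h μ _ (hg0 (μ ≫ θ))
        simpa only [g, dif_pos h] using this
      · have h' : ¬ Function.Surjective (μ ≫ θ) := by
          intro hs; apply h
          intro y; obtain ⟨z, hz⟩ := hs y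
          exact ⟨μ z, by simpa using hz⟩
        simp only [g, dif_neg h, dif_neg h']
        rw [hbd θ μ h h']
        have := (t.app _ (bd m θ h)).2 m k (𝟙 _) μ
        simpa using this
    let G : T.obj (op ⦋n⦌) := ⟨g, hg⟩
    refine ⟨⟨SSet.yonedaEquiv.symm G, ?_, ?_⟩⟩
    · ext k s m θ
      obtain ⟨k⟩ := k
      induction k using SimplexCategory.rec with | _ k =>
      have hs : ¬ Function.Surjective (SSet.stdSimplex.objEquiv s.1 : ⦋k⦌ ⟶ ⦋n⦌) := s.2
      have h' : ¬ Function.Surjective (θ ≫ (SSet.stdSimplex.objEquiv s.1 : ⦋k⦌ ⟶ ⦋n⦌)) := by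
        intro h; apply hs
        intro y; obtain ⟨z, hz⟩ := h y
        exact ⟨θ z, by simpa using hz⟩
      have h1 : g m (θ ≫ SSet.stdSimplex.objEquiv s.1) = (t.app (op ⦋k⦌) s).1 m θ := by
        simp only [g, dif_neg h']
        rw [hbd _ _ hs h']
        simp [bd]
        rfl
      exact h1
    · apply SSet.yonedaEquiv.injective
      rw [SSet.yonedaEquiv_symm_comp, Equiv.apply_symm_apply, ← hx]
      have h3 := hR _ _ _ (hg0 (𝟙 ⦋n⦌))
      simp only [op_id, Functor.map_id_apply] at h3
      exact h3
  have hmono : (MorphismProperty.monomorphisms SSet.{0}).rlp P := by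
    rw [SSet.rlp_monomorphisms]; exact hrlp
  have hlp : HasLiftingProperty (Limits.initial.to K) P := hmono _ (by
    exact MorphismProperty.monomorphisms.infer_property _)
  have sq : CommSq (Limits.initial.to T) (Limits.initial.to K) P (𝟙 K) := ⟨by simp⟩
  let sec : K ⟶ T := sq.lift
  have hsec : sec ≫ P = 𝟙 K := sq.fac_right
  refine ⟨fun n σ => (sec.app (op ⦋n⦌) σ).1 n (𝟙 _), fun n σ => ?_, fun {m n} θ σ => ?_⟩
  · have := congrArg (fun t => t.app (op ⦋n⦌) σ) hsec
    exact this
  · have h1 := (sec.app (op ⦋n⦌) σ).2 n m (𝟙 _) θ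
    have h2 : sec.app (op ⦋m⦌) (K.map θ.op σ) = T.map θ.op (sec.app (op ⦋n⦌) σ) :=
      NatTrans.naturality_apply sec θ.op σ
    have h3 : θ ≫ 𝟙 ⦋n⦌ = 𝟙 ⦋m⦌ ≫ θ := by simp
    rw [h3] at h1
    have h4 : (sec.app (op ⦋m⦌) (K.map θ.op σ)).1 m (𝟙 _) =
      (sec.app (op ⦋n⦌) σ).1 m (𝟙 _ ≫ θ) := by rw [h2]; rfl
    dsimp only
    rw [h4]; exact h1

section Pushforward

variable {I : Type} [LinearOrder I]

/-- The function on `I` obtained by pushing forward the weights `v` along `θ`. -/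
def pushWeights {n : ℕ} (θ : Fin (n + 1) → I) (v : stdSimplex ℝ (Fin (n + 1))) (i : I) : ℝ :=
  ∑ j, if θ j = i then v j else 0

theorem stdSimplex_map_apply {m n : ℕ} (θ : Fin (m + 1) → Fin (n + 1))
    (v : stdSimplex ℝ (Fin (m + 1))) (i : Fin (n + 1)) :
    stdSimplex.map θ v i = ∑ j, if θ j = i then v j else 0 := by
  rw [stdSimplex.map_coe]
  simp [FunOnFinite.linearMap_apply_apply, Finset.sum_filter]

theorem pushWeights_eq_map {m n : ℕ} (θ : Fin (m + 1) → Fin (n + 1))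
    (v : stdSimplex ℝ (Fin (m + 1))) : pushWeights θ v = stdSimplex.map θ v := by
  funext i
  rw [stdSimplex_map_apply]
  rfl

theorem pushWeights_comp {m n : ℕ} (θ : Fin (n + 1) → I) (μ : Fin (m + 1) → Fin (n + 1))
    (v : stdSimplex ℝ (Fin (m + 1))) :
    pushWeights (θ ∘ μ) v = pushWeights θ (stdSimplex.map μ v) := by
  funext i
  unfold pushWeights
  simp only [stdSimplex_map_apply, Function.comp]
  have : ∀ j, (if θ j = i then ∑ k, (if μ k = j then v k else 0) else 0) =
      ∑ k, if μ k = j then (if θ j = i then v k else 0) else 0 := by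
    intro j
    split_ifs with h
    · rfl
    · simp
  simp only [this]
  rw [Finset.sum_comm]
  simp

theorem exists_pos_rep {n : ℕ} (v : stdSimplex ℝ (Fin (n + 1))) :
    ∃ (k : ℕ) (ι : Fin (k + 1) →o Fin (n + 1)) (v' : stdSimplex ℝ (Fin (k + 1))),
      (∀ j, 0 < v' j) ∧ stdSimplex.map ι v' = v := by
  classical
  let s : Finset (Fin (n + 1)) := Finset.univ.filter fun j => 0 < v j
  have hs : s.Nonempty := by
    by_contra h
    rw [Finset.not_nonempty_iff_eq_empty] at h
    have h0 : ∀ j, v j = 0 := fun j => by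
      have : j ∉ s := by simp [h]
      have h1 : ¬ 0 < v j := by simpa [s] using this
      exact le_antisymm (not_lt.1 h1) (stdSimplex.zero_le v j)
    have := stdSimplex.sum_eq_one v
    simp [h0] at this
  obtain ⟨k, hk⟩ : ∃ k, s.card = k + 1 := Nat.exists_eq_succ_of_ne_zero hs.card_ne_zero
  let ι := s.orderEmbOfFin hk
  have hmem : ∀ j, 0 < v (ι j) := fun j => by
    exact (Finset.mem_filter.1 (Finset.orderEmbOfFin_mem s hk j)).2
  have hsum : ∀ f : Fin (n + 1) → ℝ, (∀ j, j ∉ s → f j = 0) → ∑ j, f (ι j) = ∑ j, f j := by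
    intro f hf
    rw [← Finset.sum_subset (Finset.subset_univ s) (fun j _ hj => hf j hj)]
    rw [← Finset.map_orderEmbOfFin_univ s hk, Finset.sum_map]
    rfl
  have h0 : ∀ j, j ∉ s → v j = 0 := fun j hj => by
    have h1 : ¬ 0 < v j := by simpa [s] using hj
    exact le_antisymm (not_lt.1 h1) (stdSimplex.zero_le v j)
  refine ⟨k, ι.toOrderHom, ⟨fun j => v (ι j), fun j => (hmem j).le, ?_⟩, hmem, ?_⟩
  · rw [hsum _ h0]; exact stdSimplex.sum_eq_one v
  · ext i
    rw [stdSimplex_map_apply]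
    have := hsum (fun j => if j = i then v j else 0) (fun j hj => by simp [h0 j hj])
    refine Eq.trans this ?_
    simp

theorem exists_factor_injective {n : ℕ} (θ : Fin (n + 1) →o I) :
    ∃ (k : ℕ) (ι : Fin (k + 1) →o I) (e : Fin (n + 1) →o Fin (k + 1))
      (s : Fin (k + 1) →o Fin (n + 1)),
      StrictMono ι ∧ θ = ι.comp e ∧ e.comp s = OrderHom.id := by
  classical
  let t : Finset I := Finset.univ.image θ
  have hs : t.Nonempty := ⟨θ 0, by simp [t]⟩
  obtain ⟨k, hk⟩ : ∃ k, t.card = k + 1 := Nat.exists_eq_succ_of_ne_zero hs.card_ne_zero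
  let ι := t.orderEmbOfFin hk
  have h1 : ∀ j, ∃ i, ι i = θ j := fun j => by
    have : θ j ∈ (t : Set I) := by simp [t]
    rw [← Finset.range_orderEmbOfFin t hk] at this
    exact this
  have h2 : ∀ i, ∃ j, θ j = ι i := fun i => by
    obtain ⟨j, _, hj⟩ := Finset.mem_image.1 (Finset.orderEmbOfFin_mem t hk i)
    exact ⟨j, hj⟩
  choose e he using h1
  choose s hs' using h2
  refine ⟨k, ι.toOrderHom, ⟨e, fun a b hab => ?_⟩, ⟨s, fun a b hab => ?_⟩, ι.strictMono, ?_, ?_⟩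
  · rw [← ι.le_iff_le, he, he]; exact θ.monotone hab
  · by_contra h
    have hlt := lt_of_not_ge h
    have h3 := θ.monotone hlt.le
    rw [hs', hs', ι.le_iff_le] at h3
    have : a = b := le_antisymm hab h3
    subst this; exact lt_irrefl _ hlt
  · ext j; exact (he j).symm
  · ext i
    have : ι (e (s i)) = ι i := by rw [he, hs']
    exact congrArg _ (ι.injective this)

theorem stdSimplex_map_pos {m n : ℕ} (e : Fin (m + 1) → Fin (n + 1)) (he : Function.Surjective e)
    (v : stdSimplex ℝ (Fin (m + 1))) (hv : ∀ j, 0 < v j) (i : Fin (n + 1)) :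
    0 < stdSimplex.map e v i := by
  rw [stdSimplex_map_apply]
  obtain ⟨j, hj⟩ := he i
  refine Finset.sum_pos' (fun j _ => ?_) ⟨j, Finset.mem_univ _, by simp [hj, hv]⟩
  split_ifs
  · exact (hv j).le
  · exact le_rfl

theorem pushWeights_apply_of_injective {n : ℕ} (θ : Fin (n + 1) → I) (hθ : Function.Injective θ)
    (v : stdSimplex ℝ (Fin (n + 1))) (j : Fin (n + 1)) : pushWeights θ v (θ j) = v j := by
  unfold pushWeights
  rw [Finset.sum_eq_single j]
  · simp
  · intro b _ hb
    simp [hθ.ne hb]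
  · simp

theorem pushWeights_eq_zero {n : ℕ} (θ : Fin (n + 1) → I)
    (v : stdSimplex ℝ (Fin (n + 1))) (i : I) (hi : i ∉ Set.range θ) : pushWeights θ v i = 0 := by
  unfold pushWeights
  refine Finset.sum_eq_zero fun j _ => if_neg fun h => hi ⟨j, h⟩

/-- A value attached naturally to representations of weights on a linear order only depends on
the weights. -/
theorem rep_independent {X : Type} (good : ∀ {n : ℕ}, (Fin (n + 1) →o I) → Prop)
    (hgood : ∀ {m n : ℕ} (θ : Fin (n + 1) →o I) (μ : Fin (m + 1) →o Fin (n + 1)),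
      good θ → good (θ.comp μ))
    (val : ∀ {n : ℕ} (θ : Fin (n + 1) →o I), good θ → stdSimplex ℝ (Fin (n + 1)) → X)
    (hval : ∀ {m n : ℕ} (θ : Fin (n + 1) →o I) (μ : Fin (m + 1) →o Fin (n + 1)) (h : good θ)
      (v : stdSimplex ℝ (Fin (m + 1))),
      val θ h (stdSimplex.map μ v) = val (θ.comp μ) (hgood θ μ h) v)
    {m n : ℕ} (θ : Fin (m + 1) →o I) (hθ : good θ) (v : stdSimplex ℝ (Fin (m + 1)))
    (θ' : Fin (n + 1) →o I) (hθ' : good θ') (v' : stdSimplex ℝ (Fin (n + 1)))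
    (h : pushWeights θ v = pushWeights θ' v') : val θ hθ v = val θ' hθ' v' := by
  have key : ∀ {m : ℕ} (θ : Fin (m + 1) →o I) (hθ : good θ) (v : stdSimplex ℝ (Fin (m + 1))),
      ∃ (k : ℕ) (ι : Fin (k + 1) →o I) (hι : good ι) (u : stdSimplex ℝ (Fin (k + 1))),
        StrictMono ι ∧ (∀ j, 0 < u j) ∧ pushWeights ι u = pushWeights θ v ∧
          val ι hι u = val θ hθ v := by
    intro m θ hθ v
    obtain ⟨k', ι', v', hv', rfl⟩ := exists_pos_rep v
    obtain ⟨k, ι, e, s, hι, hfac, hes⟩ := exists_factor_injective (θ.comp ι')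
    have hιe : ι = (θ.comp ι').comp s := by
      rw [hfac, OrderHom.comp_assoc, hes, OrderHom.comp_id]
    have hgι : good ι := by rw [hιe]; exact hgood _ _ (hgood _ _ hθ)
    have hsurj : Function.Surjective e := fun i => ⟨s i, by
      have := congrArg (fun f : Fin (k + 1) →o Fin (k + 1) => f i) hes
      exact this⟩
    refine ⟨k, ι, hgι, stdSimplex.map e v', hι, stdSimplex_map_pos e hsurj v' hv', ?_, ?_⟩
    · rw [← pushWeights_comp, ← pushWeights_comp]
      have := congrArg (fun f : Fin (k' + 1) →o I => (f : Fin (k' + 1) → I)) hfac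
      exact congrArg (fun f => pushWeights f v') this.symm
    · rw [hval, hval]
      congr 1
      · exact hfac.symm
  obtain ⟨k, ι, hι, u, hm, hp, hw, hv⟩ := key θ hθ v
  obtain ⟨k', ι', hι', u', hm', hp', hw', hv'⟩ := key θ' hθ' v'
  rw [← hv, ← hv']
  have hww : pushWeights ι u = pushWeights ι' u' := by rw [hw, hw', h]
  have hrange : ∀ {k : ℕ} (ι : Fin (k + 1) →o I) (u : stdSimplex ℝ (Fin (k + 1))),
      StrictMono ι → (∀ j, 0 < u j) → Set.range ι = {i | pushWeights ι u i ≠ 0} := by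
    intro k ι u hm hp
    ext i
    constructor
    · rintro ⟨j, rfl⟩
      simp only [Set.mem_ofPred_eq]
      rw [pushWeights_apply_of_injective _ hm.injective]
      exact (hp j).ne'
    · intro hi
      by_contra hc
      exact hi (pushWeights_eq_zero _ _ _ hc)
  have hr : Set.range ι = Set.range ι' := by
    rw [hrange ι u hm hp, hrange ι' u' hm' hp', hww]
  have hk : k = k' := by
    have h1 : Nat.card (Set.range ι) = k + 1 := by
      rw [Nat.card_congr (Equiv.ofInjective ι hm.injective).symm]; simp
    have h2 : Nat.card (Set.range ι') = k' + 1 := by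
      rw [Nat.card_congr (Equiv.ofInjective ι' hm'.injective).symm]; simp
    rw [hr, h2] at h1
    omega
  subst hk
  have hii : ι = ι' := by
    ext j
    exact congrFun ((StrictMono.range_inj hm hm').1 hr) j
  subst hii
  have huu : u = u' := by
    ext j
    have := congrFun hww (ι j)
    rwa [pushWeights_apply_of_injective _ hm.injective,
      pushWeights_apply_of_injective _ hm.injective] at this
  rw [huu]

end Pushforward

end Realization

/-- A collar of the subset `B` of `D`: a depth function vanishing on `B` and a retraction to `B`
of the points of depth at most `1 / 2`. -/
structure Collar {D : Type} [TopologicalSpace D] (B : Set D) where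
  depth : C(D, ℝ)
  retr : D → D
  continuousOn_retr : ContinuousOn retr {d | depth d ≤ 1 / 2}
  retr_mem : ∀ d, depth d ≤ 1 / 2 → retr d ∈ B
  depth_nonneg : ∀ d, 0 ≤ depth d
  mem_iff : ∀ d, d ∈ B ↔ depth d = 0
  retr_eq : ∀ d ∈ B, retr d = d

/-- A map to a contractible space extends from a collared subset, with parameters. -/
theorem Collar.exists_extension {D P U : Type} [TopologicalSpace D] [TopologicalSpace P]
    [TopologicalSpace U] [ContractibleSpace U] {B : Set D} (c : Collar B) (g : D × P → U)
    (hg : ContinuousOn g (B ×ˢ Set.univ)) :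
    ∃ G : C(D × P, U), ∀ d ∈ B, ∀ x, G (d, x) = g (d, x) := by
  classical
  obtain ⟨u₀, ⟨H⟩⟩ := id_nullhomotopic U
  let G : D × P → U := fun z => if c.depth z.1 ≤ 1 / 2 then
    H (Set.projIcc 0 1 zero_le_one (2 * c.depth z.1), g (c.retr z.1, z.2)) else u₀
  have hG : Continuous G := by
    rw [← continuousOn_univ]
    have hu : (Set.univ : Set (D × P)) = {z | c.depth z.1 ≤ 1 / 2} ∪ {z | 1 / 2 ≤ c.depth z.1} := by
      ext z; simpa using le_total _ _
    rw [hu]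
    refine ContinuousOn.union_of_isClosed ?_ ?_
      (isClosed_le (by fun_prop) (by fun_prop)) (isClosed_le (by fun_prop) (by fun_prop))
    · have h1 : ContinuousOn (fun z : D × P =>
          H (Set.projIcc 0 1 zero_le_one (2 * c.depth z.1), g (c.retr z.1, z.2)))
          {z | c.depth z.1 ≤ 1 / 2} := by
        refine H.continuous.comp_continuousOn ((Continuous.continuousOn ?_).prodMk ?_)
        · exact continuous_projIcc.comp (by fun_prop)
        · refine hg.comp ?_ ?_
          · refine ContinuousOn.prodMk ?_ continuous_snd.continuousOn
            exact c.continuousOn_retr.comp continuous_fst.continuousOn (fun z hz => hz)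
          · intro z hz
            exact ⟨c.retr_mem _ hz, trivial⟩
      exact h1.congr fun z hz => if_pos hz
    · refine (continuousOn_const (c := u₀)).congr fun z hz => ?_
      by_cases h : c.depth z.1 ≤ 1 / 2
      · have h2 : 2 * c.depth z.1 = 1 := by
          have : 1 / 2 ≤ c.depth z.1 := hz
          linarith
        simp only [G, if_pos h, h2, Set.projIcc_right]
        exact H.apply_one _
      · simp only [G, if_neg h]
  refine ⟨⟨G, hG⟩, fun d hd x => ?_⟩
  have h0 := (c.mem_iff d).1 hd
  have h : c.depth d ≤ 1 / 2 := by rw [h0]; norm_num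
  change G (d, x) = _
  simp only [G, if_pos h, h0, mul_zero, Set.projIcc_left, c.retr_eq d hd]
  exact H.apply_zero _

section SimplexCollar

variable {n : ℕ}

/-- The smallest barycentric coordinate. -/
noncomputable def minCoord (w : stdSimplex ℝ (Fin (n + 1))) : ℝ :=
  Finset.univ.inf' Finset.univ_nonempty fun i => w i

@[fun_prop]
theorem continuous_stdSimplex_apply {J : Type} [Fintype J] (i : J) :
    Continuous fun w : stdSimplex ℝ J => w i :=
  (continuous_apply i).comp continuous_subtype_val

@[fun_prop]
theorem continuous_minCoord : Continuous (minCoord (n := n)) :=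
  Continuous.finset_inf'_apply _ fun i _ => continuous_stdSimplex_apply i

theorem minCoord_le (w : stdSimplex ℝ (Fin (n + 1))) (i : Fin (n + 1)) : minCoord w ≤ w i :=
  Finset.inf'_le _ (Finset.mem_univ i)

theorem minCoord_nonneg (w : stdSimplex ℝ (Fin (n + 1))) : 0 ≤ minCoord w :=
  Finset.le_inf' _ _ fun i _ => stdSimplex.zero_le w i

theorem exists_minCoord_eq (w : stdSimplex ℝ (Fin (n + 1))) : ∃ i, minCoord w = w i := by
  obtain ⟨i, _, hi⟩ := Finset.exists_mem_eq_inf' Finset.univ_nonempty (fun i => w i)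
  exact ⟨i, hi⟩

theorem minCoord_eq_zero_iff (w : stdSimplex ℝ (Fin (n + 1))) :
    minCoord w = 0 ↔ ∃ i, w i = 0 := by
  constructor
  · intro h
    obtain ⟨i, hi⟩ := exists_minCoord_eq w
    exact ⟨i, hi ▸ h⟩
  · rintro ⟨i, hi⟩
    exact le_antisymm (hi ▸ minCoord_le w i) (minCoord_nonneg w)

/-- Radial expansion of the simplex away from its barycenter. -/
noncomputable def expand (w : stdSimplex ℝ (Fin (n + 1))) (s : ℝ) (i : Fin (n + 1)) : ℝ :=
  1 / (n + 1) + (w i - 1 / (n + 1)) / (1 - s)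

theorem expand_mem (w : stdSimplex ℝ (Fin (n + 1))) (s : ℝ) (hs : s ≤ 1 / 2)
    (h : s ≤ (n + 1) * minCoord w) : expand w s ∈ stdSimplex ℝ (Fin (n + 1)) := by
  have hn : (0 : ℝ) < n + 1 := by positivity
  refine ⟨fun i => ?_, ?_⟩
  · have h1 := minCoord_le w i
    have h2 : s ≤ (n + 1) * w i := h.trans (by gcongr)
    have h3 : 0 < 1 - s := by linarith
    unfold expand
    rw [div_add_div _ _ hn.ne' h3.ne']
    refine div_nonneg ?_ (by positivity)
    field_simp
    linarith
  · unfold expand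
    have := stdSimplex.sum_eq_one w
    rw [Finset.sum_add_distrib, ← Finset.sum_div _ _ (1 - s), Finset.sum_sub_distrib, this]
    simp
    field_simp
    simp

theorem expand_zero (w : stdSimplex ℝ (Fin (n + 1))) : expand w 0 = w := by
  funext i; simp [expand]

/-- The collar of the boundary of a simplex. -/
noncomputable def simplexCollar (n : ℕ) :
    Collar {w : stdSimplex ℝ (Fin (n + 1)) | ∃ i, w i = 0} := by
  classical
  exact
  { depth := ⟨fun w => (n + 1) * minCoord w, by fun_prop⟩
    retr := fun w => if h : (n + 1) * minCoord w ≤ 1 / 2 then ⟨_, expand_mem w _ h le_rfl⟩ else w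
    continuousOn_retr := by
      rw [Topology.IsInducing.subtypeVal.continuousOn_iff]
      have h : ContinuousOn (fun w : stdSimplex ℝ (Fin (n + 1)) => expand w ((n + 1) * minCoord w))
          {w | (n + 1) * minCoord w ≤ 1 / 2} := by
        rw [continuousOn_pi]
        intro i
        unfold expand
        refine ContinuousOn.add continuousOn_const (ContinuousOn.div ?_ ?_ ?_)
        · exact Continuous.continuousOn (by fun_prop)
        · exact Continuous.continuousOn (by fun_prop)
        · intro w hw h0
          have : (n + 1) * minCoord w ≤ 1 / 2 := hw
          linarith
      refine h.congr fun w hw => ?_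
      have hw' : (n + 1) * minCoord w ≤ 1 / 2 := hw
      simp only [Function.comp, dif_pos hw']
    retr_mem := fun w h => by
      have h' : (n + 1) * minCoord w ≤ 1 / 2 := h
      obtain ⟨i, hi⟩ := exists_minCoord_eq w
      refine ⟨i, ?_⟩
      simp only [dif_pos h']
      change expand w _ i = 0
      unfold expand
      rw [← hi]
      have h3 : 1 - (n + 1) * minCoord w ≠ 0 := by linarith
      field_simp
      ring
    depth_nonneg := fun w => mul_nonneg (by positivity) (minCoord_nonneg w)
    mem_iff := fun w => by
      have hn : (n + 1 : ℝ) ≠ 0 := by positivity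
      simp [← minCoord_eq_zero_iff, hn]
    retr_eq := fun w hw => by
      have h0 := (minCoord_eq_zero_iff w).2 hw
      have h : (n + 1) * minCoord w ≤ 1 / 2 := by rw [h0]; norm_num
      simp only [dif_pos h]
      apply Subtype.ext
      simp only [h0, mul_zero]
      exact expand_zero w }

/-- The collar of the boundary of a prism. -/
noncomputable def prismCollar (n : ℕ) :
    Collar {w : stdSimplex ℝ (Fin (n + 1)) × unitInterval |
      (∃ i, w.1 i = 0) ∨ w.2 = 0 ∨ w.2 = 1} := by
  classical
  let d : stdSimplex ℝ (Fin (n + 1)) × unitInterval → ℝ := fun w =>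
    min ((n + 1) * minCoord w.1) (min (2 * (w.2 : ℝ)) (2 * (1 - w.2)))
  have hd : Continuous d := by fun_prop
  have hmem : ∀ w : stdSimplex ℝ (Fin (n + 1)) × unitInterval, d w ≤ 1 / 2 →
      1 / 2 + ((w.2 : ℝ) - 1 / 2) / (1 - d w) ∈ unitInterval := by
    intro w hw
    have h3 : 0 < 1 - d w := by linarith
    have h1 : d w ≤ 2 * w.2 := (min_le_right _ _).trans (min_le_left _ _)
    have h2 : d w ≤ 2 * (1 - w.2) := (min_le_right _ _).trans (min_le_right _ _)
    constructor
    · have : -(1 / 2) ≤ ((w.2 : ℝ) - 1 / 2) / (1 - d w) := by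
        rw [le_div_iff₀ h3]; linarith
      linarith
    · have : ((w.2 : ℝ) - 1 / 2) / (1 - d w) ≤ 1 / 2 := by
        rw [div_le_iff₀ h3]; linarith
      linarith
  have hiff : ∀ w : stdSimplex ℝ (Fin (n + 1)) × unitInterval,
      ((∃ i, w.1 i = 0) ∨ w.2 = 0 ∨ w.2 = 1) ↔ d w = 0 := by
    intro w
    have hn : (0 : ℝ) < n + 1 := by positivity
    have h1 := minCoord_nonneg w.1
    have h2 := w.2.2.1
    have h3 := w.2.2.2
    rw [← minCoord_eq_zero_iff]
    constructor
    · rintro (h | h | h)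
      · simp only [d, h, mul_zero]
        exact min_eq_left (le_min (by linarith) (by linarith))
      · simp only [d, h]
        simp
        exact mul_nonneg hn.le h1
      · simp only [d, h]
        simp
        exact mul_nonneg hn.le h1
    · intro h
      rcases min_choice ((n + 1) * minCoord w.1) (min (2 * (w.2 : ℝ)) (2 * (1 - w.2))) with h4 | h4
      · left
        have : (n + 1) * minCoord w.1 = 0 := h4.symm.trans h
        rcases mul_eq_zero.1 this with h5 | h5
        · exact absurd h5 hn.ne'
        · exact h5
      · right
        have h5 := h4.symm.trans h
        rcases min_choice (2 * (w.2 : ℝ)) (2 * (1 - w.2)) with h6 | h6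
        · left; apply Subtype.ext; have := h6.symm.trans h5; change (w.2 : ℝ) = 0; linarith
        · right; apply Subtype.ext; have := h6.symm.trans h5; change (w.2 : ℝ) = 1; linarith
  exact
  { depth := ⟨d, hd⟩
    retr := fun w => if h : d w ≤ 1 / 2 then
      (⟨_, expand_mem w.1 _ h (min_le_left _ _)⟩, ⟨_, hmem w h⟩) else w
    continuousOn_retr := by
      have h1 : ContinuousOn (fun w : stdSimplex ℝ (Fin (n + 1)) × unitInterval =>
          expand w.1 (d w)) {w | d w ≤ 1 / 2} := by
        rw [continuousOn_pi]
        intro i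
        unfold expand
        refine ContinuousOn.add continuousOn_const (ContinuousOn.div ?_ ?_ ?_)
        · exact (((continuous_stdSimplex_apply i).comp continuous_fst).sub
            continuous_const).continuousOn
        · exact Continuous.continuousOn (by fun_prop)
        · intro w hw h0
          have : d w ≤ 1 / 2 := hw
          linarith
      have h2 : ContinuousOn (fun w : stdSimplex ℝ (Fin (n + 1)) × unitInterval =>
          1 / 2 + ((w.2 : ℝ) - 1 / 2) / (1 - d w)) {w | d w ≤ 1 / 2} := by
        refine ContinuousOn.add continuousOn_const (ContinuousOn.div ?_ ?_ ?_)
        · exact Continuous.continuousOn (by fun_prop)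
        · exact Continuous.continuousOn (by fun_prop)
        · intro w hw h0
          have : d w ≤ 1 / 2 := hw
          linarith
      rw [(Topology.IsInducing.subtypeVal.prodMap Topology.IsInducing.subtypeVal).continuousOn_iff]
      refine (h1.prodMk h2).congr fun w hw => ?_
      have hw' : d w ≤ 1 / 2 := hw
      simp only [Function.comp, dif_pos hw', Prod.map]
    retr_mem := fun w h => by
      have h' : d w ≤ 1 / 2 := h
      have h3 : 1 - d w ≠ 0 := by linarith
      simp only [dif_pos h']
      rcases min_choice ((n + 1) * minCoord w.1) (min (2 * (w.2 : ℝ)) (2 * (1 - w.2))) with h4 | h4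
      · left
        have h5 : d w = (n + 1) * minCoord w.1 := h4
        obtain ⟨i, hi⟩ := exists_minCoord_eq w.1
        refine ⟨i, ?_⟩
        change expand w.1 _ i = 0
        unfold expand
        rw [hi] at h5
        have h6 : w.1 i = d w / (n + 1) := by
          rw [h5]; field_simp
        rw [h6]
        field_simp
        ring
      · right
        rcases min_choice (2 * (w.2 : ℝ)) (2 * (1 - w.2)) with h6 | h6
        · left
          have h5 : d w = 2 * w.2 := h4.trans h6
          apply Subtype.ext
          have h7 : (w.2 : ℝ) = d w / 2 := by linarith
          simp only [h7]
          simp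
          field_simp
          ring
        · right
          have h5 : d w = 2 * (1 - w.2) := h4.trans h6
          apply Subtype.ext
          have h7 : (w.2 : ℝ) = 1 - d w / 2 := by linarith
          simp only [h7]
          simp
          field_simp
          ring
    depth_nonneg := fun w => by
      have h2 := w.2.2.1
      have h3 := w.2.2.2
      exact le_min (mul_nonneg (by positivity) (minCoord_nonneg w.1))
        (le_min (by linarith) (by linarith))
    mem_iff := hiff
    retr_eq := fun w hw => by
      have h0 := (hiff w).1 hw
      have h : d w ≤ 1 / 2 := by rw [h0]; norm_num
      simp only [dif_pos h]
      refine Prod.ext (Subtype.ext ?_) (Subtype.ext ?_)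
      · simp only [h0]
        exact expand_zero w.1
      · simp only [h0]; simp }

end SimplexCollar

section NerveFilling

variable {A : Type} [Category.{0} A]

/-- The morphism between two vertices of a chain. -/
abbrev chainHom {n : ℕ} (σ : ComposableArrows A n) {i j : Fin (n + 1)} (h : i ≤ j) :
    σ.obj i ⟶ σ.obj j := σ.map (homOfLE h)

/-- Reindexing of a chain along a monotone map. -/
abbrev pullChain {m n : ℕ} (σ : ComposableArrows A n) (θ : Fin (m + 1) →o Fin (n + 1)) :
    ComposableArrows A m where
  obj j := σ.obj (θ j)
  map f := chainHom σ (θ.monotone (leOfHom f))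
  map_id j := σ.map_id (θ j)
  map_comp f g := by rw [← σ.map_comp]; rfl

theorem chainHom_refl {n : ℕ} (σ : ComposableArrows A n) (i : Fin (n + 1)) (h : i ≤ i) :
    chainHom σ h = 𝟙 _ := σ.map_id i

theorem chainHom_comp {n : ℕ} (σ : ComposableArrows A n) {i j k : Fin (n + 1)} (h : i ≤ j)
    (h' : j ≤ k) : chainHom σ h ≫ chainHom σ h' = chainHom σ (h.trans h') :=
  (σ.map_comp _ _).symm

/-- The section principle for nerves. -/
theorem exists_nerve_filling (F : ∀ n, ComposableArrows A n → Type)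
    (R : ∀ {m n : ℕ} (θ : Fin (m + 1) →o Fin (n + 1)) (σ : ComposableArrows A n),
      F n σ → F m (pullChain σ θ) → Prop)
    (ext : ∀ (n : ℕ) (σ : ComposableArrows A n)
      (b : ∀ m (θ : Fin (m + 1) →o Fin (n + 1)), ¬ Function.Surjective θ → F m (pullChain σ θ)),
      (∀ {m k} (θ : Fin (m + 1) →o Fin (n + 1)) (μ : Fin (k + 1) →o Fin (m + 1))
        (h : ¬ Function.Surjective θ) (h' : ¬ Function.Surjective (θ.comp μ)),
        R μ (pullChain σ θ) (b m θ h) (b k (θ.comp μ) h')) →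
      ∃ x : F n σ, ∀ {m} (θ : Fin (m + 1) →o Fin (n + 1)) (h : ¬ Function.Surjective θ),
        R θ σ x (b m θ h))
    (pull : ∀ {m n : ℕ} (θ : Fin (m + 1) →o Fin (n + 1)) (σ : ComposableArrows A n) (x : F n σ),
      Function.Surjective θ → ∃ y : F m (pullChain σ θ), R θ σ x y ∧
        ∀ {k} (μ : Fin (k + 1) →o Fin (m + 1)) (z : F k (pullChain σ (θ.comp μ))),
          R (θ.comp μ) σ x z → R μ (pullChain σ θ) y z) :
    ∃ s : ∀ n σ, F n σ, ∀ {m n : ℕ} (θ : Fin (m + 1) →o Fin (n + 1)) (σ : ComposableArrows A n),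
      R θ σ (s n σ) (s m (pullChain σ θ)) := by
  let E : ℕ → Type := fun n => Σ σ : ComposableArrows A n, F n σ
  let R' : ∀ {m n : ℕ}, (Fin (m + 1) →o Fin (n + 1)) → E n → E m → Prop := fun θ x y =>
    ∃ g : F _ (pullChain x.1 θ), y = ⟨_, g⟩ ∧ R θ x.1 x.2 g
  have hR' : ∀ {m n : ℕ} (θ : Fin (m + 1) →o Fin (n + 1)) (σ : ComposableArrows A n) (x : F n σ)
      (y : F m (pullChain σ θ)), R' θ ⟨σ, x⟩ ⟨_, y⟩ ↔ R θ σ x y := by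
    intro m n θ σ x y
    constructor
    · rintro ⟨g, hg, h⟩
      obtain rfl := eq_of_heq (Sigma.mk.inj hg).2
      exact h
    · exact fun h => ⟨y, rfl, h⟩
  obtain ⟨s, hs, hsR⟩ := exists_coherent_filling (K := nerve A) (E := E) (fun n x => x.1)
    (fun {m n} θ => R' θ.toOrderHom) (by rintro m n θ x y ⟨g, rfl, h⟩; rfl)
    (by
      intro n σ b hb hbR
      have hg : ∀ m (θ : Fin (m + 1) →o Fin (n + 1)) (h : ¬ Function.Surjective θ),
          ∃ g : F m (pullChain σ θ), b m (SimplexCategory.Hom.mk θ) h = ⟨_, g⟩ := by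
        intro m θ h
        have h1 := hb (SimplexCategory.Hom.mk θ) h
        have h2 : (b m (SimplexCategory.Hom.mk θ) h).1 = pullChain σ θ := h1
        generalize b m (SimplexCategory.Hom.mk θ) h = y at h2
        obtain ⟨τ, y⟩ := y
        dsimp only at h2
        subst h2
        exact ⟨y, rfl⟩
      choose g hg using hg
      obtain ⟨x, hx⟩ := ext n σ g (by
        intro m k θ μ h h'
        have h3 := hbR (SimplexCategory.Hom.mk θ) (SimplexCategory.Hom.mk μ) h h'
        have h4 : R' μ (b m (SimplexCategory.Hom.mk θ) h)
          (b k (SimplexCategory.Hom.mk (θ.comp μ)) h') := h3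
        rw [hg, hg] at h4
        exact (hR' _ _ _ _).1 h4)
      refine ⟨⟨σ, x⟩, rfl, fun {m} θ h => ?_⟩
      have h5 : R' θ.toOrderHom ⟨σ, x⟩ (b m (SimplexCategory.Hom.mk θ.toOrderHom) h) := by
        rw [hg]
        exact (hR' _ _ _ _).2 (hx _ _)
      exact h5)
    (by
      rintro m n θ ⟨σ, x⟩ hθ
      obtain ⟨y, hy, hy'⟩ := pull θ.toOrderHom σ x hθ
      refine ⟨⟨_, y⟩, (hR' _ _ _ _).2 hy, ?_⟩
      rintro k μ z ⟨g, rfl, hg⟩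
      exact (hR' _ _ _ _).2 (hy' μ.toOrderHom g hg))
  have hg : ∀ n (σ : ComposableArrows A n), ∃ g : F n σ, s n σ = ⟨σ, g⟩ := by
    intro n σ
    have h2 : (s n σ).1 = σ := hs n σ
    generalize s n σ = y at h2
    obtain ⟨τ, y⟩ := y
    dsimp only at h2
    subst h2
    exact ⟨y, rfl⟩
  choose g hg using hg
  refine ⟨g, fun {m n} θ σ => ?_⟩
  have h4 : R' θ (s n σ) (s m (pullChain σ θ)) := hsR (SimplexCategory.Hom.mk θ) σ
  rw [hg, hg] at h4
  exact (hR' _ _ _ _).1 h4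

end NerveFilling

/-- A category of contractible spaces over `Y` with evenly behaved projections and the
unique lifting property of coverings. -/
structure CoveringSystem (A : Type) [Category.{0} A] (Y : Type) [TopologicalSpace Y] where
  U : A → Type
  [top : ∀ α, TopologicalSpace (U α)]
  [contr : ∀ α, ContractibleSpace (U α)]
  V : A → Set Y
  isOpen_V : ∀ α, IsOpen (V α)
  exists_mem : ∀ y, ∃ α, y ∈ V α
  locallyFinite : LocallyFinite V
  exists_inter : ∀ α β, (V α ∩ V β).Nonempty → ∃ γ, V γ = V α ∩ V β
  q : ∀ α, C(U α, Y)
  q_mem : ∀ α u, q α u ∈ V α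
  act : ∀ {α β : A}, (α ⟶ β) → C(U α, U β)
  act_id : ∀ (α : A) (u : U α), act (𝟙 α) u = u
  act_comp : ∀ {α β γ : A} (f : α ⟶ β) (g : β ⟶ γ) (u : U α), act (f ≫ g) u = act g (act f u)
  q_act : ∀ {α β : A} (f : α ⟶ β) (u : U α), q β (act f u) = q α u
  mono : ∀ {α β : A}, (α ⟶ β) → V α ⊆ V β
  exists_hom : ∀ {α β : A} (u : U α) (v : U β), V α ⊆ V β → q α u = q β v →
    ∃ f : α ⟶ β, act f u = v
  hom_ext : ∀ {α β : A} (f g : α ⟶ β) (u : U α), act f u = act g u → f = g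
  exists_section : ∀ (α : A), ∀ y ∈ V α, ∃ O : Set Y, IsOpen O ∧ y ∈ O ∧
    ∃ s : Y → U α, ContinuousOn s O ∧ ∀ y ∈ O, q α (s y) = y
  exists_injOn : ∀ (α : A) (u : U α), ∃ O ∈ nhds u, Set.InjOn (q α) O

attribute [instance] CoveringSystem.top CoveringSystem.contr

section BoundaryGlue

theorem exists_boundary_rep {n : ℕ} (w : stdSimplex ℝ (Fin (n + 1))) (hw : ∃ i, w i = 0) :
    ∃ (m : ℕ) (θ : Fin (m + 1) →o Fin (n + 1)) (v : stdSimplex ℝ (Fin (m + 1))),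
      ¬ Function.Surjective θ ∧ stdSimplex.map θ v = w := by
  obtain ⟨k, ι, v, hv, rfl⟩ := exists_pos_rep w
  refine ⟨k, ι, v, fun h => ?_, rfl⟩
  obtain ⟨i, hi⟩ := hw
  exact (stdSimplex_map_pos ι h v hv i).ne' hi

theorem map_mem_boundary {m n : ℕ} (θ : Fin (m + 1) → Fin (n + 1)) (hθ : ¬ Function.Surjective θ)
    (v : stdSimplex ℝ (Fin (m + 1))) : ∃ i, stdSimplex.map θ v i = 0 := by
  obtain ⟨i, hi⟩ := not_forall.1 hθ
  refine ⟨i, ?_⟩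
  rw [stdSimplex_map_apply]
  exact Finset.sum_eq_zero fun j _ => if_neg fun h => hi ⟨j, h⟩

theorem not_surjective_comp {m k n : ℕ} (θ : Fin (m + 1) →o Fin (n + 1))
    (μ : Fin (k + 1) →o Fin (m + 1)) (h : ¬ Function.Surjective θ) :
    ¬ Function.Surjective (θ.comp μ) :=
  fun hs => h fun y => (hs y).elim fun z hz => ⟨μ z, hz⟩

theorem succAbove_not_surjective {k : ℕ} (i : Fin (k + 1 + 1)) :
    ¬ Function.Surjective (Fin.succAboveOrderEmb i).toOrderHom := fun h => by
  obtain ⟨j, hj⟩ := h i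
  exact Fin.succAbove_ne i j hj

theorem map_succAbove_restrict {k : ℕ} (i : Fin (k + 1 + 1)) (w : stdSimplex ℝ (Fin (k + 1 + 1)))
    (hw : w i = 0) : ∃ h : (fun j => w (i.succAbove j)) ∈ stdSimplex ℝ (Fin (k + 1)),
      stdSimplex.map (Fin.succAboveOrderEmb i).toOrderHom ⟨_, h⟩ = w := by
  have h : (fun j => w (i.succAbove j)) ∈ stdSimplex ℝ (Fin (k + 1)) := by
    refine ⟨fun j => stdSimplex.zero_le _ _, ?_⟩
    have h1 := stdSimplex.sum_eq_one w
    rw [Fin.sum_univ_succAbove _ i, hw, zero_add] at h1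
    exact h1
  refine ⟨h, ?_⟩
  ext l
  rw [stdSimplex_map_apply, ← pushWeights]
  by_cases hl : l = i
  · subst hl
    rw [pushWeights_eq_zero, hw]
    rintro ⟨j, hj⟩
    exact Fin.succAbove_ne l j hj
  · obtain ⟨j, rfl⟩ := Fin.exists_succAbove_eq hl
    exact pushWeights_apply_of_injective _ (Fin.succAboveOrderEmb i).injective ⟨_, h⟩ j

/-- A compatible family of maps on the proper faces glues to a map on the boundary. -/
theorem exists_boundary_glue {n : ℕ} {Z P : Type} [TopologicalSpace Z] [TopologicalSpace P]
    [Nonempty Z]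
    (b : ∀ m (θ : Fin (m + 1) →o Fin (n + 1)), ¬ Function.Surjective θ →
      C(stdSimplex ℝ (Fin (m + 1)) × P, Z))
    (hb : ∀ {m k} (θ : Fin (m + 1) →o Fin (n + 1)) (μ : Fin (k + 1) →o Fin (m + 1))
      (h : ¬ Function.Surjective θ) (h' : ¬ Function.Surjective (θ.comp μ)) v p,
      b m θ h (stdSimplex.map μ v, p) = b k (θ.comp μ) h' (v, p)) :
    ∃ g : stdSimplex ℝ (Fin (n + 1)) × P → Z,
      ContinuousOn g ({w | ∃ i, w i = 0} ×ˢ Set.univ) ∧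
      ∀ m (θ : Fin (m + 1) →o Fin (n + 1)) (h : ¬ Function.Surjective θ) v p,
        g (stdSimplex.map θ v, p) = b m θ h (v, p) := by
  have hind := fun {m k : ℕ} => @rep_independent (Fin (n + 1)) _ (P → Z)
    (fun {m} θ => ¬ Function.Surjective θ) (fun θ μ h => not_surjective_comp θ μ h)
    (fun {m} θ h v p => b m θ h (v, p)) (fun θ μ h v => funext fun p => hb θ μ h _ v p) m k
  have hf : ∀ w : stdSimplex ℝ (Fin (n + 1)), ∃ f : P → Z,
      ∀ m (θ : Fin (m + 1) →o Fin (n + 1)) (h : ¬ Function.Surjective θ) v,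
        stdSimplex.map θ v = w → ∀ p, f p = b m θ h (v, p) := by
    intro w
    by_cases hw : ∃ i, w i = 0
    · obtain ⟨k, θ', v', h', hv'⟩ := exists_boundary_rep w hw
      refine ⟨fun p => b k θ' h' (v', p), fun m θ h v hv p => ?_⟩
      refine congrFun (hind θ' h' v' θ h v ?_) p
      rw [pushWeights_eq_map, pushWeights_eq_map, hv, hv']
    · refine ⟨fun _ => Classical.arbitrary Z, fun m θ h v hv => ?_⟩
      exact absurd (hv ▸ map_mem_boundary θ h v) hw
  choose f hf using hf
  have hval : ∀ m (θ : Fin (m + 1) →o Fin (n + 1)) (h : ¬ Function.Surjective θ) v p,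
      f (stdSimplex.map θ v) p = b m θ h (v, p) := fun m θ h v p => hf _ m θ h v rfl p
  refine ⟨fun z => f z.1 z.2, ?_, hval⟩
  have hB : ({w | ∃ i, w i = 0} ×ˢ Set.univ : Set (stdSimplex ℝ (Fin (n + 1)) × P)) =
      ⋃ i, {z | z.1 i = 0} := by
    ext z; simp
  rw [hB]
  refine (locallyFinite_of_finite _).continuousOn_iUnion (fun i =>
    isClosed_eq ((continuous_stdSimplex_apply i).comp continuous_fst) continuous_const)
    fun i => ?_
  rw [continuousOn_iff_continuous_domRestrict]
  cases n with
  | zero =>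
    have : IsEmpty {z : stdSimplex ℝ (Fin (0 + 1)) × P | z.1 i = 0} := ⟨fun z => by
      have h1 := stdSimplex.sum_eq_one z.1.1
      have h2 : z.1.1 i = 0 := z.2
      rw [Finset.sum_eq_zero fun j _ => (congrArg _ (Fin.fin_one_eq_zero j)).trans
        ((congrArg _ (Fin.fin_one_eq_zero i).symm).trans h2)] at h1
      exact zero_ne_one h1⟩
    exact continuous_of_discreteTopology
  | succ k =>
    let θ : Fin (k + 1) →o Fin (k + 1 + 1) := (Fin.succAboveOrderEmb i).toOrderHom
    have hθ : ¬ Function.Surjective θ := succAbove_not_surjective i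
    have hmem : ∀ z : {z : stdSimplex ℝ (Fin (k + 1 + 1)) × P | z.1 i = 0},
        (fun j => z.1.1 (i.succAbove j)) ∈ stdSimplex ℝ (Fin (k + 1)) := fun z =>
      (map_succAbove_restrict i z.1.1 z.2).choose
    have hmap : ∀ z : {z : stdSimplex ℝ (Fin (k + 1 + 1)) × P | z.1 i = 0},
        stdSimplex.map θ ⟨_, hmem z⟩ = z.1.1 := fun z =>
      (map_succAbove_restrict i z.1.1 z.2).choose_spec
    have heq : ({z : stdSimplex ℝ (Fin (k + 1 + 1)) × P | z.1 i = 0}).domRestrict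
        (fun z => f z.1 z.2) = fun z => b k θ hθ (⟨_, hmem z⟩, z.1.2) := by
      funext z
      rw [← hval, hmap]
      rfl
    rw [heq]
    refine (b k θ hθ).continuous.comp (Continuous.prodMk (Continuous.subtype_mk ?_ _) (by fun_prop))
    refine continuous_pi fun j => ?_
    exact (continuous_stdSimplex_apply _).comp (continuous_fst.comp continuous_subtype_val)

end BoundaryGlue

namespace CoveringSystem

variable {A : Type} [Category.{0} A] {Y : Type} [TopologicalSpace Y] (S : CoveringSystem A Y)

/-- Contractions of the spaces of a chain into the space of its last vertex, starting with the
composite of the chain. -/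
abbrev Contraction (n : ℕ) (σ : ComposableArrows A n) : Type :=
  {G : C((stdSimplex ℝ (Fin (n + 1)) × unitInterval) × S.U (σ.obj 0), S.U (σ.obj (Fin.last n))) //
    (∀ w x, G ((w, 0), x) = S.act (chainHom σ (Fin.zero_le _)) x) ∧
      ∀ w x z, G ((w, 1), x) = G ((w, 1), z)}

/-- Extension of a contraction of a face to the original chain. -/
abbrev faceContraction {m n : ℕ} (θ : Fin (m + 1) →o Fin (n + 1)) (σ : ComposableArrows A n)
    (G : S.Contraction m (pullChain σ θ)) :
    C(stdSimplex ℝ (Fin (m + 1)) × (unitInterval × S.U (σ.obj 0)), S.U (σ.obj (Fin.last n))) where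
  toFun z := S.act (chainHom σ (Fin.le_last (θ (Fin.last m))))
    (G.1 ((z.1, z.2.1), S.act (chainHom σ (Fin.zero_le (θ 0))) z.2.2))

/-- Compatibility of contractions. -/
abbrev ContractionRel {m n : ℕ} (θ : Fin (m + 1) →o Fin (n + 1)) (σ : ComposableArrows A n)
    (G : S.Contraction n σ) (G' : S.Contraction m (pullChain σ θ)) : Prop :=
  ∀ w l x, G.1 ((stdSimplex.map θ w, l), x) = S.faceContraction θ σ G' (w, (l, x))

theorem act_act_chainHom {n : ℕ} (σ : ComposableArrows A n) {i j k : Fin (n + 1)} (h : i ≤ j)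
    (h' : j ≤ k) (x : S.U (σ.obj i)) :
    S.act (chainHom σ h') (S.act (chainHom σ h) x) = S.act (chainHom σ (h.trans h')) x := by
  rw [← S.act_comp, chainHom_comp]

theorem faceContraction_zero {m n : ℕ} (θ : Fin (m + 1) →o Fin (n + 1)) (σ : ComposableArrows A n)
    (G : S.Contraction m (pullChain σ θ)) (w : stdSimplex ℝ (Fin (m + 1))) (x : S.U (σ.obj 0)) :
    S.faceContraction θ σ G (w, (0, x)) = S.act (chainHom σ (Fin.zero_le _)) x := by
  change S.act (chainHom σ _) (G.1 ((w, 0), S.act (chainHom σ _) x)) = _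
  rw [G.2.1]
  refine (congrArg _ (S.act_act_chainHom σ _ (θ.monotone (Fin.zero_le _)) x)).trans ?_
  exact S.act_act_chainHom σ _ _ x

theorem faceContraction_one {m n : ℕ} (θ : Fin (m + 1) →o Fin (n + 1)) (σ : ComposableArrows A n)
    (G : S.Contraction m (pullChain σ θ)) (w : stdSimplex ℝ (Fin (m + 1)))
    (x x' : S.U (σ.obj 0)) :
    S.faceContraction θ σ G (w, (1, x)) = S.faceContraction θ σ G (w, (1, x')) := by
  change S.act (chainHom σ _) (G.1 ((w, 1), S.act (chainHom σ _) x)) =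
    S.act (chainHom σ _) (G.1 ((w, 1), S.act (chainHom σ _) x'))
  rw [G.2.2]

theorem faceContraction_comp {m n k : ℕ} (θ : Fin (m + 1) →o Fin (n + 1))
    (μ : Fin (k + 1) →o Fin (m + 1)) (σ : ComposableArrows A n)
    (G : S.Contraction m (pullChain σ θ)) (G' : S.Contraction k (pullChain σ (θ.comp μ)))
    (h : S.ContractionRel μ (pullChain σ θ) G G') (w : stdSimplex ℝ (Fin (k + 1)))
    (p : unitInterval × S.U (σ.obj 0)) :
    S.faceContraction θ σ G (stdSimplex.map μ w, p) =
      S.faceContraction (θ.comp μ) σ G' (w, p) := by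
  change S.act (chainHom σ _) (G.1 ((stdSimplex.map μ w, p.1), S.act (chainHom σ _) p.2)) =
    S.act (chainHom σ _) (G'.1 ((w, p.1), S.act (chainHom σ _) p.2))
  rw [h]
  refine (S.act_act_chainHom σ (θ.monotone (Fin.le_last _)) _ _).trans ?_
  congr 3
  exact S.act_act_chainHom σ _ (θ.monotone (Fin.zero_le _)) p.2

theorem exists_contraction_extension (n : ℕ) (σ : ComposableArrows A n)
    (b : ∀ m (θ : Fin (m + 1) →o Fin (n + 1)), ¬ Function.Surjective θ →
      S.Contraction m (pullChain σ θ))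
    (hb : ∀ {m k} (θ : Fin (m + 1) →o Fin (n + 1)) (μ : Fin (k + 1) →o Fin (m + 1))
      (h : ¬ Function.Surjective θ) (h' : ¬ Function.Surjective (θ.comp μ)),
      S.ContractionRel μ (pullChain σ θ) (b m θ h) (b k (θ.comp μ) h')) :
    ∃ x : S.Contraction n σ, ∀ {m} (θ : Fin (m + 1) →o Fin (n + 1)) (h : ¬ Function.Surjective θ),
      S.ContractionRel θ σ x (b m θ h) := by
  classical
  obtain ⟨g, hg, hgb⟩ := exists_boundary_glue (fun m θ h => S.faceContraction θ σ (b m θ h))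
    (fun θ μ h h' v p => S.faceContraction_comp θ μ σ _ _ (hb θ μ h h') v p)
  have x₀ : S.U (σ.obj 0) := Classical.arbitrary _
  obtain ⟨G₁, hG₁⟩ := (simplexCollar n).exists_extension (P := Unit)
    (fun z => g (z.1, (1, x₀)))
    (hg.comp (f := fun z : stdSimplex ℝ (Fin (n + 1)) × Unit => (z.1, ((1 : unitInterval), x₀)))
      (by fun_prop) fun z hz => ⟨hz.1, Set.mem_univ _⟩)
  have hzero : ∀ w x, (∃ i, w i = 0) → g (w, (0, x)) = S.act (chainHom σ (Fin.zero_le _)) x := by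
    intro w x hw
    obtain ⟨m, θ, v, hθ, rfl⟩ := exists_boundary_rep w hw
    rw [hgb _ _ hθ, faceContraction_zero]
  have hone : ∀ w x, (∃ i, w i = 0) → g (w, (1, x)) = G₁ (w, ()) := by
    intro w x hw
    rw [hG₁ w hw]
    obtain ⟨m, θ, v, hθ, rfl⟩ := exists_boundary_rep w hw
    rw [hgb _ _ hθ, hgb _ _ hθ, faceContraction_one]
  let f : (stdSimplex ℝ (Fin (n + 1)) × unitInterval) × S.U (σ.obj 0) → S.U (σ.obj (Fin.last n)) :=
    fun z => if z.1.2 = 0 then S.act (chainHom σ (Fin.zero_le _)) z.2 else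
      if z.1.2 = 1 then G₁ (z.1.1, ()) else g (z.1.1, (z.1.2, z.2))
  have hf0 : ∀ w x, f ((w, 0), x) = S.act (chainHom σ (Fin.zero_le _)) x := fun w x => if_pos rfl
  have hf1 : ∀ w x, f ((w, 1), x) = G₁ (w, ()) := fun w x =>
    (if_neg one_ne_zero).trans (if_pos rfl)
  have hfg : ∀ w l x, (∃ i, w i = 0) → f ((w, l), x) = g (w, (l, x)) := by
    intro w l x hw
    by_cases h0 : l = 0
    · rw [h0, hf0, hzero w x hw]
    by_cases h1 : l = 1
    · rw [h1, hf1, hone w x hw]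
    exact (if_neg h0).trans (if_neg h1)
  have hclosed : IsClosed {w : stdSimplex ℝ (Fin (n + 1)) | ∃ i, w i = 0} := by
    rw [show {w : stdSimplex ℝ (Fin (n + 1)) | ∃ i, w i = 0} = ⋃ i, {w | w i = 0} by ext; simp]
    exact isClosed_iUnion_of_finite fun i =>
      isClosed_eq (continuous_stdSimplex_apply i) continuous_const
  have hfc : ContinuousOn f ({w : stdSimplex ℝ (Fin (n + 1)) × unitInterval |
      (∃ i, w.1 i = 0) ∨ w.2 = 0 ∨ w.2 = 1} ×ˢ Set.univ) := by
    have hsplit : ({w : stdSimplex ℝ (Fin (n + 1)) × unitInterval |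
        (∃ i, w.1 i = 0) ∨ w.2 = 0 ∨ w.2 = 1} ×ˢ Set.univ : Set (_ × S.U (σ.obj 0))) =
        {z | ∃ i, z.1.1 i = 0} ∪ ({z | z.1.2 = 0} ∪ {z | z.1.2 = 1}) := by
      ext z; simp
    rw [hsplit]
    have hc0 : IsClosed {z : (stdSimplex ℝ (Fin (n + 1)) × unitInterval) × S.U (σ.obj 0) |
        z.1.2 = 0} := isClosed_eq (by fun_prop) continuous_const
    have hc1 : IsClosed {z : (stdSimplex ℝ (Fin (n + 1)) × unitInterval) × S.U (σ.obj 0) |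
        z.1.2 = 1} := isClosed_eq (by fun_prop) continuous_const
    refine ContinuousOn.union_of_isClosed ?_ (ContinuousOn.union_of_isClosed ?_ ?_ hc0 hc1)
      (hclosed.preimage (continuous_fst.comp continuous_fst)) (hc0.union hc1)
    · refine (hg.comp (f := fun z : (stdSimplex ℝ (Fin (n + 1)) × unitInterval) × S.U (σ.obj 0) =>
        (z.1.1, (z.1.2, z.2))) (by fun_prop) fun z hz => ⟨hz, Set.mem_univ _⟩).congr ?_
      exact fun z hz => hfg z.1.1 z.1.2 z.2 hz
    · refine ((S.act (chainHom σ (Fin.zero_le _))).continuous.comp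
        continuous_snd).continuousOn.congr ?_
      rintro ⟨⟨w, l⟩, x⟩ (rfl : l = 0)
      exact hf0 w x
    · refine (G₁.continuous.comp (f := fun z : (stdSimplex ℝ (Fin (n + 1)) × unitInterval) ×
        S.U (σ.obj 0) => (z.1.1, ())) (by fun_prop)).continuousOn.congr ?_
      rintro ⟨⟨w, l⟩, x⟩ (rfl : l = 1)
      exact hf1 w x
  obtain ⟨G, hG⟩ := (prismCollar n).exists_extension f hfc
  refine ⟨⟨G, fun w x => ?_, fun w x x' => ?_⟩, fun {m} θ h w l x => ?_⟩
  · rw [hG _ (Or.inr (Or.inl rfl)), hf0]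
  · rw [hG _ (Or.inr (Or.inr rfl)), hG _ (Or.inr (Or.inr rfl)), hf1, hf1]
  · have hw : ∃ i, stdSimplex.map θ w i = 0 := map_mem_boundary θ h w
    change G ((stdSimplex.map θ w, l), x) = _
    rw [hG _ (Or.inl hw), hfg _ _ _ hw, hgb _ _ h]

theorem contraction_pull {m n : ℕ} (θ : Fin (m + 1) →o Fin (n + 1)) (σ : ComposableArrows A n)
    (G : S.Contraction n σ) (hθ : Function.Surjective θ) :
    ∃ G' : S.Contraction m (pullChain σ θ), S.ContractionRel θ σ G G' ∧
      ∀ {k} (μ : Fin (k + 1) →o Fin (m + 1)) (H : S.Contraction k (pullChain σ (θ.comp μ))),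
        S.ContractionRel (θ.comp μ) σ G H → S.ContractionRel μ (pullChain σ θ) G' H := by
  have h0 : θ 0 ≤ 0 := by
    obtain ⟨j, hj⟩ := hθ 0
    exact hj ▸ θ.monotone (Fin.zero_le j)
  have hl : Fin.last n ≤ θ (Fin.last m) := by
    obtain ⟨j, hj⟩ := hθ (Fin.last n)
    exact hj ▸ θ.monotone (Fin.le_last j)
  have hid : ∀ {i : Fin (n + 1)} (h : i ≤ i) (x : S.U (σ.obj i)), S.act (chainHom σ h) x = x :=
    fun h x => by rw [chainHom_refl, S.act_id]
  let G' : C((stdSimplex ℝ (Fin (m + 1)) × unitInterval) × S.U (σ.obj (θ 0)),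
      S.U (σ.obj (θ (Fin.last m)))) :=
    ⟨fun z => S.act (chainHom σ hl) (G.1 ((stdSimplex.map θ z.1.1, z.1.2),
      S.act (chainHom σ h0) z.2)), by
      have := stdSimplex.continuous_map (S := ℝ) θ
      fun_prop⟩
  refine ⟨⟨G', fun w x => ?_, fun w x x' => ?_⟩, fun w l x => ?_, fun {k} μ H hH w l x => ?_⟩
  · change S.act (chainHom σ hl) (G.1 ((stdSimplex.map θ w, 0), S.act (chainHom σ h0) x)) = _
    rw [G.2.1]
    exact (congrArg _ (S.act_act_chainHom σ _ _ x)).trans (S.act_act_chainHom σ _ hl x)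
  · change S.act (chainHom σ hl) (G.1 ((stdSimplex.map θ w, 1), S.act (chainHom σ h0) x)) =
      S.act (chainHom σ hl) (G.1 ((stdSimplex.map θ w, 1), S.act (chainHom σ h0) x'))
    rw [G.2.2]
  · change _ = S.act (chainHom σ _) (S.act (chainHom σ hl) (G.1 ((stdSimplex.map θ w, l),
      S.act (chainHom σ h0) (S.act (chainHom σ _) x))))
    rw [act_act_chainHom, act_act_chainHom, hid, hid]
  · change S.act (chainHom σ hl) (G.1 ((stdSimplex.map θ (stdSimplex.map μ w), l),
      S.act (chainHom σ h0) x)) = S.act (chainHom σ _) (H.1 ((w, l), S.act (chainHom σ _) x))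
    have h2 := hH w l (S.act (chainHom σ h0) x)
    have h3 : stdSimplex.map (S := ℝ) (θ.comp μ) w = stdSimplex.map θ (stdSimplex.map μ w) := by
      rw [stdSimplex.map_comp_apply]; rfl
    rw [h3] at h2
    rw [h2]
    refine (S.act_act_chainHom σ (Fin.le_last _) hl _).trans ?_
    congr 3
    exact S.act_act_chainHom σ _ _ x

theorem exists_contraction : ∃ G : ∀ n (σ : ComposableArrows A n), S.Contraction n σ,
    ∀ {m n : ℕ} (θ : Fin (m + 1) →o Fin (n + 1)) (σ : ComposableArrows A n),
      S.ContractionRel θ σ (G n σ) (G m (pullChain σ θ)) :=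
  exists_nerve_filling S.Contraction S.ContractionRel S.exists_contraction_extension
    S.contraction_pull

end CoveringSystem

namespace CoveringSystem

variable {A : Type} [Category.{0} A] {Y : Type} [TopologicalSpace Y] (S : CoveringSystem A Y)

/-- Points of the spaces of a covering system. -/
structure Elt where
  idx : A
  pt : S.U idx

variable {S}

instance : Preorder S.Elt where
  le e e' := S.V e.idx ⊆ S.V e'.idx ∧ S.q _ e.pt = S.q _ e'.pt
  le_refl e := ⟨subset_rfl, rfl⟩
  le_trans _ _ _ h k := ⟨h.1.trans k.1, h.2.trans k.2⟩

/-- The morphism connecting two comparable points. -/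
noncomputable def Elt.hom {e e' : S.Elt} (h : e ≤ e') : e.idx ⟶ e'.idx :=
  (S.exists_hom e.pt e'.pt h.1 h.2).choose

theorem Elt.act_hom {e e' : S.Elt} (h : e ≤ e') : S.act (Elt.hom h) e.pt = e'.pt :=
  (S.exists_hom e.pt e'.pt h.1 h.2).choose_spec

theorem Elt.hom_eq {e e' : S.Elt} (h : e ≤ e') (f : e.idx ⟶ e'.idx) (hf : S.act f e.pt = e'.pt) :
    Elt.hom h = f :=
  S.hom_ext _ _ e.pt ((Elt.act_hom h).trans hf.symm)

/-- The chain of morphisms underlying a chain of points. -/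
noncomputable abbrev eltChain {n : ℕ} (a : Fin (n + 1) →o S.Elt) : ComposableArrows A n where
  obj j := (a j).idx
  map f := Elt.hom (a.monotone (leOfHom f))
  map_id j := Elt.hom_eq _ _ (S.act_id _ _)
  map_comp f g := Elt.hom_eq _ _ (by rw [S.act_comp, Elt.act_hom, Elt.act_hom])

theorem eltChain_eq {n : ℕ} (σ : ComposableArrows A n) (u : ∀ j, S.U (σ.obj j))
    (hu : ∀ {i j} (h : i ≤ j), S.act (chainHom σ h) (u i) = u j)
    (a : Fin (n + 1) →o S.Elt) (ha : ∀ j, a j = ⟨σ.obj j, u j⟩) :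
    (⟨eltChain a, (a 0).pt⟩ : Σ τ : ComposableArrows A n, S.U (τ.obj 0)) = ⟨σ, u 0⟩ := by
  obtain ⟨a, hmono⟩ := a
  obtain rfl : a = fun j => ⟨σ.obj j, u j⟩ := funext ha
  have : eltChain ⟨fun j => (⟨σ.obj j, u j⟩ : S.Elt), hmono⟩ = σ := by
    refine Functor.hext (fun j => rfl) fun i j f => heq_of_eq ?_
    exact Elt.hom_eq (hmono (leOfHom f)) _ (hu (leOfHom f))
  exact Sigma.ext this HEq.rfl

variable (S) in
/-- Continuous functions on chains with a starting point and barycentric coordinates. -/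
structure NatFamily (X : Type) [TopologicalSpace X] where
  val : ∀ n (σ : ComposableArrows A n), S.U (σ.obj 0) → stdSimplex ℝ (Fin (n + 1)) → X
  natural : ∀ {m n : ℕ} (θ : Fin (m + 1) →o Fin (n + 1)) (σ : ComposableArrows A n)
    (x : S.U (σ.obj 0)) (w : stdSimplex ℝ (Fin (m + 1))),
    val n σ x (stdSimplex.map θ w) =
      val m (pullChain σ θ) (S.act (chainHom σ (Fin.zero_le (θ 0))) x) w
  cont : ∀ n (σ : ComposableArrows A n),
    Continuous fun z : S.U (σ.obj 0) × stdSimplex ℝ (Fin (n + 1)) => val n σ z.1 z.2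

/-- Finitely supported weights of total mass one. -/
structure IsWeight {I : Type} (t : I → ℝ) : Prop where
  finite : (Function.support t).Finite
  nonneg : ∀ i, 0 ≤ t i
  sum_eq : ∑ᶠ i, t i = 1

theorem IsWeight.exists_rep {I : Type} [LinearOrder I] {t : I → ℝ} (ht : IsWeight t) :
    ∃ (n : ℕ) (θ : Fin (n + 1) →o I) (w : stdSimplex ℝ (Fin (n + 1))), pushWeights θ w = t ∧
      (∀ j, w j = t (θ j)) ∧ StrictMono θ ∧ ∀ j, t (θ j) ≠ 0 := by
  classical
  have hsum : ∑ i ∈ ht.finite.toFinset, t i = 1 := by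
    rw [← ht.sum_eq, finsum_eq_sum _ ht.finite]
  have hne : ht.finite.toFinset.Nonempty := by
    by_contra h
    rw [Finset.not_nonempty_iff_eq_empty.1 h, Finset.sum_empty] at hsum
    exact zero_ne_one hsum
  obtain ⟨n, hn⟩ : ∃ n, ht.finite.toFinset.card = n + 1 :=
    ⟨_, (Nat.succ_pred_eq_of_pos hne.card_pos).symm⟩
  let θ := ht.finite.toFinset.orderEmbOfFin hn
  have hθ : ∀ j, t (θ j) ≠ 0 := fun j =>
    (ht.finite.mem_toFinset).1 (ht.finite.toFinset.orderEmbOfFin_mem hn j)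
  have hw : (fun j => t (θ j)) ∈ stdSimplex ℝ (Fin (n + 1)) := by
    refine ⟨fun j => ht.nonneg _, ?_⟩
    rw [← hsum]
    conv_rhs => rw [← Finset.map_orderEmbOfFin_univ _ hn]
    rw [Finset.sum_map]
    rfl
  refine ⟨n, θ.toOrderHom, ⟨_, hw⟩, ?_, fun j => rfl, θ.strictMono, hθ⟩
  funext i
  by_cases hi : t i = 0
  · rw [hi]
    refine pushWeights_eq_zero _ _ _ ?_
    rintro ⟨j, rfl⟩
    exact hθ j hi
  · have : i ∈ Set.range θ := by
      rw [Finset.range_orderEmbOfFin]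
      exact (ht.finite.mem_toFinset).2 hi
    obtain ⟨j, rfl⟩ := this
    exact pushWeights_apply_of_injective _ θ.injective _ j

namespace NatFamily

variable {X : Type} [TopologicalSpace X] (N : S.NatFamily X)

/-- The value on a chain of points. -/
noncomputable def ofChain {n : ℕ} (a : Fin (n + 1) →o S.Elt) (w : stdSimplex ℝ (Fin (n + 1))) : X :=
  N.val n (eltChain a) (a 0).pt w

theorem ofChain_map {m n : ℕ} (θ : Fin (m + 1) →o Fin (n + 1)) (a : Fin (n + 1) →o S.Elt)
    (w : stdSimplex ℝ (Fin (m + 1))) :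
    N.ofChain a (stdSimplex.map θ w) = N.ofChain (a.comp θ) w := by
  refine (N.natural θ (eltChain a) (a 0).pt w).trans ?_
  exact congrArg (fun x => N.val m (eltChain (a.comp θ)) x w)
    (Elt.act_hom (a.monotone (Fin.zero_le (θ 0))))

theorem ofChain_eq {n : ℕ} (σ : ComposableArrows A n) (u : ∀ j, S.U (σ.obj j))
    (hu : ∀ {i j} (h : i ≤ j), S.act (chainHom σ h) (u i) = u j)
    (a : Fin (n + 1) →o S.Elt) (ha : ∀ j, a j = ⟨σ.obj j, u j⟩)
    (w : stdSimplex ℝ (Fin (n + 1))) : N.ofChain a w = N.val n σ (u 0) w :=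
  congrArg (fun p : Σ τ : ComposableArrows A n, S.U (τ.obj 0) => N.val n p.1 p.2 w)
    (eltChain_eq σ u hu a ha)

/-- Evaluation on weighted points, indexed by a linear order. -/
noncomputable def eval [Nonempty X] {I : Type} [LinearOrder I] (t : I → ℝ) (e : I → S.Elt) : X :=
  Classical.epsilon fun x => ∃ (n : ℕ) (θ : Fin (n + 1) →o I) (w : stdSimplex ℝ (Fin (n + 1)))
    (h : Monotone (e ∘ θ)), pushWeights θ w = t ∧ N.ofChain ⟨e ∘ θ, h⟩ w = x

variable [Nonempty X] {I I' : Type} [LinearOrder I] [LinearOrder I']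

theorem eval_eq {n : ℕ} (θ : Fin (n + 1) →o I) (w : stdSimplex ℝ (Fin (n + 1))) {t : I → ℝ}
    {e : I → S.Elt} (ht : pushWeights θ w = t) (h : Monotone (e ∘ θ)) :
    N.eval t e = N.ofChain ⟨e ∘ θ, h⟩ w := by
  obtain ⟨m, θ', w', h', ht', hx⟩ := Classical.epsilon_spec
    (p := fun x => ∃ (n : ℕ) (θ : Fin (n + 1) →o I) (w : stdSimplex ℝ (Fin (n + 1)))
      (h : Monotone (e ∘ θ)), pushWeights θ w = t ∧ N.ofChain ⟨e ∘ θ, h⟩ w = x)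
    ⟨_, n, θ, w, h, ht, rfl⟩
  refine hx.symm.trans ?_
  exact rep_independent (fun {n} (θ : Fin (n + 1) →o I) => Monotone (e ∘ θ))
    (fun θ μ h => h.comp μ.monotone) (fun θ h w => N.ofChain ⟨e ∘ θ, h⟩ w)
    (fun θ μ h v => N.ofChain_map μ _ v) θ' h' w' θ h w (ht'.trans ht.symm)

theorem monotone_rep {t : I → ℝ} {e : I → S.Elt}
    (he : ∀ i i', i ≤ i' → t i ≠ 0 → t i' ≠ 0 → e i ≤ e i') {n : ℕ} (θ : Fin (n + 1) →o I)
    (hθ : ∀ j, t (θ j) ≠ 0) : Monotone (e ∘ θ) :=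
  fun i j h => he _ _ (θ.monotone h) (hθ i) (hθ j)

theorem pushWeights_comp_rep {n : ℕ} (θ : Fin (n + 1) →o I) (w : stdSimplex ℝ (Fin (n + 1)))
    {t : I → ℝ} (ht : pushWeights θ w = t) (hθ : ∀ j, t (θ j) ≠ 0) (τ : I → I') (T : Finset I)
    (hT : ∀ i, t i ≠ 0 → i ∈ T) (i' : I') :
    pushWeights (τ ∘ θ) w i' = ∑ i ∈ T, if τ i = i' then t i else 0 := by
  have h1 : ∀ i, (if τ i = i' then t i else 0) =
      ∑ j, if θ j = i then (if τ (θ j) = i' then w j else 0) else 0 := by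
    intro i
    rw [← ht]
    unfold pushWeights
    split_ifs with h
    · refine Finset.sum_congr rfl fun j _ => ?_
      by_cases hj : θ j = i
      · rw [if_pos hj, if_pos hj, if_pos (by rw [hj, h])]
      · rw [if_neg hj, if_neg hj]
    · refine (Finset.sum_eq_zero fun j _ => ?_).symm
      by_cases hj : θ j = i
      · rw [if_pos hj, if_neg (by rw [hj]; exact h)]
      · rw [if_neg hj]
  rw [Finset.sum_congr rfl fun i _ => h1 i, Finset.sum_comm]
  unfold pushWeights
  refine Finset.sum_congr rfl fun j _ => ?_
  rw [Finset.sum_ite_eq, if_pos (hT _ (hθ j))]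
  rfl

/-- Functoriality of the evaluation in the index set. -/
theorem eval_push {t : I → ℝ} {e : I → S.Elt} (ht : IsWeight t)
    (he : ∀ i i', i ≤ i' → t i ≠ 0 → t i' ≠ 0 → e i ≤ e i')
    {t' : I' → ℝ} {e' : I' → S.Elt} (τ : I →o I') (T : Finset I) (hT : ∀ i, t i ≠ 0 → i ∈ T)
    (ht' : ∀ i', t' i' = ∑ i ∈ T, if τ i = i' then t i else 0)
    (he' : ∀ i, t i ≠ 0 → e' (τ i) = e i) : N.eval t' e' = N.eval t e := by
  obtain ⟨n, θ, w, hw, -, -, hθ⟩ := ht.exists_rep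
  have h1 := monotone_rep he θ hθ
  have h2 : e' ∘ (τ.comp θ) = e ∘ θ := funext fun j => he' _ (hθ j)
  rw [N.eval_eq θ w hw h1, N.eval_eq (τ.comp θ) w (t := t') (e := e')
    (funext fun i' => (pushWeights_comp_rep θ w hw hθ τ T hT i').trans (ht' i').symm)
    (by rw [h2]; exact h1)]
  congr 1
  exact OrderHom.ext _ _ h2

end NatFamily

end CoveringSystem

namespace CoveringSystem

variable {A : Type} [Category.{0} A] {Y : Type} [TopologicalSpace Y] {S : CoveringSystem A Y}

/-- Two continuous lifts to the same space agreeing at a point agree nearby. -/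
theorem eventually_lift_eq {Z : Type} [TopologicalSpace Z] {α : A} {u v : Z → S.U α} {W : Set Z}
    {z₀ : Z} (hu : ContinuousWithinAt u W z₀) (hv : ContinuousWithinAt v W z₀)
    (h₀ : u z₀ = v z₀) (hq : ∀ z ∈ W, S.q α (u z) = S.q α (v z)) :
    ∀ᶠ z in nhdsWithin z₀ W, u z = v z := by
  obtain ⟨O, hO, hinj⟩ := S.exists_injOn α (u z₀)
  filter_upwards [hu hO, hv (h₀ ▸ hO), self_mem_nhdsWithin] with z h1 h2 hz
  exact hinj h1 h2 (hq z hz)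

/-- Continuous families of weighted points. -/
structure WeightedFamily (S : CoveringSystem A Y) {Z I : Type} [TopologicalSpace Z] [LinearOrder I]
    (y : Z → Y) (m : I → A) (t : I → Z → ℝ) (u : ∀ i, Z → S.U (m i)) (D : I → Set Z) : Prop where
  cont : ∀ i, Continuous (t i)
  locallyFinite : LocallyFinite fun i => Function.support (t i)
  nonneg : ∀ i z, 0 ≤ t i z
  sum_eq : ∀ z, ∑ᶠ i, t i z = 1
  isClosed : ∀ i, IsClosed (D i)
  mem : ∀ i z, t i z ≠ 0 → z ∈ D i
  contOn : ∀ i, ContinuousOn (u i) (D i)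
  q_eq : ∀ i, ∀ z ∈ D i, S.q (m i) (u i z) = y z
  subset : ∀ z i i', i ≤ i' → t i z ≠ 0 → t i' z ≠ 0 → S.V (m i) ⊆ S.V (m i')

namespace WeightedFamily

variable {X Z I : Type} [TopologicalSpace X] [TopologicalSpace Z] [LinearOrder I]
  {y : Z → Y} {m : I → A} {t : I → Z → ℝ} {u : ∀ i, Z → S.U (m i)} {D : I → Set Z}

theorem isWeight (H : WeightedFamily S y m t u D) (z : Z) : IsWeight fun i => t i z where
  finite := H.locallyFinite.point_finite z
  nonneg i := H.nonneg i z
  sum_eq := H.sum_eq z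

theorem le (H : WeightedFamily S y m t u D) (z : Z) (i i' : I) (h : i ≤ i') (hi : t i z ≠ 0)
    (hi' : t i' z ≠ 0) : (⟨m i, u i z⟩ : S.Elt) ≤ ⟨m i', u i' z⟩ :=
  ⟨H.subset z i i' h hi hi', (H.q_eq i z (H.mem i z hi)).trans (H.q_eq i' z (H.mem i' z hi')).symm⟩

theorem continuousWithinAt_eval [Nonempty X] (N : S.NatFamily X)
    (H : WeightedFamily S y m t u D) (J q : Finset I) (hq : q.Nonempty) (z₀ : Z)
    (hJ : ∀ᶠ z in nhds z₀, ∀ i ∉ J, t i z = 0)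
    (hV : ∀ i ∈ q, ∀ i' ∈ q, i ≤ i' → S.V (m i) ⊆ S.V (m i')) (W : Set Z)
    (hW : ∀ z ∈ W, ∀ i ∈ J, i ∉ q → t i z = 0) (hWD : ∀ i ∈ q, W ⊆ D i) (hz₀ : z₀ ∈ W) :
    ContinuousWithinAt (fun z => N.eval (fun i => t i z) fun i => ⟨m i, u i z⟩) W z₀ := by
  classical
  obtain ⟨n, hn⟩ : ∃ n, q.card = n + 1 := ⟨_, (Nat.succ_pred_eq_of_pos hq.card_pos).symm⟩
  let θ : Fin (n + 1) →o I := (q.orderEmbOfFin hn).toOrderHom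
  have hθq : ∀ j, θ j ∈ q := fun j => q.orderEmbOfFin_mem hn j
  have hqz : ∀ j, ∀ z ∈ W, S.q _ (u (θ j) z) = y z := fun j z hz =>
    H.q_eq _ z (hWD _ (hθq j) hz)
  have hle : ∀ z ∈ W, ∀ i j, i ≤ j →
      (⟨m (θ i), u (θ i) z⟩ : S.Elt) ≤ ⟨m (θ j), u (θ j) z⟩ := fun z hz i j h =>
    ⟨hV _ (hθq i) _ (hθq j) (θ.monotone h), (hqz i z hz).trans (hqz j z hz).symm⟩
  let σ : ComposableArrows A n := eltChain ⟨fun j => ⟨m (θ j), u (θ j) z₀⟩, fun i j h =>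
    hle z₀ hz₀ i j h⟩
  have hcu : ∀ j, ContinuousWithinAt (u (θ j)) W z₀ := fun j =>
    ((H.contOn _).mono (hWD _ (hθq j))) z₀ hz₀
  have hact : ∀ᶠ z in nhdsWithin z₀ W, ∀ i j, ∀ h : i ≤ j,
      S.act (chainHom σ h) (u (θ i) z) = u (θ j) z := by
    rw [Filter.eventually_all]; intro i
    rw [Filter.eventually_all]; intro j
    rw [Filter.eventually_all]; intro h
    refine eventually_lift_eq
      ((S.act (chainHom σ h)).continuous.continuousAt.comp_continuousWithinAt
      (hcu i)) (hcu j) ?_ ?_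
    · exact Elt.act_hom (hle z₀ hz₀ i j h)
    · intro z hz
      exact (S.q_act _ _).trans ((hqz i z hz).trans (hqz j z hz).symm)
  have hJ' : ∀ᶠ z in nhdsWithin z₀ W, ∀ i ∉ q, t i z = 0 := by
    filter_upwards [nhdsWithin_le_nhds hJ, self_mem_nhdsWithin] with z h1 h2 i hi
    by_cases h : i ∈ J
    · exact hW z h2 i h hi
    · exact h1 i h
  have hmem : ∀ z, (∀ i ∉ q, t i z = 0) →
      (fun j => t (θ j) z) ∈ stdSimplex ℝ (Fin (n + 1)) := by
    intro z hz
    refine ⟨fun j => H.nonneg _ _, ?_⟩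
    rw [← H.sum_eq z, finsum_eq_sum_of_support_subset (s := q) _ fun i hi => by
      by_contra h; exact hi (hz i h)]
    conv_rhs => rw [← Finset.map_orderEmbOfFin_univ _ hn]
    rw [Finset.sum_map]
    rfl
  let w : Z → stdSimplex ℝ (Fin (n + 1)) := fun z =>
    if h : (fun j => t (θ j) z) ∈ stdSimplex ℝ (Fin (n + 1)) then ⟨_, h⟩ else Classical.arbitrary _
  have hwt : ∀ z, (∀ i ∉ q, t i z = 0) → (w z : Fin (n + 1) → ℝ) = fun j => t (θ j) z :=
    fun z hz => by
      have : w z = ⟨_, hmem z hz⟩ := dif_pos (hmem z hz)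
      rw [this]
      rfl
  have hwc : ContinuousWithinAt w W z₀ := by
    rw [Topology.IsInducing.subtypeVal.continuousWithinAt_iff]
    have h1 : ContinuousWithinAt (fun z j => t (θ j) z) W z₀ :=
      (continuous_pi fun j => H.cont (θ j)).continuousWithinAt
    refine h1.congr_of_eventuallyEq ?_ ?_
    · filter_upwards [hJ'] with z hz
      exact hwt z hz
    · exact hwt z₀ (hJ'.self_of_nhdsWithin hz₀)
  have heval : ∀ᶠ z in nhdsWithin z₀ W, N.eval (fun i => t i z) (fun i => ⟨m i, u i z⟩) =
      N.val n σ (u (θ 0) z) (w z) := by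
    filter_upwards [hact, hJ', self_mem_nhdsWithin] with z h1 h2 h3
    have hmono : Monotone ((fun i => (⟨m i, u i z⟩ : S.Elt)) ∘ θ) := fun i j h => hle z h3 i j h
    rw [N.eval_eq θ (w z) ?_ hmono]
    · exact N.ofChain_eq σ (fun j => u (θ j) z) (fun h => h1 _ _ h) _ (fun j => rfl) (w z)
    · funext i
      by_cases hi : i ∈ q
      · rw [← Finset.mem_coe, ← Finset.range_orderEmbOfFin q hn] at hi
        obtain ⟨j, rfl⟩ := hi
        exact (pushWeights_apply_of_injective θ (q.orderEmbOfFin hn).injective (w z) j).trans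
          (congrFun (hwt z h2) j)
      · rw [h2 i hi]
        refine pushWeights_eq_zero _ _ _ ?_
        rintro ⟨j, rfl⟩
        exact hi (hθq j)
  refine ContinuousWithinAt.congr_of_eventuallyEq ?_ heval (heval.self_of_nhdsWithin hz₀)
  exact (N.cont n σ).continuousAt.comp_continuousWithinAt
    (f := fun z => (u (θ 0) z, w z)) ((hcu 0).prodMk hwc)

theorem continuous_eval [Nonempty X] (N : S.NatFamily X) (H : WeightedFamily S y m t u D) :
    Continuous fun z => N.eval (fun i => t i z) fun i => ⟨m i, u i z⟩ := by
  classical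
  rw [continuous_iff_continuousAt]
  intro z₀
  obtain ⟨O, hO, hfin⟩ := H.locallyFinite z₀
  let J := hfin.toFinset
  have hJ : ∀ z ∈ O, ∀ i ∉ J, t i z = 0 := fun z hz i hi => by
    by_contra h
    exact hi (hfin.mem_toFinset.2 ⟨z, h, hz⟩)
  let Q : Set (Finset I) := {q | q ⊆ J ∧ ∃ z, ∀ i, i ∈ q ↔ t i z ≠ 0}
  have hQ : Q.Finite := J.powerset.finite_toSet.subset fun q hq =>
    Finset.mem_coe.2 (Finset.mem_powerset.2 hq.1)
  let W : Finset I → Set Z := fun q =>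
    (⋂ i ∈ J, ⋂ (_ : i ∉ q), {z | t i z = 0}) ∩ ⋂ i ∈ q, D i
  have hWc : ∀ q, IsClosed (W q) := fun q =>
    (isClosed_biInter fun i _ => isClosed_iInter fun _ =>
      isClosed_eq (H.cont i) continuous_const).inter (isClosed_biInter fun i _ => H.isClosed i)
  have hcov : O ⊆ ⋃ q ∈ Q, W q := by
    intro z hz
    have hfin' := H.locallyFinite.point_finite z
    refine Set.mem_biUnion (x := hfin'.toFinset) ⟨fun i hi => ?_, z, fun i => ?_⟩ ⟨?_, ?_⟩
    · by_contra h
      exact hfin'.mem_toFinset.1 hi (hJ z hz i h)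
    · exact hfin'.mem_toFinset
    · simp only [Set.mem_iInter]
      intro i _ hi
      by_contra h
      exact hi (hfin'.mem_toFinset.2 h)
    · simp only [Set.mem_iInter]
      intro i hi
      exact H.mem i z (hfin'.mem_toFinset.1 hi)
  rw [← continuousWithinAt_univ]
  have hwithin : ContinuousWithinAt (fun z => N.eval (fun i => t i z) fun i => ⟨m i, u i z⟩)
      (⋃ q ∈ Q, W q) z₀ := by
    rw [ContinuousWithinAt, nhdsWithin_biUnion hQ, Filter.tendsto_iSup]
    intro q
    rw [Filter.tendsto_iSup]
    intro hq
    by_cases hz₀ : z₀ ∈ W q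
    · obtain ⟨-, z₁, hz₁⟩ := hq
      refine H.continuousWithinAt_eval N J q ?_ z₀ ?_ ?_ (W q) ?_ ?_ hz₀
      · by_contra h
        have h1 := H.sum_eq z₁
        rw [finsum_eq_zero_of_forall_eq_zero] at h1
        · exact zero_ne_one h1
        · intro i
          by_contra hi
          exact h ⟨i, (hz₁ i).2 hi⟩
      · filter_upwards [hO] with z hz using hJ z hz
      · exact fun i hi i' hi' h => H.subset z₁ i i' h ((hz₁ i).1 hi) ((hz₁ i').1 hi')
      · intro z hz i hi hiq
        have h1 := hz.1
        simp only [Set.mem_iInter] at h1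
        exact h1 i hi hiq
      · intro i hi z hz
        have h1 := hz.2
        simp only [Set.mem_iInter] at h1
        exact h1 i hi
    · have : nhdsWithin z₀ (W q) = ⊥ := by
        rw [← Filter.not_neBot, ← mem_closure_iff_nhdsWithin_neBot, (hWc q).closure_eq]
        exact hz₀
      rw [this]
      exact Filter.tendsto_bot
  exact hwithin.continuousAt (Filter.mem_of_superset hO hcov) |>.continuousWithinAt

end WeightedFamily

end CoveringSystem

section UnitMass

open MeasureTheory Set Filter Topology

/-- The Lebesgue measure of the part of a set in the half-open unit interval. -/
noncomputable def unitMass (P : Set ℝ) : ℝ := volume.real (P ∩ Ioc 0 1)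

theorem unitMass_nonneg (P : Set ℝ) : 0 ≤ unitMass P := measureReal_nonneg

theorem inter_Ioc_ne_top (P : Set ℝ) : volume (P ∩ Ioc 0 1) ≠ ⊤ :=
  ((measure_mono inter_subset_right).trans_lt measure_Ioc_lt_top).ne

theorem unitMass_mono {P Q : Set ℝ} (h : ∀ x ∈ Ioc (0 : ℝ) 1, x ∈ P → x ∈ Q) :
    unitMass P ≤ unitMass Q :=
  measureReal_mono (fun x hx => ⟨h x hx.2 hx.1, hx.2⟩) (inter_Ioc_ne_top Q)

theorem unitMass_congr {P Q : Set ℝ} (h : ∀ x ∈ Ioc (0 : ℝ) 1, x ∈ P ↔ x ∈ Q) :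
    unitMass P = unitMass Q :=
  (unitMass_mono fun x hx => (h x hx).1).antisymm (unitMass_mono fun x hx => (h x hx).2)

theorem unitMass_union_le (P Q : Set ℝ) : unitMass (P ∪ Q) ≤ unitMass P + unitMass Q := by
  unfold unitMass
  rw [union_inter_distrib_right]
  exact measureReal_union_le _ _

theorem unitMass_univ : unitMass univ = 1 := by
  simp [unitMass]

theorem unitMass_empty : unitMass ∅ = 0 := by
  simp [unitMass]

theorem exists_mem_of_unitMass_ne_zero {P : Set ℝ} (h : unitMass P ≠ 0) :
    ∃ x ∈ Ioc (0 : ℝ) 1, x ∈ P := by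
  by_contra! hc
  exact h ((unitMass_congr fun x hx => ⟨fun hP => hc x hx hP, fun hP => hP.elim⟩).trans
    unitMass_empty)

theorem unitMass_uIoc_le (a b : ℝ) : unitMass (uIoc a b) ≤ |b - a| := by
  have h : volume.real (uIoc a b) = |b - a| := by
    rw [measureReal_def, Real.volume_uIoc, ENNReal.toReal_ofReal (abs_nonneg _)]
  rw [← h]
  exact measureReal_mono inter_subset_left (by simp)

theorem sum_unitMass {I : Type} (T : Finset I) (R : I → Set ℝ) (Q : Set ℝ)
    (hR : ∀ i, MeasurableSet (R i)) (hQ : ∀ x ∈ Ioc (0 : ℝ) 1, x ∈ Q ↔ ∃ i ∈ T, x ∈ R i)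
    (hd : ∀ x ∈ Ioc (0 : ℝ) 1, ∀ i i', x ∈ R i → x ∈ R i' → i = i') :
    ∑ i ∈ T, unitMass (R i) = unitMass Q := by
  rw [unitMass_congr (Q := ⋃ i ∈ T, R i) (by simpa using hQ)]
  unfold unitMass
  rw [iUnion₂_inter, measureReal_biUnion_finset (h := fun i _ => inter_Ioc_ne_top (R i))]
  · intro i _ i' _ hne
    refine Set.disjoint_left.2 fun x hx hx' => hne (hd x hx.2 i i' hx.1 hx'.1)
  · exact fun i _ => (hR i).inter measurableSet_Ioc

variable {Z : Type} [TopologicalSpace Z]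

/-- Families of sets varying continuously in measure. -/
def ContSetAt (P : Z → Set ℝ) (z₀ : Z) : Prop :=
  Tendsto (fun z => unitMass (symmDiff (P z) (P z₀))) (𝓝 z₀) (𝓝 0)

variable {P Q : Z → Set ℝ} {z₀ : Z}

theorem ContSetAt.of_le {f : Z → ℝ} (hf : Tendsto f (𝓝 z₀) (𝓝 0))
    (h : ∀ᶠ z in 𝓝 z₀, unitMass (symmDiff (P z) (P z₀)) ≤ f z) : ContSetAt P z₀ :=
  squeeze_zero' (Eventually.of_forall fun _ => unitMass_nonneg _) h hf

theorem abs_unitMass_sub_le (P Q : Set ℝ) :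
    |unitMass P - unitMass Q| ≤ unitMass (symmDiff P Q) := by
  have h1 : ∀ P Q : Set ℝ, unitMass P ≤ unitMass Q + unitMass (symmDiff P Q) := fun P Q =>
    (unitMass_mono fun x _ hx => by
      by_cases hQ : x ∈ Q
      · exact Or.inl hQ
      · exact Or.inr (Or.inl ⟨hx, hQ⟩)).trans (unitMass_union_le _ _)
  rw [abs_le]
  have h2 := h1 P Q
  have h3 := h1 Q P
  rw [symmDiff_comm] at h3
  constructor <;> linarith

theorem ContSetAt.continuousAt (h : ContSetAt P z₀) :
    ContinuousAt (fun z => unitMass (P z)) z₀ := by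
  rw [ContinuousAt, tendsto_iff_dist_tendsto_zero]
  exact squeeze_zero (fun _ => dist_nonneg) (fun z => abs_unitMass_sub_le _ _) h

theorem ContSetAt.congr (h : ContSetAt P z₀)
    (hPQ : ∀ᶠ z in 𝓝 z₀, ∀ x ∈ Ioc (0 : ℝ) 1, x ∈ Q z ↔ x ∈ P z) : ContSetAt Q z₀ := by
  refine ContSetAt.of_le h ?_
  filter_upwards [hPQ] with z hz
  refine (unitMass_congr fun x hx => ?_).le
  have h1 := hz x hx
  have h2 := hPQ.self_of_nhds x hx
  simp only [mem_symmDiff, h1, h2]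

theorem contSetAt_const (P : Set ℝ) : ContSetAt (fun _ : Z => P) z₀ := by
  refine ContSetAt.of_le tendsto_const_nhds (Eventually.of_forall fun z => ?_)
  rw [symmDiff_self]
  exact unitMass_empty.le

theorem ContSetAt.compl (h : ContSetAt P z₀) : ContSetAt (fun z => (P z)ᶜ) z₀ := by
  refine ContSetAt.of_le h (Eventually.of_forall fun z => (unitMass_congr fun x _ => ?_).le)
  simp only [mem_symmDiff, mem_compl_iff]
  tauto

theorem ContSetAt.inter (hP : ContSetAt P z₀) (hQ : ContSetAt Q z₀) :
    ContSetAt (fun z => P z ∩ Q z) z₀ := by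
  refine ContSetAt.of_le (by simpa using Tendsto.add hP hQ) (Eventually.of_forall fun z => ?_)
  refine (unitMass_mono fun x _ hx => ?_).trans (unitMass_union_le _ _)
  simp only [mem_symmDiff, mem_inter_iff, mem_union] at hx ⊢
  tauto

theorem ContSetAt.union (hP : ContSetAt P z₀) (hQ : ContSetAt Q z₀) :
    ContSetAt (fun z => P z ∪ Q z) z₀ := by
  have := (hP.compl.inter hQ.compl).compl
  simpa only [compl_inter, compl_compl] using this

theorem contSetAt_setOf_le {h : Z → ℝ} (hh : ContinuousAt h z₀) :
    ContSetAt (fun z => {x | x ≤ h z}) z₀ := by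
  have h1 : Tendsto (fun z => |h z₀ - h z|) (𝓝 z₀) (𝓝 0) := by
    have h2 : ContinuousAt (fun z => |h z₀ - h z|) z₀ := (continuousAt_const.sub hh).abs
    simpa [ContinuousAt] using h2
  refine ContSetAt.of_le h1 (Eventually.of_forall fun z => ?_)
  refine le_trans (unitMass_mono fun x _ hx => ?_) (unitMass_uIoc_le _ _)
  rcases hx with ⟨h2, h3⟩ | ⟨h2, h3⟩
  · rw [uIoc_comm]
    exact Set.Ioc_subset_uIoc ⟨not_le.1 h3, h2⟩
  · exact Set.Ioc_subset_uIoc ⟨not_le.1 h3, h2⟩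

theorem contSetAt_setOf_lt {h : Z → ℝ} (hh : ContinuousAt h z₀) :
    ContSetAt (fun z => {x | h z < x}) z₀ :=
  (contSetAt_setOf_le hh).compl.congr (Eventually.of_forall fun z x _ => by simp)

theorem contSetAt_forall {I : Type} {P : I → Z → Set ℝ} (J : Finset I)
    (h : ∀ i ∈ J, ContSetAt (P i) z₀) : ContSetAt (fun z => {x | ∀ i ∈ J, x ∈ P i z}) z₀ := by
  classical
  induction J using Finset.induction_on with
  | empty => exact (contSetAt_const univ).congr (Eventually.of_forall fun z x _ => by simp)
  | insert i J hi ih =>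
    refine ((h i (Finset.mem_insert_self i J)).inter
      (ih fun j hj => h j (Finset.mem_insert_of_mem hj))).congr
      (Eventually.of_forall fun z x _ => ?_)
    simp

theorem contSetAt_exists {I : Type} {P : I → Z → Set ℝ} (J : Finset I)
    (h : ∀ i ∈ J, ContSetAt (P i) z₀) : ContSetAt (fun z => {x | ∃ i ∈ J, x ∈ P i z}) z₀ := by
  refine (contSetAt_forall J fun i hi => (h i hi).compl).compl.congr
    (Eventually.of_forall fun z x _ => ?_)
  simp

end UnitMass

section Slots

open Set Filter Topology

variable {n : ℕ}

/-- The total weight of the vertices satisfying a predicate. -/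
noncomputable def partWeight (w : stdSimplex ℝ (Fin (n + 1))) (p : Fin (n + 1) → Prop) : ℝ :=
  open Classical in ∑ i, if p i then w i else 0

theorem partWeight_map {m : ℕ} (θ : Fin (m + 1) → Fin (n + 1)) (w : stdSimplex ℝ (Fin (m + 1)))
    (p : Fin (n + 1) → Prop) :
    partWeight (stdSimplex.map θ w) p = partWeight w (p ∘ θ) := by
  classical
  unfold partWeight
  have : ∀ i, (if p i then stdSimplex.map θ w i else 0) =
      ∑ j, if θ j = i then (if p (θ j) then w j else 0) else 0 := by
    intro i
    rw [stdSimplex_map_apply]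
    split_ifs with h
    · refine Finset.sum_congr rfl fun j _ => ?_
      split_ifs with h1 h2
      · rfl
      · exact (h2 (h1 ▸ h)).elim
      · rfl
    · refine (Finset.sum_eq_zero fun j _ => ?_).symm
      split_ifs with h1 h2
      · exact (h (h1 ▸ h2)).elim
      · rfl
      · rfl
  rw [Finset.sum_congr rfl fun i _ => this i, Finset.sum_comm]
  refine Finset.sum_congr rfl fun j _ => ?_
  simp [Finset.sum_ite_eq]

theorem partWeight_mono (w : stdSimplex ℝ (Fin (n + 1))) {p p' : Fin (n + 1) → Prop}
    (h : ∀ i, p i → p' i) : partWeight w p ≤ partWeight w p' := by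
  classical
  refine Finset.sum_le_sum fun i _ => ?_
  split_ifs with h1 h2 h2
  · exact le_rfl
  · exact (h2 (h i h1)).elim
  · exact stdSimplex.zero_le w i
  · exact le_rfl

theorem partWeight_true (w : stdSimplex ℝ (Fin (n + 1))) {p : Fin (n + 1) → Prop}
    (h : ∀ i, p i) : partWeight w p = 1 := by
  unfold partWeight
  rw [← stdSimplex.sum_eq_one w]
  exact Finset.sum_congr rfl fun i _ => if_pos (h i)

theorem partWeight_false (w : stdSimplex ℝ (Fin (n + 1))) {p : Fin (n + 1) → Prop}
    (h : ∀ i, ¬ p i) : partWeight w p = 0 :=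
  Finset.sum_eq_zero fun i _ => if_neg (h i)

@[fun_prop]
theorem continuous_partWeight (p : Fin (n + 1) → Prop) :
    Continuous fun w : stdSimplex ℝ (Fin (n + 1)) => partWeight w p := by
  classical
  refine continuous_finsetSum _ fun i _ => ?_
  split_ifs
  · exact continuous_stdSimplex_apply i
  · exact continuous_const

/-- The parameter `x` lies in the subinterval of the unit interval belonging to the vertex `j`. -/
def InSlot (w : stdSimplex ℝ (Fin (n + 1))) (x : ℝ) (j : Fin (n + 1)) : Prop :=
  partWeight w (· < j) < x ∧ x ≤ partWeight w (· ≤ j)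

theorem InSlot.unique {w : stdSimplex ℝ (Fin (n + 1))} {x : ℝ} {j j' : Fin (n + 1)}
    (h : InSlot w x j) (h' : InSlot w x j') : j = j' := by
  have key : ∀ {j j'}, InSlot w x j → InSlot w x j' → ¬ j < j' := fun {j j'} h h' hlt =>
    absurd (h.2.trans (partWeight_mono w fun i hi => hi.trans_lt hlt)) (not_le.2 h'.1)
  exact le_antisymm (not_lt.1 (key h' h)) (not_lt.1 (key h h'))

theorem InSlot.le {w : stdSimplex ℝ (Fin (n + 1))} {x x' : ℝ} (hx : x ≤ x') {j j' : Fin (n + 1)}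
    (h : InSlot w x j) (h' : InSlot w x' j') : j ≤ j' := by
  by_contra hlt
  refine absurd (h'.2.trans (partWeight_mono w (p' := (· < j)) fun i hi =>
    lt_of_le_of_lt hi (not_le.1 hlt))) (not_le.2 (h.1.trans_le hx))

theorem exists_inSlot (w : stdSimplex ℝ (Fin (n + 1))) {x : ℝ} (hx : x ∈ Ioc (0 : ℝ) 1) :
    ∃ j, InSlot w x j := by
  have hne : ∃ j, x ≤ partWeight w (· ≤ j) :=
    ⟨Fin.last n, by rw [partWeight_true w fun i => Fin.le_last i]; exact hx.2⟩
  obtain ⟨j, hj, hmin⟩ := WellFounded.has_min (wellFounded_lt (α := Fin (n + 1)))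
    {j | x ≤ partWeight w (· ≤ j)} hne
  refine ⟨j, ?_, hj⟩
  rcases Fin.eq_zero_or_eq_succ j with rfl | ⟨k, rfl⟩
  · rw [partWeight_false w fun i => Fin.not_lt_zero i]
    exact hx.1
  · have h1 : ¬ x ≤ partWeight w (· ≤ k.castSucc) := fun h =>
      hmin k.castSucc h Fin.castSucc_lt_succ
    exact (partWeight_mono w fun i hi => Fin.le_castSucc_iff.2 hi).trans_lt (not_le.1 h1)

theorem InSlot.map {m : ℕ} (θ : Fin (m + 1) →o Fin (n + 1)) {w : stdSimplex ℝ (Fin (m + 1))}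
    {x : ℝ} {j : Fin (m + 1)} (h : InSlot w x j) : InSlot (stdSimplex.map θ w) x (θ j) := by
  constructor
  · rw [partWeight_map]
    exact (partWeight_mono w fun i hi => θ.monotone.reflect_lt hi).trans_lt h.1
  · rw [partWeight_map]
    exact h.2.trans (partWeight_mono w fun i hi => θ.monotone hi)

theorem inSlot_map_iff {m : ℕ} (θ : Fin (m + 1) →o Fin (n + 1)) (w : stdSimplex ℝ (Fin (m + 1)))
    {x : ℝ} (hx : x ∈ Ioc (0 : ℝ) 1) (i : Fin (n + 1)) :
    InSlot (stdSimplex.map θ w) x i ↔ ∃ j, θ j = i ∧ InSlot w x j := by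
  constructor
  · intro h
    obtain ⟨j, hj⟩ := exists_inSlot w hx
    exact ⟨j, (hj.map θ).unique h, hj⟩
  · rintro ⟨j, rfl, hj⟩
    exact hj.map θ

/-- The parameters sent to the slot of a vertex by an affine reparametrization onto an interval of
length one half. -/
def slotSet (a : ℝ) (w : stdSimplex ℝ (Fin (n + 1))) (j : Fin (n + 1)) : Set ℝ :=
  {x | InSlot w (a + x / 2) j}

theorem slotSet_eq (a : ℝ) (w : stdSimplex ℝ (Fin (n + 1))) (j : Fin (n + 1)) :
    slotSet a w j = {x | 2 * (partWeight w (· < j) - a) < x} ∩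
      {x | x ≤ 2 * (partWeight w (· ≤ j) - a)} := by
  ext x
  simp only [slotSet, InSlot, Set.mem_ofPred_eq, mem_inter_iff]
  constructor <;> rintro ⟨h1, h2⟩ <;> constructor <;> linarith

theorem measurableSet_slotSet (a : ℝ) (w : stdSimplex ℝ (Fin (n + 1))) (j : Fin (n + 1)) :
    MeasurableSet (slotSet a w j) := by
  rw [slotSet_eq]
  exact measurableSet_Ioi.inter measurableSet_Iic

theorem contSetAt_slotSet {Z : Type} [TopologicalSpace Z] (a : ℝ)
    {w : Z → stdSimplex ℝ (Fin (n + 1))} (hw : Continuous w) (j : Fin (n + 1)) (z₀ : Z) :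
    ContSetAt (fun z => slotSet a (w z) j) z₀ := by
  simp only [slotSet_eq]
  exact (contSetAt_setOf_lt (by fun_prop)).inter (contSetAt_setOf_le (by fun_prop))

theorem half_mem {a x : ℝ} (ha : 0 ≤ a) (ha' : a ≤ 1 / 2) (hx : x ∈ Ioc (0 : ℝ) 1) :
    a + x / 2 ∈ Ioc (0 : ℝ) 1 :=
  ⟨by linarith [hx.1], by linarith [hx.2]⟩

/-- Barycentric coordinates read off from an interval of length one half. -/
noncomputable def resampling (a : ℝ) (ha : 0 ≤ a ∧ a ≤ 1 / 2) (w : stdSimplex ℝ (Fin (n + 1))) :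
    stdSimplex ℝ (Fin (n + 1)) :=
  ⟨fun j => unitMass (slotSet a w j), fun j => unitMass_nonneg _, by
    rw [sum_unitMass Finset.univ (slotSet a w) univ (measurableSet_slotSet a w), unitMass_univ]
    · intro x hx
      refine ⟨fun _ => ?_, fun _ => mem_univ x⟩
      obtain ⟨j, hj⟩ := exists_inSlot w (half_mem ha.1 ha.2 hx)
      exact ⟨j, Finset.mem_univ j, hj⟩
    · exact fun x _ i i' h h' => InSlot.unique h h'⟩

theorem resample_apply (a : ℝ) (ha : 0 ≤ a ∧ a ≤ 1 / 2) (w : stdSimplex ℝ (Fin (n + 1)))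
    (j : Fin (n + 1)) : resampling a ha w j = unitMass (slotSet a w j) := rfl

theorem continuous_resampling (a : ℝ) (ha : 0 ≤ a ∧ a ≤ 1 / 2) :
    Continuous (resampling (n := n) a ha) :=
  Continuous.subtype_mk (continuous_pi fun j => continuous_iff_continuousAt.2 fun z₀ =>
    (contSetAt_slotSet a continuous_id j z₀).continuousAt) _

theorem resample_map {m : ℕ} (a : ℝ) (ha : 0 ≤ a ∧ a ≤ 1 / 2) (θ : Fin (m + 1) →o Fin (n + 1))
    (w : stdSimplex ℝ (Fin (m + 1))) :
    resampling a ha (stdSimplex.map θ w) = stdSimplex.map θ (resampling a ha w) := by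
  ext i
  rw [stdSimplex_map_apply, resample_apply, ← Finset.sum_filter]
  refine (sum_unitMass _ (slotSet a w) _ (measurableSet_slotSet a w) (fun x hx => ?_)
    (fun x _ i i' h h' => InSlot.unique h h')).symm
  simp only [Finset.mem_filter, Finset.mem_univ, true_and]
  exact inSlot_map_iff θ w (half_mem ha.1 ha.2 hx) i

theorem exists_inSlot_of_resample_ne_zero {a : ℝ} {ha : 0 ≤ a ∧ a ≤ 1 / 2}
    {w : stdSimplex ℝ (Fin (n + 1))} {j : Fin (n + 1)} (h : resampling a ha w j ≠ 0) :
    ∃ x ∈ Ioc (0 : ℝ) 1, InSlot w (a + x / 2) j :=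
  exists_mem_of_unitMass_ne_zero h

end Slots

section LayerSum

open MeasureTheory Set

theorem finsum_unitMass_mul {I : Type} (R : I → Set ℝ) (ρ : I → ℝ)
    (hR : ∀ i, MeasurableSet (R i))
    (hsum : ∀ x ∈ Ioc (0 : ℝ) 1, ∃ (κ : Type) (e : κ → I), Function.Injective e ∧
      (∀ k, x ∈ R (e k)) ∧ (∀ i, x ∈ R i → ρ i ≠ 0 → i ∈ range e) ∧ ∑ᶠ k, ρ (e k) = 1)
    (hfin' : {i | (∃ x ∈ Ioc (0 : ℝ) 1, x ∈ R i) ∧ ρ i ≠ 0}.Finite) :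
    ∑ᶠ i, unitMass (R i) * ρ i = 1 := by
  classical
  let T := hfin'.toFinset
  have hT : ∀ i x, x ∈ Ioc (0 : ℝ) 1 → x ∈ R i → ρ i ≠ 0 → i ∈ T := fun i x hx hxi hi =>
    hfin'.mem_toFinset.2 ⟨⟨x, hx, hxi⟩, hi⟩
  rw [finsum_eq_sum_of_support_subset (s := T)]
  swap
  · intro i hi
    obtain ⟨x, hx, hxi⟩ := exists_mem_of_unitMass_ne_zero (left_ne_zero_of_mul hi)
    exact hT i x hx hxi (right_ne_zero_of_mul hi)
  have h1 : ∀ i, unitMass (R i) * ρ i =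
      ∫ x in Ioc (0 : ℝ) 1, (R i).indicator (fun _ => ρ i) x := by
    intro i
    rw [integral_indicator_const _ (hR i), measureReal_restrict_apply (hR i)]
    rfl
  rw [Finset.sum_congr rfl fun i _ => h1 i, ← integral_finsetSum]
  · have h2 : ∀ x ∈ Ioc (0 : ℝ) 1, ∑ i ∈ T, (R i).indicator (fun _ => ρ i) x = 1 := by
      intro x hx
      obtain ⟨κ, e, he, heR, hcov, hs⟩ := hsum x hx
      rw [← hs, ← finsum_mem_range he, ← finsum_eq_sum_of_support_subset (s := T)]
      · rw [finsum_mem_def]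
        refine finsum_congr fun i => ?_
        by_cases hi : i ∈ range e
        · obtain ⟨k, rfl⟩ := hi
          rw [indicator_of_mem (heR k), indicator_of_mem (mem_range_self k)]
        · rw [indicator_of_notMem hi]
          by_cases hx' : x ∈ R i
          · rw [indicator_of_mem hx']
            by_contra h
            exact hi (hcov i hx' h)
          · rw [indicator_of_notMem hx']
      · intro i hi
        have hx' : x ∈ R i := by
          by_contra h
          exact hi (indicator_of_notMem h _)
        refine hT i x hx hx' fun h => hi ?_
        simp [h]
    rw [setIntegral_congr_fun measurableSet_Ioc h2]
    simp
  · intro i _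
    exact (integrable_const (ρ i)).indicator (hR i)

end LayerSum

namespace CoveringSystem

variable {A : Type} [Category.{0} A] {Y : Type} [TopologicalSpace Y] {S : CoveringSystem A Y}

open Set

/-- Weighted points whose weights come from subsets of the unit interval. -/
structure LayeredFamily (S : CoveringSystem A Y) {Z I : Type} [TopologicalSpace Z] [LinearOrder I]
    (y : Z → Y) (m : I → A) (R : I → Z → Set ℝ) (ρ : I → Z → ℝ) (u : ∀ i, Z → S.U (m i))
    (D : I → Set Z) : Prop where
  measurable : ∀ i z, MeasurableSet (R i z)
  contSet : ∀ i z, ContSetAt (R i) z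
  cont : ∀ i, Continuous (ρ i)
  nonneg : ∀ i z, 0 ≤ ρ i z
  locallyFinite : LocallyFinite fun i => {z | (∃ x ∈ Ioc (0 : ℝ) 1, x ∈ R i z) ∧ ρ i z ≠ 0}
  sum_eq : ∀ z, ∀ x ∈ Ioc (0 : ℝ) 1, ∃ (κ : Type) (e : κ → I), Function.Injective e ∧
    (∀ k, x ∈ R (e k) z) ∧ (∀ i, x ∈ R i z → ρ i z ≠ 0 → i ∈ range e) ∧ ∑ᶠ k, ρ (e k) z = 1
  isClosed : ∀ i, IsClosed (D i)
  mem : ∀ i z, ∀ x ∈ Ioc (0 : ℝ) 1, x ∈ R i z → ρ i z ≠ 0 → z ∈ D i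
  contOn : ∀ i, ContinuousOn (u i) (D i)
  q_eq : ∀ i, ∀ z ∈ D i, S.q (m i) (u i z) = y z
  subset : ∀ z i i', i ≤ i' → ∀ x ∈ Ioc (0 : ℝ) 1, ∀ x' ∈ Ioc (0 : ℝ) 1, x ∈ R i z →
    x' ∈ R i' z → ρ i z ≠ 0 → ρ i' z ≠ 0 → S.V (m i) ⊆ S.V (m i')

theorem LayeredFamily.weighted {Z I : Type} [TopologicalSpace Z] [LinearOrder I]
    {y : Z → Y} {m : I → A} {R : I → Z → Set ℝ} {ρ : I → Z → ℝ} {u : ∀ i, Z → S.U (m i)}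
    {D : I → Set Z} (H : LayeredFamily S y m R ρ u D) :
    WeightedFamily S y m (fun i z => unitMass (R i z) * ρ i z) u D := by
  have hact : ∀ i z, unitMass (R i z) * ρ i z ≠ 0 →
      (∃ x ∈ Ioc (0 : ℝ) 1, x ∈ R i z) ∧ ρ i z ≠ 0 := fun i z h =>
    ⟨exists_mem_of_unitMass_ne_zero (left_ne_zero_of_mul h), right_ne_zero_of_mul h⟩
  exact {
    cont := fun i => (continuous_iff_continuousAt.2 fun z => (H.contSet i z).continuousAt).mul
      (H.cont i)
    locallyFinite := H.locallyFinite.subset fun i z hz => hact i z hz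
    nonneg := fun i z => mul_nonneg (unitMass_nonneg _) (H.nonneg i z)
    sum_eq := fun z => finsum_unitMass_mul _ _ (fun i => H.measurable i z) (H.sum_eq z)
      (H.locallyFinite.point_finite z)
    isClosed := H.isClosed
    mem := fun i z hz => by
      obtain ⟨⟨x, hx, hxR⟩, hρ⟩ := hact i z hz
      exact H.mem i z x hx hxR hρ
    contOn := H.contOn
    q_eq := H.q_eq
    subset := fun z i i' h hi hi' => by
      obtain ⟨⟨x, hx, hxR⟩, hρ⟩ := hact i z hi
      obtain ⟨⟨x', hx', hxR'⟩, hρ'⟩ := hact i' z hi'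
      exact H.subset z i i' h x hx x' hx' hxR hxR' hρ hρ' }

end CoveringSystem

section Partition

open Set

/-- Continuous partitions of unity with finitely many nonzero members. -/
structure IsFinPartition {κ D : Type} [TopologicalSpace D] (O : κ → Set D) (ρ : κ → C(D, ℝ)) :
    Prop where
  finite : {k | ∃ d, ρ k d ≠ 0}.Finite
  nonneg : ∀ k d, 0 ≤ ρ k d
  sum_eq : ∀ d, ∑ᶠ k, ρ k d = 1
  subset : ∀ k, tsupport (ρ k) ⊆ O k

theorem Collar.exists_separating_depth {D κ : Type} [TopologicalSpace D] [CompactSpace D]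
    {B : Set D} (c : Collar B) (T : Finset κ) (O C : κ → Set D) (hO : ∀ k, IsOpen (O k))
    (hC : ∀ k, IsClosed (C k)) (hCO : ∀ k, C k ⊆ O k) :
    ∃ ε : ℝ, 0 < ε ∧ ε ≤ 1 / 2 ∧ ∀ k ∈ T, ∀ d, c.depth d ≤ ε → c.retr d ∈ C k → d ∈ O k := by
  let E : Set D := {d | c.depth d ≤ 1 / 2}
  have hE : IsClosed E := isClosed_le c.depth.continuous continuous_const
  let F : Set D := ⋃ k ∈ T, (E ∩ c.retr ⁻¹' C k) ∩ (O k)ᶜ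
  have hF : IsCompact F := by
    refine (T.finite_toSet.isClosed_biUnion fun k _ => ?_).isCompact
    exact (c.continuousOn_retr.preimage_isClosed_of_isClosed hE (hC k)).inter (hO k).isClosed_compl
  have hpos : ∀ d ∈ F, 0 < c.depth d := by
    intro d hd
    obtain ⟨k, -, ⟨-, hdC⟩, hdO⟩ := mem_iUnion₂.1 hd
    refine lt_of_le_of_ne (c.depth_nonneg d) fun h => ?_
    have hdB := (c.mem_iff d).2 h.symm
    rw [mem_preimage, c.retr_eq d hdB] at hdC
    exact hdO (hCO k hdC)
  obtain ⟨ε, hε, hεF⟩ := hF.exists_forall_le' c.depth.continuous.continuousOn hpos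
  refine ⟨min (ε / 2) (1 / 2), by positivity, min_le_right _ _, fun k hk d hd hdC => ?_⟩
  by_contra hdO
  have h1 := hεF d (mem_iUnion₂.2 ⟨k, hk, ⟨hd.trans (min_le_right _ _), hdC⟩, hdO⟩)
  have h2 := hd.trans (min_le_left _ _)
  linarith

/-- A partition of unity extends from a collared subset. -/
theorem Collar.exists_partition_extension {D κ : Type} [TopologicalSpace D] [CompactSpace D]
    [T2Space D] {B : Set D} (c : Collar B) (O C : κ → Set D) (hO : ∀ k, IsOpen (O k))
    (hcov : ∀ d, ∃ k, d ∈ O k) (hC : ∀ k, IsClosed (C k)) (hCO : ∀ k, C k ⊆ O k) (T : Finset κ)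
    (g : κ → D → ℝ) (hg : ∀ k, ContinuousOn (g k) B) (hg0 : ∀ k, ∀ d ∈ B, 0 ≤ g k d)
    (hg1 : ∀ d ∈ B, ∑ᶠ k, g k d = 1) (hgT : ∀ k, ∀ d ∈ B, g k d ≠ 0 → k ∈ T)
    (hgC : ∀ k, ∀ d ∈ B, g k d ≠ 0 → d ∈ C k) :
    ∃ ρ : κ → C(D, ℝ), IsFinPartition O ρ ∧ ∀ k, ∀ d ∈ B, ρ k d = g k d := by
  classical
  obtain ⟨ε, hε, hε', hεO⟩ := c.exists_separating_depth T O C hO hC hCO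
  obtain ⟨χ, hχ⟩ := PartitionOfUnity.exists_isSubordinate isClosed_univ O hO
    fun d _ => mem_iUnion.2 (hcov d)
  let η : D → ℝ := fun d => max 0 (1 - c.depth d / ε)
  have hη : Continuous η := by fun_prop
  have hη0 : ∀ d, 0 ≤ η d := fun d => le_max_left _ _
  have hη1 : ∀ d, η d ≤ 1 := fun d => max_le zero_le_one
    (sub_le_self _ (div_nonneg (c.depth_nonneg d) hε.le))
  have hηε : ∀ d, η d ≠ 0 → c.depth d < ε := fun d hd => by
    by_contra h
    refine hd (max_eq_left ?_)
    rw [sub_nonpos, one_le_div hε]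
    exact not_lt.1 h
  have hηB : ∀ d ∈ B, η d = 1 := fun d hd => by
    simp [η, (c.mem_iff d).1 hd]
  let f : κ → D → ℝ := fun k d => if c.depth d ≤ 1 / 2 then η d * g k (c.retr d) else 0
  have hf : ∀ k, Continuous (f k) := by
    intro k
    refine continuous_if_le c.depth.continuous continuous_const (hη.continuousOn.mul
      ((hg k).comp c.continuousOn_retr fun d hd => c.retr_mem d hd)) continuousOn_const
      fun d hd => ?_
    have : η d = 0 := by
      by_contra h
      linarith [hηε d h]
    rw [this, zero_mul]
  have hf0 : ∀ k d, 0 ≤ f k d := by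
    intro k d
    simp only [f]
    split_ifs with h
    · exact mul_nonneg (hη0 d) (hg0 k _ (c.retr_mem d h))
    · exact le_rfl
  have hfT : ∀ k d, f k d ≠ 0 → c.depth d ≤ ε ∧ c.depth d ≤ 1 / 2 ∧ g k (c.retr d) ≠ 0 := by
    intro k d h
    simp only [f] at h
    split_ifs at h with h1
    · exact ⟨(hηε d (left_ne_zero_of_mul h)).le, h1, right_ne_zero_of_mul h⟩
    · exact (h rfl).elim
  have hfsum : ∀ d, ∑ᶠ k, f k d = η d := by
    intro d
    by_cases h : c.depth d ≤ 1 / 2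
    · simp only [f, if_pos h]
      rw [← mul_finsum, hg1 _ (c.retr_mem d h), mul_one]
    · simp only [f, if_neg h, finsum_zero]
      by_contra hc
      linarith [hηε d (Ne.symm hc)]
  have hfχ : {k | ∃ d, χ k d ≠ 0}.Finite :=
    (χ.locallyFinite.finite_nonempty_of_compact).subset fun k ⟨d, hd⟩ => ⟨d, hd⟩
  refine ⟨fun k => ⟨fun d => f k d + (1 - η d) * χ k d, by have := hf k; fun_prop⟩,
    ⟨?_, fun k d => ?_, fun d => ?_, fun k => ?_⟩, fun k d hd => ?_⟩
  · refine (T.finite_toSet.union hfχ).subset ?_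
    rintro k ⟨d, hd⟩
    by_cases h : f k d = 0
    · right
      refine ⟨d, fun h' => hd ?_⟩
      simp [h, h']
    · exact Or.inl (hgT k _ (c.retr_mem d (hfT k d h).2.1) (hfT k d h).2.2)
  · exact add_nonneg (hf0 k d) (mul_nonneg (sub_nonneg.2 (hη1 d)) (χ.nonneg k d))
  · simp only [ContinuousMap.coe_mk]
    rw [finsum_add_distrib, hfsum, ← mul_finsum, χ.sum_eq_one (mem_univ d)]
    · ring
    · exact T.finite_toSet.subset fun k hk =>
        hgT k _ (c.retr_mem d (hfT k d hk).2.1) (hfT k d hk).2.2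
    · exact hfχ.subset fun k hk => ⟨d, right_ne_zero_of_mul hk⟩
  · by_cases hk : k ∈ T
    · have hcl : IsClosed ({d | c.depth d ≤ ε} ∩ ({d | c.depth d ≤ 1 / 2} ∩ c.retr ⁻¹' C k)) :=
        (isClosed_le c.depth.continuous continuous_const).inter
          (c.continuousOn_retr.preimage_isClosed_of_isClosed
            (isClosed_le c.depth.continuous continuous_const) (hC k))
      refine (closure_minimal (t := ({d | c.depth d ≤ ε} ∩ ({d | c.depth d ≤ 1 / 2} ∩
        c.retr ⁻¹' C k)) ∪ tsupport (χ k)) ?_ (hcl.union (isClosed_tsupport _))).trans ?_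
      · intro d hd
        by_cases h : f k d = 0
        · refine Or.inr (subset_tsupport _ fun h' => hd ?_)
          simp [h, h']
        · obtain ⟨h1, h2, h3⟩ := hfT k d h
          exact Or.inl ⟨h1, h2, hgC k _ (c.retr_mem d h2) h3⟩
      · rintro d (⟨h1, -, h3⟩ | h)
        · exact hεO k hk d h1 h3
        · exact hχ k h
    · refine (closure_mono fun d hd => ?_).trans (hχ k)
      have h : f k d = 0 := by
        by_contra h
        exact hk (hgT k _ (c.retr_mem d (hfT k d h).2.1) (hfT k d h).2.2)
      exact fun h' => hd (by simp [h, h'])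
  · have h : c.depth d ≤ 1 / 2 := by
      rw [(c.mem_iff d).1 hd]
      norm_num
    simp only [ContinuousMap.coe_mk, f, if_pos h, hηB d hd, c.retr_eq d hd]
    ring

end Partition

section NervePartition

variable {A : Type} [Category.{0} A] {κ : Type}

theorem IsFinPartition.comp {D D' : Type} [TopologicalSpace D] [TopologicalSpace D']
    {O : κ → Set D} {ρ : κ → C(D, ℝ)} (h : IsFinPartition O ρ) (f : C(D', D)) :
    IsFinPartition (fun k => f ⁻¹' O k) fun k => (ρ k).comp f where
  finite := h.finite.subset fun _ ⟨d, hd⟩ => ⟨f d, hd⟩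
  nonneg k _ := h.nonneg k _
  sum_eq _ := h.sum_eq _
  subset k := (tsupport_comp_subset_preimage _ f.continuous).trans
    (Set.preimage_mono (h.subset k))

/-- Open covers of simplices, compatible with faces and degeneracies, have compatible
partitions of unity. -/
theorem exists_nerve_partition
    (O : ∀ n, ComposableArrows A n → κ → Set (stdSimplex ℝ (Fin (n + 1))))
    (hO : ∀ n σ k, IsOpen (O n σ k)) (hcov : ∀ n σ w, ∃ k, w ∈ O n σ k)
    (hmap : ∀ {m n : ℕ} (θ : Fin (m + 1) →o Fin (n + 1)) (σ : ComposableArrows A n) k,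
      O m (pullChain σ θ) k = stdSimplex.map θ ⁻¹' O n σ k) :
    ∃ ρ : ∀ n, ComposableArrows A n → κ → C(stdSimplex ℝ (Fin (n + 1)), ℝ),
      (∀ n σ, IsFinPartition (O n σ) (ρ n σ)) ∧
      ∀ {m n : ℕ} (θ : Fin (m + 1) →o Fin (n + 1)) (σ : ComposableArrows A n) k w,
        ρ n σ k (stdSimplex.map θ w) = ρ m (pullChain σ θ) k w := by
  let F : ∀ n, ComposableArrows A n → Type := fun n σ =>
    {ρ : κ → C(stdSimplex ℝ (Fin (n + 1)), ℝ) // IsFinPartition (O n σ) ρ}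
  let R : ∀ {m n : ℕ} (θ : Fin (m + 1) →o Fin (n + 1)) (σ : ComposableArrows A n),
      F n σ → F m (pullChain σ θ) → Prop :=
    fun {m n} θ σ x y => ∀ k w, x.1 k (stdSimplex.map θ w) = y.1 k w
  suffices h : ∃ s : ∀ n σ, F n σ, ∀ {m n : ℕ} (θ : Fin (m + 1) →o Fin (n + 1))
      (σ : ComposableArrows A n), R θ σ (s n σ) (s m (pullChain σ θ)) by
    obtain ⟨s, hs⟩ := h
    exact ⟨fun n σ => (s n σ).1, fun n σ => (s n σ).2, fun θ σ => hs θ σ⟩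
  refine exists_nerve_filling F R ?_ ?_
  · intro n σ b hb
    have hglue := fun k => exists_boundary_glue (P := Unit)
      (fun m θ h => ((b m θ h).1 k).comp ⟨Prod.fst, continuous_fst⟩)
      fun θ μ h h' v _ => hb θ μ h h' k v
    choose g hg hgb using hglue
    have hgb' : ∀ k m (θ : Fin (m + 1) →o Fin (n + 1)) (h : ¬ Function.Surjective θ) v,
        g k (stdSimplex.map θ v, ()) = (b m θ h).1 k v := fun k m θ h v => hgb k m θ h v ()
    have hfaces : ∃ (T : Finset κ) (C : κ → Set (stdSimplex ℝ (Fin (n + 1)))),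
        (∀ k, IsClosed (C k)) ∧ (∀ k, C k ⊆ O n σ k) ∧ ∀ k, ∀ w, (∃ i, w i = 0) →
          g k (w, ()) ≠ 0 → k ∈ T ∧ w ∈ C k := by
      cases n with
      | zero =>
        refine ⟨∅, fun _ => ∅, fun _ => isClosed_empty, fun _ => Set.empty_subset _, ?_⟩
        rintro k w hw -
        obtain ⟨m, θ, v, hθ, -⟩ := exists_boundary_rep w hw
        exact (hθ fun y => ⟨0, by omega⟩).elim
      | succ n =>
        classical
        let δ : Fin (n + 1 + 1) → (Fin (n + 1) →o Fin (n + 1 + 1)) := fun i =>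
          (Fin.succAboveOrderEmb i).toOrderHom
        have hδ := fun i : Fin (n + 1 + 1) => succAbove_not_surjective i
        refine ⟨Finset.univ.biUnion fun i => (b n (δ i) (hδ i)).2.finite.toFinset,
          fun k => ⋃ i, stdSimplex.map (δ i) '' tsupport ((b n (δ i) (hδ i)).1 k),
          fun k => isClosed_iUnion_of_finite fun i => ?_, fun k => Set.iUnion_subset fun i => ?_,
          fun k w hw hgw => ?_⟩
        · exact ((isClosed_tsupport _).isCompact.image (stdSimplex.continuous_map _)).isClosed
        · rw [Set.image_subset_iff, ← hmap]
          exact (b n (δ i) (hδ i)).2.subset k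
        · obtain ⟨i, hi⟩ := hw
          obtain ⟨h1, h2⟩ := map_succAbove_restrict i w hi
          have h3 : (b n (δ i) (hδ i)).1 k ⟨_, h1⟩ ≠ 0 := by
            rw [← hgb' k n (δ i) (hδ i), h2]
            exact hgw
          refine ⟨Finset.mem_biUnion.2 ⟨i, Finset.mem_univ i, ?_⟩,
            Set.mem_iUnion.2 ⟨i, _, subset_tsupport _ h3, h2⟩⟩
          exact (b n (δ i) (hδ i)).2.finite.mem_toFinset.2 ⟨_, h3⟩
    obtain ⟨T, C, hC, hCO, hTC⟩ := hfaces
    obtain ⟨ρ, hρ, hρg⟩ := (simplexCollar n).exists_partition_extension (O n σ) C (hO n σ)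
      (hcov n σ) hC hCO T (fun k w => g k (w, ()))
      (fun k => (hg k).comp (by fun_prop) fun w hw => ⟨hw, Set.mem_univ _⟩)
      (fun k w hw => by
        obtain ⟨m, θ, v, hθ, rfl⟩ := exists_boundary_rep w hw
        rw [hgb' k m θ hθ]
        exact (b m θ hθ).2.nonneg k v)
      (fun w hw => by
        obtain ⟨m, θ, v, hθ, rfl⟩ := exists_boundary_rep w hw
        rw [finsum_congr fun k => hgb' k m θ hθ v]
        exact (b m θ hθ).2.sum_eq v)
      (fun k w hw h => (hTC k w hw h).1) (fun k w hw h => (hTC k w hw h).2)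
    refine ⟨⟨ρ, hρ⟩, fun {m} θ h k w => ?_⟩
    exact (hρg k _ (map_mem_boundary θ h w)).trans (hgb' k m θ h w)
  · intro m n θ σ x _
    refine ⟨⟨fun k => (x.1 k).comp ⟨stdSimplex.map θ, stdSimplex.continuous_map θ⟩, ?_⟩,
      fun k w => rfl, fun {l} μ z hz k w => ?_⟩
    · have := x.2.comp ⟨stdSimplex.map θ, stdSimplex.continuous_map θ⟩
      simpa only [ContinuousMap.coe_mk, ← hmap] using this
    · rw [← hz k w]
      change x.1 k (stdSimplex.map θ (stdSimplex.map μ w)) = _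
      rw [stdSimplex.map_comp_apply]
      rfl

end NervePartition

theorem exists_linearOrder_refining {I P : Type} [PartialOrder P] (f : I → P) :
    ∃ _ : LinearOrder I, ∀ i i' : I, i ≤ i' → f i' ≤ f i → f i ≤ f i' := by
  obtain ⟨o, -⟩ := exists_wellFoundedLT I
  let g : I → LinearExtension P ×ₗ I := fun i => toLex (toLinearExtension (f i), i)
  have hg : Function.Injective g := fun i i' h => congrArg (fun p => (ofLex p).2) h
  refine ⟨LinearOrder.lift' g hg, fun i i' h hf => ?_⟩
  have h1 : g i ≤ g i' := h
  rw [Prod.Lex.le_iff] at h1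
  have h2 : toLinearExtension (f i') ≤ toLinearExtension (f i) := toLinearExtension.monotone hf
  rcases h1 with h1 | h1
  · exact (not_lt.2 h2 h1).elim
  · exact le_of_eq h1.1

namespace CoveringSystem

variable {A : Type} [Category.{0} A] {Y : Type} [TopologicalSpace Y] (S : CoveringSystem A Y)

open Set

theorem exists_lift (α : A) {y : Y} (hy : y ∈ S.V α) : ∃ u, S.q α u = y := by
  obtain ⟨O, -, hyO, s, -, hs⟩ := S.exists_section α y hy
  exact ⟨s y, hs y hyO⟩

/-- The common intersection of finitely many members of the covering. -/
def inf (T : Finset A) : Set Y := ⋂ α ∈ T, S.V α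

theorem exists_V_eq_inf {T : Finset A} (hT : T.Nonempty) (h : (S.inf T).Nonempty) :
    ∃ γ, S.V γ = S.inf T := by
  classical
  induction hT using Finset.Nonempty.cons_induction with
  | singleton a => exact ⟨a, by simp [inf]⟩
  | cons a T ha hT ih =>
    have h1 : S.inf (Finset.cons a T ha) = S.V a ∩ S.inf T := by
      simp [inf]
    rw [h1] at h ⊢
    obtain ⟨γ, hγ⟩ := ih (h.mono inter_subset_right)
    rw [← hγ] at h ⊢
    exact S.exists_inter a γ h

open Classical in
/-- A morphism between two members of the covering, when there is one. -/
noncomputable def transfer (α β : A) : C(S.U α, S.U β) :=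
  if h : Nonempty (α ⟶ β) then S.act h.some else ContinuousMap.const _ (Classical.arbitrary _)

theorem q_transfer {α β : A} (h : S.V α ⊆ S.V β) (u : S.U α) :
    S.q β (S.transfer α β u) = S.q α u := by
  obtain ⟨v, hv⟩ := S.exists_lift β (h (S.q_mem α u))
  obtain ⟨f, -⟩ := S.exists_hom u v h hv.symm
  have hf : Nonempty (α ⟶ β) := ⟨f⟩
  rw [transfer, dif_pos hf, S.q_act]

variable [Nonempty A]

/-- An index of the intersection of finitely many members of the covering. -/
noncomputable def meet (T : Finset A) : A := Classical.epsilon fun γ => S.V γ = S.inf T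

theorem V_meet {T : Finset A} (hT : T.Nonempty) (h : (S.inf T).Nonempty) :
    S.V (S.meet T) = S.inf T :=
  Classical.epsilon_spec (p := fun γ => S.V γ = S.inf T) (S.exists_V_eq_inf hT h)

/-- Finite sets of indices with a label, ordered compatibly with inclusion of intersections. -/
def Tag (_ : CoveringSystem A Y) (κ : Type) : Type := Finset A × κ

noncomputable instance (κ : Type) : LinearOrder (S.Tag κ) :=
  (exists_linearOrder_refining fun i : Finset A × κ => S.V (S.meet i.1)).choose

theorem Tag.subset {κ : Type} {i i' : S.Tag κ} (h : i ≤ i')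
    (h' : S.V (S.meet i'.1) ⊆ S.V (S.meet i.1)) : S.V (S.meet i.1) ⊆ S.V (S.meet i'.1) :=
  (exists_linearOrder_refining fun i : Finset A × κ => S.V (S.meet i.1)).choose_spec i i' h h'

end CoveringSystem

namespace CoveringSystem

variable {A : Type} [Category.{0} A] {Y : Type} [TopologicalSpace Y] (S : CoveringSystem A Y)

open Set

/-- Local lifts of a map to `Y`, adapted to a family of closed sets. -/
structure Atlas {Z : Type} [TopologicalSpace Z] (κ : Type) (y : Z → Y) (F : A → Set Z) where
  O : κ → Set Z
  μ : κ → A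
  s : ∀ k, Z → S.U (μ k)
  isOpen : ∀ k, IsOpen (O k)
  cover : ∀ z, ∃ k, z ∈ O k
  contOn : ∀ k, ContinuousOn (s k) (O k)
  q_eq : ∀ k, ∀ z ∈ O k, S.q (μ k) (s k z) = y z
  subset : ∀ k α, (F α ∩ O k).Nonempty → S.V (μ k) ⊆ S.V α

variable {S}

/-- Pullback of an atlas. -/
def Atlas.comp {Z Z' κ : Type} [TopologicalSpace Z] [TopologicalSpace Z'] {y : Z → Y}
    {F : A → Set Z} (a : S.Atlas κ y F) (f : C(Z', Z)) :
    S.Atlas κ (fun z => y (f z)) fun α => f ⁻¹' F α where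
  O k := f ⁻¹' a.O k
  μ := a.μ
  s k z := a.s k (f z)
  isOpen k := (a.isOpen k).preimage f.continuous
  cover z := a.cover (f z)
  contOn k := (a.contOn k).comp f.continuous.continuousOn fun _ hz => hz
  q_eq k z hz := a.q_eq k (f z) hz
  subset k α h := a.subset k α (h.elim fun z hz => ⟨f z, hz⟩)

theorem exists_atlas (S : CoveringSystem A Y) {Z : Type} [TopologicalSpace Z] {y : Z → Y}
    (hy : Continuous y) (F : A → Set Z) (hF : ∀ α, IsClosed (F α))
    (hFV : ∀ α, F α ⊆ y ⁻¹' S.V α) : Nonempty (S.Atlas Z y F) := by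
  classical
  have key : ∀ k : Z, ∃ (O : Set Z) (μ : A) (s : Z → S.U μ), IsOpen O ∧ k ∈ O ∧
      ContinuousOn s O ∧ (∀ z ∈ O, S.q μ (s z) = y z) ∧
      ∀ α, (F α ∩ O).Nonempty → S.V μ ⊆ S.V α := by
    intro k
    obtain ⟨W, hW, hWfin⟩ := S.locallyFinite (y k)
    have hJ : {α | y k ∈ S.V α}.Finite := S.locallyFinite.point_finite (y k)
    obtain ⟨α₀, hα₀⟩ := S.exists_mem (y k)
    have hmem : y k ∈ S.inf hJ.toFinset :=
      mem_iInter₂.2 fun α hα => hJ.mem_toFinset.1 hα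
    obtain ⟨μ, hμ⟩ := S.exists_V_eq_inf ⟨α₀, hJ.mem_toFinset.2 hα₀⟩ ⟨_, hmem⟩
    obtain ⟨O', hO', hkO', s, hs, hsq⟩ := S.exists_section μ (y k) (hμ ▸ hmem)
    let B : Set Z := ⋃ α ∈ hWfin.toFinset \ hJ.toFinset, F α
    have hB : IsClosed B := by
      exact (Finset.finite_toSet _).isClosed_biUnion fun α _ => hF α
    have hkB : k ∉ B := by
      intro hk
      obtain ⟨α, hα, hkα⟩ := mem_iUnion₂.1 hk
      exact (Finset.mem_sdiff.1 hα).2 (hJ.mem_toFinset.2 (hFV α hkα))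
    refine ⟨y ⁻¹' O' ∩ y ⁻¹' interior W ∩ Bᶜ, μ, fun z => s (y z),
      ((hO'.preimage hy).inter (isOpen_interior.preimage hy)).inter hB.isOpen_compl,
      ⟨⟨hkO', mem_interior_iff_mem_nhds.2 hW⟩, hkB⟩,
      hs.comp hy.continuousOn fun z hz => hz.1.1, fun z hz => hsq _ hz.1.1, ?_⟩
    rintro α ⟨z, hz, hzO⟩
    have hα : α ∈ hJ.toFinset := by
      by_contra hα
      refine hzO.2 (mem_iUnion₂.2 ⟨α, Finset.mem_sdiff.2 ⟨hWfin.mem_toFinset.2 ?_, hα⟩, hz⟩)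
      exact ⟨y z, hFV α hz, interior_subset hzO.1.2⟩
    rw [hμ]
    exact biInter_subset_of_mem hα
  choose O μ s h1 h2 h3 h4 h5 using key
  exact ⟨⟨O, μ, s, h1, fun z => ⟨z, h2 z⟩, h3, h4, h5⟩⟩

end CoveringSystem

theorem ContSetAt.comp {Z Z' : Type} [TopologicalSpace Z] [TopologicalSpace Z'] {P : Z → Set ℝ}
    {f : Z' → Z} {z : Z'} (hf : ContinuousAt f z) (h : ContSetAt P (f z)) :
    ContSetAt (fun z => P (f z)) z := by
  have h1 : Filter.Tendsto (fun z' => unitMass (symmDiff (P z') (P (f z)))) (nhds (f z))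
    (nhds 0) := h
  exact h1.comp hf

/-- Partitions of unity with supports in given sets. -/
structure IsPartition {κ Z : Type} [TopologicalSpace Z] (O : κ → Set Z) (ρ : κ → Z → ℝ) :
    Prop where
  cont : ∀ k, Continuous (ρ k)
  nonneg : ∀ k z, 0 ≤ ρ k z
  locallyFinite : LocallyFinite fun k => Function.support (ρ k)
  sum_eq : ∀ z, ∑ᶠ k, ρ k z = 1
  subset : ∀ k, tsupport (ρ k) ⊆ O k

theorem IsFinPartition.isPartition {κ D : Type} [TopologicalSpace D] {O : κ → Set D}
    {ρ : κ → C(D, ℝ)} (h : IsFinPartition O ρ) : IsPartition O fun k => ρ k where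
  cont k := (ρ k).continuous
  nonneg := h.nonneg
  locallyFinite _ := ⟨Set.univ, Filter.univ_mem, h.finite.subset fun _ ⟨d, hd, _⟩ => ⟨d, hd⟩⟩
  sum_eq := h.sum_eq
  subset := h.subset

theorem exists_isPartition {κ Z : Type} [TopologicalSpace Z] [ParacompactSpace Z] [T2Space Z]
    (O : κ → Set Z) (hO : ∀ k, IsOpen (O k)) (hcov : ∀ z, ∃ k, z ∈ O k) :
    ∃ ρ : κ → Z → ℝ, IsPartition O ρ := by
  obtain ⟨χ, hχ⟩ := PartitionOfUnity.exists_isSubordinate isClosed_univ O hO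
    fun z _ => Set.mem_iUnion.2 (hcov z)
  exact ⟨fun k => χ k, fun k => (χ k).continuous, χ.nonneg, χ.locallyFinite,
    fun z => χ.sum_eq_one (Set.mem_univ z), hχ⟩

namespace CoveringSystem

variable {A : Type} [Category.{0} A] {Y : Type} [TopologicalSpace Y] {S : CoveringSystem A Y}

open Set

/-- A family of finite sets of indices parametrized by points and levels in the unit interval. -/
structure Leveling (S : CoveringSystem A Y) {Z : Type} [TopologicalSpace Z] (F : A → Set Z)
    (L : Finset A → Z → Set ℝ) : Prop where
  measurable : ∀ T z, MeasurableSet (L T z)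
  contSet : ∀ T z, ContSetAt (L T) z
  exists_mem : ∀ z, ∀ x ∈ Ioc (0 : ℝ) 1, ∃ T, x ∈ L T z
  unique : ∀ z, ∀ x ∈ Ioc (0 : ℝ) 1, ∀ T T', x ∈ L T z → x ∈ L T' z → T = T'
  locallyFinite : LocallyFinite fun T => {z | ∃ x ∈ Ioc (0 : ℝ) 1, x ∈ L T z}
  nonempty : ∀ z, ∀ x ∈ Ioc (0 : ℝ) 1, ∀ T, x ∈ L T z → T.Nonempty
  mem : ∀ z, ∀ x ∈ Ioc (0 : ℝ) 1, ∀ T, x ∈ L T z → ∀ α ∈ T, z ∈ F α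
  inf_subset : ∀ z, ∀ x ∈ Ioc (0 : ℝ) 1, ∀ x' ∈ Ioc (0 : ℝ) 1, x ≤ x' → ∀ T T', x ∈ L T z →
    x' ∈ L T' z → S.inf T ⊆ S.inf T'

variable [Nonempty A] {Z κ : Type} [TopologicalSpace Z]

theorem Leveling.V_meet {F : A → Set Z} {L : Finset A → Z → Set ℝ} {y : Z → Y}
    (H : S.Leveling F L) (hFV : ∀ α, F α ⊆ y ⁻¹' S.V α) {z : Z} {x : ℝ} (hx : x ∈ Ioc (0 : ℝ) 1)
    {T : Finset A} (h : x ∈ L T z) : S.V (S.meet T) = S.inf T :=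
  S.V_meet (H.nonempty z x hx T h) ⟨y z, mem_iInter₂.2 fun α hα => hFV α (H.mem z x hx T h α hα)⟩

theorem Leveling.layered {F : A → Set Z} {L : Finset A → Z → Set ℝ} {y : Z → Y}
    (H : S.Leveling F L) (hFV : ∀ α, F α ⊆ y ⁻¹' S.V α) (a : S.Atlas κ y F) {ρ : κ → Z → ℝ}
    (hρ : IsPartition a.O ρ) :
    LayeredFamily S y (fun i : S.Tag κ => S.meet i.1) (fun i => L i.1) (fun i => ρ i.2)
      (fun i z => S.transfer (a.μ i.2) (S.meet i.1) (a.s i.2 z))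
      (fun i => {z | z ∈ tsupport (ρ i.2) ∧ S.V (a.μ i.2) ⊆ S.V (S.meet i.1)}) where
  measurable i z := H.measurable i.1 z
  contSet i z := H.contSet i.1 z
  cont i := hρ.cont i.2
  nonneg i z := hρ.nonneg i.2 z
  locallyFinite z := by
    obtain ⟨W, hW, hWf⟩ := H.locallyFinite z
    obtain ⟨W', hW', hWf'⟩ := hρ.locallyFinite z
    refine ⟨W ∩ W', Filter.inter_mem hW hW', (hWf.prod hWf').subset ?_⟩
    rintro ⟨T, k⟩ ⟨z', ⟨h1, h2⟩, h3, h4⟩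
    exact ⟨⟨z', h1, h3⟩, ⟨z', h2, h4⟩⟩
  sum_eq z x hx := by
    obtain ⟨T, hT⟩ := H.exists_mem z x hx
    refine ⟨κ, fun k => (T, k), fun k k' h => congrArg Prod.snd h, fun _ => hT, ?_, hρ.sum_eq z⟩
    rintro ⟨T', k⟩ h -
    exact ⟨k, Prod.ext (H.unique z x hx T T' hT h) rfl⟩
  isClosed i := (isClosed_tsupport _).inter isClosed_const
  mem i z x hx h h' := by
    have h1 := subset_tsupport (ρ i.2) h'
    refine ⟨h1, ?_⟩
    rw [H.V_meet hFV hx h]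
    exact subset_iInter₂ fun α hα => a.subset i.2 α ⟨z, H.mem z x hx _ h α hα, hρ.subset i.2 h1⟩
  contOn i := (S.transfer _ _).continuous.comp_continuousOn
    ((a.contOn i.2).mono fun z hz => hρ.subset i.2 hz.1)
  q_eq i z hz := (S.q_transfer hz.2 _).trans (a.q_eq i.2 z (hρ.subset i.2 hz.1))
  subset z i i' hle x hx x' hx' h h' _ _ := by
    rcases le_total x x' with hxx | hxx
    · rw [H.V_meet hFV hx h, H.V_meet hFV hx' h']
      exact H.inf_subset z x hx x' hx' hxx _ _ h h'
    · refine Tag.subset S hle ?_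
      rw [H.V_meet hFV hx h, H.V_meet hFV hx' h']
      exact H.inf_subset z x' hx' x hx hxx _ _ h' h

end CoveringSystem

namespace CoveringSystem.LayeredFamily

variable {A : Type} [Category.{0} A] {Y : Type} [TopologicalSpace Y] {S : CoveringSystem A Y}

open Set

variable {Z Z' I E : Type} [TopologicalSpace Z] [TopologicalSpace Z'] [LinearOrder I]
  [LinearOrder E] {y : Z → Y}
  {m : I → A} {R : I → Z → Set ℝ} {ρ : I → Z → ℝ} {u : ∀ i, Z → S.U (m i)} {D : I → Set Z}
  {m' : E → A} {R' : E → Z → Set ℝ} {ρ' : E → Z → ℝ} {u' : ∀ i, Z → S.U (m' i)} {D' : E → Set Z}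

theorem comp (H : LayeredFamily S y m R ρ u D) (f : C(Z', Z)) :
    LayeredFamily S (fun z => y (f z)) m (fun i z => R i (f z)) (fun i z => ρ i (f z))
      (fun i z => u i (f z)) (fun i => f ⁻¹' D i) where
  measurable i _ := H.measurable i _
  contSet i _ := (H.contSet i _).comp f.continuous.continuousAt
  cont i := (H.cont i).comp f.continuous
  nonneg i _ := H.nonneg i _
  locallyFinite := H.locallyFinite.preimage_continuous f.continuous
  sum_eq _ := H.sum_eq _
  isClosed i := (H.isClosed i).preimage f.continuous
  mem i _ := H.mem i _
  contOn i := (H.contOn i).comp f.continuous.continuousOn fun _ hz => hz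
  q_eq i _ := H.q_eq i _
  subset _ := H.subset _

/-- The index of the family interpolating between two families. -/
abbrev joinIdx {I E : Type} (m : I → A) (m' : E → A) (i : I ⊕ₗ E) : A := Sum.elim m m' (ofLex i)

/-- The layers of the family interpolating between two families. -/
def joinLayer {Z I E : Type} (R : I → Z → Set ℝ) (R' : E → Z → Set ℝ) (i : I ⊕ₗ E)
    (z : Z × unitInterval) :
    Set ℝ :=
  Sum.elim (fun i => R i z.1 ∩ {x | x ≤ (z.2 : ℝ)}) (fun e => R' e z.1 ∩ {x | (z.2 : ℝ) < x})
    (ofLex i)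

/-- The points of the family interpolating between two families. -/
def joinPt {Z I E : Type} {m : I → A} {m' : E → A} (u : ∀ i, Z → S.U (m i))
    (u' : ∀ i, Z → S.U (m' i)) :
    ∀ (i : I ⊕ₗ E) (_ : Z × unitInterval), S.U (joinIdx m m' i)
  | Sum.inl i, z => u i z.1
  | Sum.inr e, z => u' e z.1

theorem join (H : LayeredFamily S y m R ρ u D) (H' : LayeredFamily S y m' R' ρ' u' D')
    (hsub : ∀ z i e, ∀ x ∈ Ioc (0 : ℝ) 1, ∀ x' ∈ Ioc (0 : ℝ) 1, x ≤ x' → x ∈ R i z → x' ∈ R' e z →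
      ρ i z ≠ 0 → ρ' e z ≠ 0 → S.V (m i) ⊆ S.V (m' e)) :
    LayeredFamily S (fun z : Z × unitInterval => y z.1) (joinIdx m m') (joinLayer R R')
      (fun i z => Sum.elim (fun i => ρ i z.1) (fun e => ρ' e z.1) (ofLex i)) (joinPt u u')
      (fun i => Prod.fst ⁻¹' Sum.elim D D' (ofLex i)) where
  measurable
    | Sum.inl i, z => (H.measurable i z.1).inter measurableSet_Iic
    | Sum.inr e, z => (H'.measurable e z.1).inter measurableSet_Ioi
  contSet
    | Sum.inl i, z => ((H.contSet i z.1).comp continuousAt_fst).inter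
        (contSetAt_setOf_le (by fun_prop))
    | Sum.inr e, z => ((H'.contSet e z.1).comp continuousAt_fst).inter
        (contSetAt_setOf_lt (by fun_prop))
  cont
    | Sum.inl i => (H.cont i).comp continuous_fst
    | Sum.inr e => (H'.cont e).comp continuous_fst
  nonneg
    | Sum.inl i, z => H.nonneg i z.1
    | Sum.inr e, z => H'.nonneg e z.1
  locallyFinite z := by
    obtain ⟨W, hW, hWf⟩ := H.locallyFinite z.1
    obtain ⟨W', hW', hWf'⟩ := H'.locallyFinite z.1
    refine ⟨Prod.fst ⁻¹' (W ∩ W'), continuousAt_fst (Filter.inter_mem hW hW'),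
      ((hWf.image Sum.inl).union (hWf'.image Sum.inr)).subset ?_⟩
    rintro (i | e) ⟨z', ⟨⟨x, hx, hxR⟩, h2⟩, h3, h4⟩
    · exact Or.inl ⟨i, ⟨z'.1, ⟨⟨x, hx, hxR.1⟩, h2⟩, h3⟩, rfl⟩
    · exact Or.inr ⟨e, ⟨z'.1, ⟨⟨x, hx, hxR.1⟩, h2⟩, h4⟩, rfl⟩
  sum_eq z x hx := by
    by_cases hxz : x ≤ (z.2 : ℝ)
    · obtain ⟨κ, e, he, hR, hc, hs⟩ := H.sum_eq z.1 x hx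
      refine ⟨κ, fun k => Sum.inlₗ (e k), fun k k' h => he (Sum.inl_injective h),
        fun k => ⟨hR k, hxz⟩, ?_, hs⟩
      rintro (i | i) h h'
      · obtain ⟨k, hk⟩ := hc i h.1 h'
        exact ⟨k, congrArg Sum.inl hk⟩
      · exact (not_lt.2 hxz h.2).elim
    · obtain ⟨κ, e, he, hR, hc, hs⟩ := H'.sum_eq z.1 x hx
      refine ⟨κ, fun k => Sum.inrₗ (e k), fun k k' h => he (Sum.inr_injective h),
        fun k => ⟨hR k, not_le.1 hxz⟩, ?_, hs⟩
      rintro (i | i) h h'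
      · exact (hxz h.2).elim
      · obtain ⟨k, hk⟩ := hc i h.1 h'
        exact ⟨k, congrArg Sum.inr hk⟩
  isClosed
    | Sum.inl i => (H.isClosed i).preimage continuous_fst
    | Sum.inr e => (H'.isClosed e).preimage continuous_fst
  mem
    | Sum.inl i, z, x, hx, h, h' => H.mem i z.1 x hx h.1 h'
    | Sum.inr e, z, x, hx, h, h' => H'.mem e z.1 x hx h.1 h'
  contOn
    | Sum.inl i => (H.contOn i).comp continuous_fst.continuousOn fun _ hz => hz
    | Sum.inr e => (H'.contOn e).comp continuous_fst.continuousOn fun _ hz => hz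
  q_eq
    | Sum.inl i, z, hz => H.q_eq i z.1 hz
    | Sum.inr e, z, hz => H'.q_eq e z.1 hz
  subset
    | z, Sum.inl i, Sum.inl i', hle, x, hx, x', hx', h, h', hρ, hρ' =>
      H.subset z.1 i i' (Sum.Lex.inl_le_inl_iff.1 hle) x hx x' hx' h.1 h'.1 hρ hρ'
    | z, Sum.inl i, Sum.inr e, _, x, hx, x', hx', h, h', hρ, hρ' =>
      hsub z.1 i e x hx x' hx' (h.2.trans h'.2.le) h.1 h'.1 hρ hρ'
    | z, Sum.inr e, Sum.inl i, hle, _, _, _, _, _, _, _, _ =>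
      (Sum.Lex.not_inr_le_inl hle).elim
    | z, Sum.inr i, Sum.inr i', hle, x, hx, x', hx', h, h', hρ, hρ' =>
      H'.subset z.1 i i' (Sum.Lex.inr_le_inr_iff.1 hle) x hx x' hx' h.1 h'.1 hρ hρ'

theorem weight_join_zero {Z I E : Type} (R : I → Z → Set ℝ)
    (R' : E → Z → Set ℝ) (z : Z) (i : I ⊕ₗ E) :
    unitMass (joinLayer R R' i (z, 0)) =
      Sum.elim (fun _ => 0) (fun e => unitMass (R' e z)) (ofLex i) := by
  rcases i with i | e
  · refine (unitMass_congr (Q := ∅) fun x hx => ⟨fun h => ?_, fun h => h.elim⟩).trans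
      unitMass_empty
    exact absurd hx.1 (not_lt.2 h.2)
  · exact unitMass_congr fun x hx => ⟨fun h => h.1, fun h => ⟨h, hx.1⟩⟩

theorem weight_join_one {Z I E : Type} (R : I → Z → Set ℝ)
    (R' : E → Z → Set ℝ) (z : Z) (i : I ⊕ₗ E) :
    unitMass (joinLayer R R' i (z, 1)) =
      Sum.elim (fun i => unitMass (R i z)) (fun _ => 0) (ofLex i) := by
  rcases i with i | e
  · exact unitMass_congr fun x hx => ⟨fun h => h.1, fun h => ⟨h, hx.2⟩⟩
  · refine (unitMass_congr (Q := ∅) fun x hx => ⟨fun h => ?_, fun h => h.elim⟩).trans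
      unitMass_empty
    exact absurd hx.2 (not_le.2 h.2)

/-- Evaluation of a layered family of points. -/
noncomputable def evalAt {X : Type} [TopologicalSpace X] [Nonempty X] (N : S.NatFamily X)
    (R : I → Z → Set ℝ) (ρ : I → Z → ℝ) (u : ∀ i, Z → S.U (m i)) (z : Z) : X :=
  N.eval (fun i => unitMass (R i z) * ρ i z) fun i => ⟨m i, u i z⟩

variable {X : Type} [TopologicalSpace X] [Nonempty X] (N : S.NatFamily X)

theorem continuous_evalAt (H : LayeredFamily S y m R ρ u D) : Continuous (evalAt N R ρ u) :=
  H.weighted.continuous_eval N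

theorem evalAt_join_zero (H' : LayeredFamily S y m' R' ρ' u' D') (z : Z) :
    evalAt N (joinLayer R R')
      (fun i z => Sum.elim (fun i => ρ i z.1) (fun e => ρ' e z.1) (ofLex i)) (joinPt u u')
      (z, 0) = evalAt N R' ρ' u' z := by
  classical
  have hw := H'.weighted.isWeight z
  refine N.eval_push hw (H'.weighted.le z) ⟨Sum.inrₗ, Sum.Lex.inr_mono⟩ hw.finite.toFinset
    (fun i hi => hw.finite.mem_toFinset.2 hi) ?_ fun e _ => rfl
  intro i
  rw [weight_join_zero]
  rcases i with i | e
  · refine (zero_mul _).trans (Eq.symm (Finset.sum_eq_zero fun e _ => ?_))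
    exact if_neg Sum.inr_ne_inl
  · have : ∀ e', (if (Sum.inrₗ e' : I ⊕ₗ E) = Sum.inrₗ e then unitMass (R' e' z) * ρ' e' z else 0) =
        if e' = e then unitMass (R' e' z) * ρ' e' z else 0 := fun e' =>
      if_congr Sum.inr_injective.eq_iff rfl rfl
    refine Eq.trans ?_ (Finset.sum_congr rfl fun e' _ => (this e').symm)
    rw [Finset.sum_ite_eq']
    split_ifs with h
    · rfl
    · by_contra hc
      exact h (hw.finite.mem_toFinset.2 hc)

theorem evalAt_join_one (H : LayeredFamily S y m R ρ u D) (z : Z) :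
    evalAt N (joinLayer R R')
      (fun i z => Sum.elim (fun i => ρ i z.1) (fun e => ρ' e z.1) (ofLex i)) (joinPt u u')
      (z, 1) = evalAt N R ρ u z := by
  classical
  have hw := H.weighted.isWeight z
  refine N.eval_push hw (H.weighted.le z) ⟨Sum.inlₗ, Sum.Lex.inl_mono⟩ hw.finite.toFinset
    (fun i hi => hw.finite.mem_toFinset.2 hi) ?_ fun e _ => rfl
  intro i
  rw [weight_join_one]
  rcases i with i | e
  · have : ∀ e', (if (Sum.inlₗ e' : I ⊕ₗ E) = Sum.inlₗ i then unitMass (R e' z) * ρ e' z else 0) =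
        if e' = i then unitMass (R e' z) * ρ e' z else 0 := fun e' =>
      if_congr Sum.inl_injective.eq_iff rfl rfl
    refine Eq.trans ?_ (Finset.sum_congr rfl fun e' _ => (this e').symm)
    rw [Finset.sum_ite_eq']
    split_ifs with h
    · rfl
    · by_contra hc
      exact h (hw.finite.mem_toFinset.2 hc)
  · refine (zero_mul _).trans (Eq.symm (Finset.sum_eq_zero fun e _ => ?_))
    exact if_neg Sum.inl_ne_inr

end CoveringSystem.LayeredFamily

namespace CoveringSystem

variable {A : Type} [Category.{0} A] {Y : Type} [TopologicalSpace Y]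

open Set

/-- Bump functions subordinate to the covering. -/
structure Bumps (S : CoveringSystem A Y) (g : A → Y → ℝ) : Prop where
  cont : ∀ α, Continuous (g α)
  nonneg : ∀ α y, 0 ≤ g α y
  locallyFinite : LocallyFinite fun α => Function.support (g α)
  subset : ∀ α, tsupport (g α) ⊆ S.V α
  exists_eq_one : ∀ y, ∃ α, g α y = 1

theorem exists_bumps (S : CoveringSystem A Y) [ParacompactSpace Y] [T2Space Y] :
    ∃ g, S.Bumps g := by
  obtain ⟨f, hf⟩ := BumpCovering.exists_isSubordinate isClosed_univ S.V S.isOpen_V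
    fun y _ => mem_iUnion.2 (S.exists_mem y)
  exact ⟨fun α => f α, fun α => (f α).continuous, f.nonneg, f.locallyFinite, hf,
    fun y => ⟨f.ind y (mem_univ y), f.ind_apply y (mem_univ y)⟩⟩

/-- The levels at which a given finite set of bump functions is the set of large ones. -/
def levelSet (g : A → Y → ℝ) (T : Finset A) (y : Y) : Set ℝ :=
  {x | 0 < x ∧ ∀ α, α ∈ T ↔ x ≤ g α y}

variable {S : CoveringSystem A Y} {g : A → Y → ℝ}

theorem mem_levelSet_iff {A Y : Type} {g : A → Y → ℝ} {y : Y} {J T : Finset A}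
    (hJ : ∀ α ∉ J, g α y = 0) {x : ℝ}
    (hx : x ∈ Ioc (0 : ℝ) 1) : x ∈ levelSet g T y ↔
      (∀ α ∈ T, x ∈ {x | x ≤ g α y}) ∧ ∀ α ∈ J, x ∈ {_x | α ∈ T} ∪ {x | g α y < x} := by
  constructor
  · rintro ⟨-, h⟩
    refine ⟨fun α hα => (h α).1 hα, fun α _ => ?_⟩
    by_cases hα : α ∈ T
    · exact Or.inl hα
    · exact Or.inr (not_le.1 fun h' => hα ((h α).2 h'))
  · rintro ⟨h1, h2⟩
    refine ⟨hx.1, fun α => ⟨fun hα => h1 α hα, fun hα => ?_⟩⟩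
    by_cases hαJ : α ∈ J
    · exact (h2 α hαJ).resolve_right (not_lt.2 hα)
    · rw [hJ α hαJ] at hα
      exact (not_lt.2 hα hx.1).elim

theorem Bumps.exists_finset (hg : S.Bumps g) (y : Y) :
    ∃ J : Finset A, ∀ᶠ y' in nhds y, ∀ α ∉ J, g α y' = 0 := by
  obtain ⟨W, hW, hWf⟩ := hg.locallyFinite y
  refine ⟨hWf.toFinset, ?_⟩
  filter_upwards [hW] with y' hy' α hα
  by_contra h
  exact hα (hWf.mem_toFinset.2 ⟨y', h, hy'⟩)

theorem Bumps.contSetAt_levelSet (hg : S.Bumps g) (T : Finset A) (y : Y) :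
    ContSetAt (levelSet g T) y := by
  obtain ⟨J, hJ⟩ := hg.exists_finset y
  have h1 := (contSetAt_forall (z₀ := y) T (P := fun α y => {x | x ≤ g α y}) fun α _ =>
    contSetAt_setOf_le (hg.cont α).continuousAt).inter (contSetAt_forall J
      (P := fun α y => {_x | α ∈ T} ∪ {x | g α y < x}) fun α _ =>
      (contSetAt_const {_x | α ∈ T}).union (contSetAt_setOf_lt (hg.cont α).continuousAt))
  refine h1.congr ?_
  filter_upwards [hJ] with y' hy' x hx
  exact mem_levelSet_iff hy' hx

theorem Bumps.measurableSet_levelSet (hg : S.Bumps g) (T : Finset A) (y : Y) :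
    MeasurableSet (levelSet g T y) := by
  obtain ⟨J, hJ⟩ := hg.exists_finset y
  have hJy := hJ.self_of_nhds
  have h1 : levelSet g T y = Ioi 0 ∩ ((⋂ α ∈ T, Iic (g α y)) ∩
      ⋂ α ∈ (J : Set A) \ T, Ioi (g α y)) := by
    ext x
    simp only [levelSet, mem_ofPred_eq, mem_inter_iff, mem_Ioi, mem_iInter, mem_Iic]
    refine and_congr_right fun hx => ⟨fun h => ⟨fun α hα => (h α).1 hα, fun α hα =>
      not_le.1 fun h' => hα.2 ((h α).2 h')⟩, fun h α => ⟨fun hα => h.1 α hα, fun hα => ?_⟩⟩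
    by_contra hαT
    by_cases hαJ : α ∈ J
    · exact not_lt.2 hα (h.2 α ⟨hαJ, hαT⟩)
    · rw [hJy α hαJ] at hα
      exact not_lt.2 hα hx
  rw [h1]
  refine measurableSet_Ioi.inter ((T.measurableSet_biInter fun _ _ => measurableSet_Iic).inter ?_)
  exact (J.finite_toSet.sdiff).measurableSet_biInter fun _ _ => measurableSet_Ioi

theorem Bumps.leveling (hg : S.Bumps g) :
    S.Leveling (fun α => tsupport (g α)) (levelSet g) where
  measurable := hg.measurableSet_levelSet
  contSet := hg.contSetAt_levelSet
  exists_mem y x hx := by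
    have hfin : {α | x ≤ g α y}.Finite := (hg.locallyFinite.point_finite y).subset
      fun α hα => (hx.1.trans_le hα).ne'
    exact ⟨hfin.toFinset, hx.1, fun α => hfin.mem_toFinset⟩
  unique y x _ T T' h h' := Finset.ext fun α => (h.2 α).trans (h'.2 α).symm
  locallyFinite y := by
    obtain ⟨J, hJ⟩ := hg.exists_finset y
    refine ⟨_, hJ, J.powerset.finite_toSet.subset ?_⟩
    rintro T ⟨y', ⟨x, -, hx⟩, hy'⟩
    refine Finset.mem_coe.2 (Finset.mem_powerset.2 fun α hα => ?_)
    by_contra h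
    have h1 := (hx.2 α).1 hα
    rw [hy' α h] at h1
    exact not_lt.2 h1 hx.1
  nonempty y x hx T h := by
    obtain ⟨α, hα⟩ := hg.exists_eq_one y
    exact ⟨α, (h.2 α).2 (hα.symm ▸ hx.2)⟩
  mem y x _ T h α hα := subset_tsupport _ (h.1.trans_le ((h.2 α).1 hα)).ne'
  inf_subset y x _ x' _ hxx T T' h h' :=
    biInter_subset_biInter_left fun α hα => (h.2 α).2 (hxx.trans ((h'.2 α).1 hα))

theorem Leveling.comp {Z Z' : Type} [TopologicalSpace Z] [TopologicalSpace Z'] {F : A → Set Z}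
    {L : Finset A → Z → Set ℝ} (H : S.Leveling F L) (f : C(Z', Z)) :
    S.Leveling (fun α => f ⁻¹' F α) fun T z => L T (f z) where
  measurable T _ := H.measurable T _
  contSet T _ := (H.contSet T _).comp f.continuous.continuousAt
  exists_mem _ := H.exists_mem _
  unique _ := H.unique _
  locallyFinite := H.locallyFinite.preimage_continuous f.continuous
  nonempty _ := H.nonempty _
  mem _ := H.mem _
  inf_subset _ := H.inf_subset _

section Slots

variable {n : ℕ}

open Classical in
/-- The leveling of a simplex which adds the current vertex to a given leveling. -/
def slotLevel (σ : ComposableArrows A n)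
    (L : Finset A → stdSimplex ℝ (Fin (n + 1)) → Set ℝ) (S' : Finset A)
    (w : stdSimplex ℝ (Fin (n + 1))) : Set ℝ :=
  {x | ∃ j ∈ Finset.univ, x ∈ {x | ∃ T ∈ S'.powerset, x ∈
    {_x | insert (σ.obj j) T = S'} ∩ (slotSet (1 / 2) w j ∩ L T w)}}

open Classical in
theorem mem_slotLevel_iff {σ : ComposableArrows A n}
    {L : Finset A → stdSimplex ℝ (Fin (n + 1)) → Set ℝ} {S' : Finset A}
    {w : stdSimplex ℝ (Fin (n + 1))} {x : ℝ} : x ∈ slotLevel σ L S' w ↔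
      ∃ j T, insert (σ.obj j) T = S' ∧ InSlot w (1 / 2 + x / 2) j ∧ x ∈ L T w := by
  constructor
  · rintro ⟨j, -, T, -, h1, h2, h3⟩
    exact ⟨j, T, h1, h2, h3⟩
  · rintro ⟨j, T, h1, h2, h3⟩
    exact ⟨j, Finset.mem_univ j, T, Finset.mem_powerset.2 (h1 ▸ Finset.subset_insert _ _),
      h1, h2, h3⟩

theorem half_add_mem {x : ℝ} (hx : x ∈ Ioc (0 : ℝ) 1) : 1 / 2 + x / 2 ∈ Ioc (0 : ℝ) 1 :=
  half_mem (by norm_num) le_rfl hx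

theorem half_le_partWeight {w : stdSimplex ℝ (Fin (n + 1))} {x : ℝ} (hx : x ∈ Ioc (0 : ℝ) 1)
    {j : Fin (n + 1)} (h : InSlot w (1 / 2 + x / 2) j) : 1 / 2 ≤ partWeight w (· ≤ j) := by
  linarith [h.2, hx.1]

theorem Leveling.slotLevel {σ : ComposableArrows A n}
    {L : Finset A → stdSimplex ℝ (Fin (n + 1)) → Set ℝ}
    {F F' : A → Set (stdSimplex ℝ (Fin (n + 1)))} (H : S.Leveling F L) (hF : ∀ α, F α ⊆ F' α)
    (hσ : ∀ j, {w | 1 / 2 ≤ partWeight w (· ≤ j)} ⊆ F' (σ.obj j)) :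
    S.Leveling F' (slotLevel σ L) where
  measurable S' w := by
    classical
    have : CoveringSystem.slotLevel σ L S' w = ⋃ j ∈ (Finset.univ : Finset (Fin (n + 1))),
        ⋃ T ∈ S'.powerset, {_x | insert (σ.obj j) T = S'} ∩ (slotSet (1 / 2) w j ∩ L T w) := by
      ext x
      simp only [mem_iUnion, exists_prop]
      rfl
    rw [this]
    exact Finset.measurableSet_biUnion _ fun j _ => Finset.measurableSet_biUnion _ fun T _ =>
      (MeasurableSet.const _).inter ((measurableSet_slotSet _ _ _).inter (H.measurable T w))
  contSet S' w := by
    classical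
    exact contSetAt_exists _ fun j _ => contSetAt_exists _ fun T _ =>
      (contSetAt_const _).inter ((contSetAt_slotSet _ continuous_id _ _).inter (H.contSet T w))
  exists_mem w x hx := by
    classical
    obtain ⟨j, hj⟩ := exists_inSlot w (half_add_mem hx)
    obtain ⟨T, hT⟩ := H.exists_mem w x hx
    exact ⟨insert (σ.obj j) T, mem_slotLevel_iff.2 ⟨j, T, rfl, hj, hT⟩⟩
  unique w x hx S₁ S₂ h h' := by
    obtain ⟨j, T, rfl, hj, hT⟩ := mem_slotLevel_iff.1 h
    obtain ⟨j', T', rfl, hj', hT'⟩ := mem_slotLevel_iff.1 h'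
    rw [hj.unique hj', H.unique w x hx T T' hT hT']
  locallyFinite w := by
    classical
    obtain ⟨W, hW, hWf⟩ := H.locallyFinite w
    refine ⟨W, hW, ((Set.toFinite (univ : Set (Fin (n + 1)))).image2
      (fun j T => insert (σ.obj j) T) hWf).subset ?_⟩
    rintro S' ⟨w', ⟨x, hx, h⟩, hw'⟩
    obtain ⟨j, T, rfl, hj, hT⟩ := mem_slotLevel_iff.1 h
    exact ⟨j, mem_univ j, T, ⟨w', ⟨x, hx, hT⟩, hw'⟩, rfl⟩
  nonempty w x _ S' h := by
    classical
    obtain ⟨j, T, rfl, -, -⟩ := mem_slotLevel_iff.1 h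
    exact Finset.insert_nonempty _ _
  mem w x hx S' h α hα := by
    classical
    obtain ⟨j, T, rfl, hj, hT⟩ := mem_slotLevel_iff.1 h
    rcases Finset.mem_insert.1 hα with rfl | hα
    · exact hσ j (half_le_partWeight hx hj)
    · exact hF α (H.mem w x hx T hT α hα)
  inf_subset w x hx x' hx' hxx S₁ S₂ h h' := by
    classical
    obtain ⟨j, T, rfl, hj, hT⟩ := mem_slotLevel_iff.1 h
    obtain ⟨j', T', rfl, hj', hT'⟩ := mem_slotLevel_iff.1 h'
    intro y hy
    simp only [inf, mem_iInter, Finset.mem_insert] at hy ⊢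
    rintro α (rfl | hα)
    · exact S.mono (chainHom σ (hj.le (by linarith) hj')) (hy _ (Or.inl rfl))
    · exact mem_iInter₂.1 (H.inf_subset w x hx x' hx' hxx T T' hT hT'
        (mem_iInter₂.2 fun β hβ => hy β (Or.inr hβ))) α hα

end Slots

end CoveringSystem

section NerveRealization

variable {A : Type} [Category.{0} A]

/-- The characteristic map of a chain in the classifying space. -/
noncomputable def nervePt {n : ℕ} (σ : ComposableArrows A n) :
    C(stdSimplex ℝ (Fin (n + 1)), SSet.toTop.obj (nerve A)) :=
  realPt (K := nerve A) σ

theorem nervePt_map {m n : ℕ} (θ : Fin (m + 1) →o Fin (n + 1)) (σ : ComposableArrows A n)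
    (w : stdSimplex ℝ (Fin (m + 1))) :
    nervePt σ (stdSimplex.map θ w) = nervePt (pullChain σ θ) w :=
  realPt_map (K := nerve A) σ (SimplexCategory.Hom.mk θ) w

theorem exists_nerveDesc {Z : Type} [TopologicalSpace Z]
    (g : ∀ n, ComposableArrows A n → C(stdSimplex ℝ (Fin (n + 1)), Z))
    (hg : ∀ {m n : ℕ} (θ : Fin (m + 1) →o Fin (n + 1)) (σ : ComposableArrows A n)
      (w : stdSimplex ℝ (Fin (m + 1))), g n σ (stdSimplex.map θ w) = g m (pullChain σ θ) w) :
    ∃ f : C(SSet.toTop.obj (nerve A), Z), ∀ n (σ : ComposableArrows A n) w,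
      f (nervePt σ w) = g n σ w :=
  exists_realDesc (K := nerve A) g fun _ _ θ σ w => hg θ.toOrderHom σ w

theorem exists_nervePt_eq (z : SSet.toTop.obj (nerve A)) :
    ∃ (n : ℕ) (σ : ComposableArrows A n) (w : stdSimplex ℝ (Fin (n + 1))), nervePt σ w = z :=
  exists_realPt_eq (K := nerve A) z

/-- Homotopies out of a classifying space glued from a natural family of homotopies. -/
theorem nerve_homotopic {Z : Type} [TopologicalSpace Z]
    (H : ∀ n, ComposableArrows A n → stdSimplex ℝ (Fin (n + 1)) × unitInterval → Z)
    (hc : ∀ n σ, Continuous (H n σ))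
    (hH : ∀ {m n : ℕ} (θ : Fin (m + 1) →o Fin (n + 1)) (σ : ComposableArrows A n)
      (w : stdSimplex ℝ (Fin (m + 1))) (l : unitInterval),
      H n σ (stdSimplex.map θ w, l) = H m (pullChain σ θ) (w, l))
    {f g : C(SSet.toTop.obj (nerve A), Z)}
    (h0 : ∀ n (σ : ComposableArrows A n) w, H n σ (w, 0) = f (nervePt σ w))
    (h1 : ∀ n (σ : ComposableArrows A n) w, H n σ (w, 1) = g (nervePt σ w)) :
    f.Homotopic g := by
  obtain ⟨F, hF⟩ := exists_nerveDesc (Z := C(unitInterval, Z))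
    (fun n σ => ContinuousMap.curry ⟨H n σ, hc n σ⟩)
    (fun θ σ w => ContinuousMap.ext fun l => hH θ σ w l)
  have hF' : ∀ n (σ : ComposableArrows A n) w l, F (nervePt σ w) l = H n σ (w, l) := fun n σ w l =>
    congrArg (fun k : C(unitInterval, Z) => k l) (hF n σ w)
  refine ⟨⟨⟨fun p => F p.2 p.1, ?_⟩, fun z => ?_, fun z => ?_⟩⟩
  · exact (ContinuousMap.continuous_uncurry_of_continuous F).comp continuous_swap
  · obtain ⟨n, σ, w, rfl⟩ := exists_nervePt_eq z
    exact (hF' n σ w 0).trans (h0 n σ w)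
  · obtain ⟨n, σ, w, rfl⟩ := exists_nervePt_eq z
    exact (hF' n σ w 1).trans (h1 n σ w)

/-- The point dividing a segment in a simplex in a given ratio. -/
noncomputable def segmentPt {n : ℕ} (p : stdSimplex ℝ (Fin (n + 1)) × stdSimplex ℝ (Fin (n + 1)))
    (l : unitInterval) : stdSimplex ℝ (Fin (n + 1)) :=
  ⟨fun i => (1 - (l : ℝ)) * p.1 i + l * p.2 i, by
    refine convex_stdSimplex ℝ (Fin (n + 1)) p.1.2 p.2.2 ?_ l.2.1 (by ring)
    linarith [l.2.2]⟩

theorem segmentPt_map {m n : ℕ} (θ : Fin (m + 1) → Fin (n + 1))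
    (p : stdSimplex ℝ (Fin (m + 1)) × stdSimplex ℝ (Fin (m + 1))) (l : unitInterval) :
    segmentPt (stdSimplex.map θ p.1, stdSimplex.map θ p.2) l =
      stdSimplex.map θ (segmentPt p l) := by
  ext i
  change (1 - (l : ℝ)) * stdSimplex.map θ p.1 i + l * stdSimplex.map θ p.2 i = _
  simp only [stdSimplex_map_apply, Finset.mul_sum, ← Finset.sum_add_distrib]
  refine Finset.sum_congr rfl fun j _ => ?_
  split_ifs
  · rfl
  · simp

theorem continuous_segmentPt {n : ℕ} : Continuous fun z : (stdSimplex ℝ (Fin (n + 1)) ×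
    stdSimplex ℝ (Fin (n + 1))) × unitInterval => segmentPt z.1 z.2 := by
  refine Continuous.subtype_mk (continuous_pi fun i => ?_) _
  have h1 : Continuous fun z : (stdSimplex ℝ (Fin (n + 1)) × stdSimplex ℝ (Fin (n + 1))) ×
      unitInterval => z.1.1 i := (continuous_stdSimplex_apply i).comp (by fun_prop)
  have h2 : Continuous fun z : (stdSimplex ℝ (Fin (n + 1)) × stdSimplex ℝ (Fin (n + 1))) ×
      unitInterval => z.1.2 i := (continuous_stdSimplex_apply i).comp (by fun_prop)
  fun_prop

theorem segmentPt_zero {n : ℕ}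
    (p : stdSimplex ℝ (Fin (n + 1)) × stdSimplex ℝ (Fin (n + 1))) : segmentPt p 0 = p.1 := by
  ext i
  change (1 - ((0 : unitInterval) : ℝ)) * p.1 i + ((0 : unitInterval) : ℝ) * p.2 i = p.1 i
  simp

theorem segmentPt_one {n : ℕ}
    (p : stdSimplex ℝ (Fin (n + 1)) × stdSimplex ℝ (Fin (n + 1))) : segmentPt p 1 = p.2 := by
  ext i
  change (1 - ((1 : unitInterval) : ℝ)) * p.1 i + ((1 : unitInterval) : ℝ) * p.2 i = p.2 i
  simp

/-- A natural self-map of simplices induces a map of the classifying space homotopic to the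
identity. -/
theorem exists_resampleMap (a : ℝ) (ha : 0 ≤ a ∧ a ≤ 1 / 2) :
    ∃ κ : C(SSet.toTop.obj (nerve A), SSet.toTop.obj (nerve A)),
      (∀ n (σ : ComposableArrows A n) w, κ (nervePt σ w) = nervePt σ (resampling a ha w)) ∧
      κ.Homotopic (ContinuousMap.id _) := by
  obtain ⟨κ, hκ⟩ := exists_nerveDesc (A := A)
    (fun n σ => (nervePt σ).comp ⟨_, continuous_resampling a ha⟩) fun θ σ w => by
      change nervePt σ (resampling a ha (stdSimplex.map θ w)) = nervePt _ (resampling a ha w)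
      rw [resample_map, nervePt_map]
  refine ⟨κ, hκ, nerve_homotopic
    (fun n σ z => nervePt σ (segmentPt (resampling a ha z.1, z.1) z.2)) (fun n σ => ?_)
    (fun θ σ w l => ?_) (fun n σ w => ?_) fun n σ w => ?_⟩
  · exact (nervePt σ).continuous.comp (continuous_segmentPt.comp
      ((((continuous_resampling a ha).comp continuous_fst).prodMk continuous_fst).prodMk
        continuous_snd))
  · change nervePt σ (segmentPt (resampling a ha (stdSimplex.map θ w), stdSimplex.map θ w) l) =
      nervePt (pullChain σ θ) (segmentPt (resampling a ha w, w) l)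
    rw [resample_map, ← nervePt_map, ← segmentPt_map]
  · change nervePt σ (segmentPt (resampling a ha w, w) 0) = _
    rw [segmentPt_zero, hκ]
    rfl
  · change nervePt σ (segmentPt (resampling a ha w, w) 1) = nervePt σ w
    rw [segmentPt_one]

/-- The tautological natural family in the classifying space. -/
noncomputable def CoveringSystem.ptFamily {Y : Type} [TopologicalSpace Y]
    (S : CoveringSystem A Y) : S.NatFamily (SSet.toTop.obj (nerve A)) where
  val _ σ _ w := nervePt σ w
  natural θ σ _ w := nervePt_map θ σ w
  cont _ σ := (nervePt σ).continuous.comp continuous_snd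

end NerveRealization

namespace CoveringSystem

variable {A : Type} [Category.{0} A] {Y : Type} [TopologicalSpace Y] {S : CoveringSystem A Y}

/-- Compatible contractions for all chains. -/
structure ContractionSystem (S : CoveringSystem A Y) where
  G : ∀ n (σ : ComposableArrows A n), S.Contraction n σ
  rel : ∀ {m n : ℕ} (θ : Fin (m + 1) →o Fin (n + 1)) (σ : ComposableArrows A n),
    S.ContractionRel θ σ (G n σ) (G m (pullChain σ θ))

theorem nonempty_contractionSystem (S : CoveringSystem A Y) : Nonempty S.ContractionSystem :=
  let ⟨G, hG⟩ := S.exists_contraction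
  ⟨⟨G, hG⟩⟩

namespace ContractionSystem

variable (C : S.ContractionSystem)

/-- The point to which the first space of a chain gets contracted. -/
noncomputable def endPt {n : ℕ} (σ : ComposableArrows A n) (w : stdSimplex ℝ (Fin (n + 1))) :
    S.U (σ.obj (Fin.last n)) :=
  (C.G n σ).1 ((w, 1), Classical.arbitrary _)

theorem endPt_map {m n : ℕ} (θ : Fin (m + 1) →o Fin (n + 1)) (σ : ComposableArrows A n)
    (w : stdSimplex ℝ (Fin (m + 1))) :
    C.endPt σ (stdSimplex.map θ w) =
      S.act (chainHom σ (Fin.le_last (θ (Fin.last m)))) (C.endPt (pullChain σ θ) w) :=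
  (C.rel θ σ w 1 _).trans (congrArg _ ((C.G m (pullChain σ θ)).2.2 w _ _))

theorem continuous_endPt {n : ℕ} (σ : ComposableArrows A n) : Continuous (C.endPt σ) := by
  unfold endPt
  fun_prop

theorem exists_descent : ∃ ψ : C(SSet.toTop.obj (nerve A), Y),
    ∀ n (σ : ComposableArrows A n) w, ψ (nervePt σ w) = S.q _ (C.endPt σ w) :=
  exists_nerveDesc (fun _ σ => (S.q _).comp ⟨_, C.continuous_endPt σ⟩) fun θ σ w =>
    (congrArg (S.q _) (C.endPt_map θ σ w)).trans (S.q_act _ _)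

/-- The natural family of the paths in `Y` traced by the contractions. -/
noncomputable def pathFamily : S.NatFamily C(unitInterval, Y) where
  val n σ x w := ⟨fun l => S.q _ ((C.G n σ).1 ((w, l), x)), by fun_prop⟩
  natural θ σ x w := ContinuousMap.ext fun l =>
    (congrArg (S.q _) (C.rel θ σ w l x)).trans (S.q_act _ _)
  cont n σ := (ContinuousMap.curry
    ⟨fun z : (S.U (σ.obj 0) × stdSimplex ℝ (Fin (n + 1))) × unitInterval =>
      S.q _ ((C.G n σ).1 ((z.1.2, z.2), z.1.1)), by fun_prop⟩).continuous

variable {Z I : Type} [TopologicalSpace Z] [LinearOrder I] {y : Z → Y} {m : I → A}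
  {R : I → Z → Set ℝ} {ρ : I → Z → ℝ} {u : ∀ i, Z → S.U (m i)} {D : I → Set Z}
  [Nonempty (SSet.toTop.obj (nerve A))] [Nonempty C(unitInterval, Y)]

theorem pathFamily_evalAt (H : LayeredFamily S y m R ρ u D)
    {ψ : C(SSet.toTop.obj (nerve A), Y)}
    (hψ : ∀ n (σ : ComposableArrows A n) w, ψ (nervePt σ w) = S.q _ (C.endPt σ w)) (z : Z) :
    LayeredFamily.evalAt C.pathFamily R ρ u z 0 = y z ∧
      LayeredFamily.evalAt C.pathFamily R ρ u z 1 =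
        ψ (LayeredFamily.evalAt S.ptFamily R ρ u z) := by
  obtain ⟨n, θ, w, hw, -, -, hθ⟩ := (H.weighted.isWeight z).exists_rep
  have hmono := NatFamily.monotone_rep (H.weighted.le z) θ hθ
  unfold LayeredFamily.evalAt
  rw [C.pathFamily.eval_eq θ w hw hmono, S.ptFamily.eval_eq θ w hw hmono]
  constructor
  · refine (congrArg (S.q _) ((C.G n _).2.1 w _)).trans ((S.q_act _ _).trans ?_)
    exact H.weighted.q_eq (θ 0) z (H.weighted.mem (θ 0) z (hθ 0))
  · refine Eq.trans ?_ (hψ n _ w).symm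
    exact congrArg (S.q _) ((C.G n _).2.2 w _ _)

theorem homotopic_descent_evalAt (H : LayeredFamily S y m R ρ u D)
    {ψ : C(SSet.toTop.obj (nerve A), Y)}
    (hψ : ∀ n (σ : ComposableArrows A n) w, ψ (nervePt σ w) = S.q _ (C.endPt σ w))
    {φ : C(Z, SSet.toTop.obj (nerve A))}
    (hφ : ∀ z, φ z = LayeredFamily.evalAt S.ptFamily R ρ u z) {f : C(Z, Y)} (hf : ∀ z, f z = y z) :
    f.Homotopic (ψ.comp φ) := by
  let F : C(Z, C(unitInterval, Y)) := ⟨_, LayeredFamily.continuous_evalAt C.pathFamily H⟩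
  refine ⟨⟨⟨fun p => F p.2 p.1, ?_⟩, fun z => ?_, fun z => ?_⟩⟩
  · exact (ContinuousMap.continuous_uncurry_of_continuous F).comp continuous_swap
  · exact (C.pathFamily_evalAt H hψ z).1.trans (hf z).symm
  · exact (C.pathFamily_evalAt H hψ z).2.trans (congrArg ψ (hφ z)).symm

end ContractionSystem

end CoveringSystem

theorem stdSimplex_map_eq_self {n : ℕ} {θ : Fin (n + 1) → Fin (n + 1)}
    {v : stdSimplex ℝ (Fin (n + 1))} (h : ∀ i, v i ≠ 0 → θ i = i) : stdSimplex.map θ v = v := by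
  ext i
  rw [stdSimplex_map_apply]
  have : ∀ j, (if θ j = i then v j else 0) = if j = i then v j else 0 := fun j => by
    by_cases hj : v j = 0
    · simp [hj]
    · rw [h j hj]
  simp [this]

/-- Truncation of an ordinal at a given element. -/
def truncHom {n : ℕ} (j : Fin (n + 1)) : Fin (n + 1) →o Fin (n + 1) where
  toFun i := min i j
  monotone' _ _ h := min_le_min_right _ h

theorem truncHom_le {n : ℕ} (i j : Fin (n + 1)) : truncHom j i ≤ j := min_le_right i j

theorem truncHom_comp {m n : ℕ} (θ : Fin (m + 1) →o Fin (n + 1)) (j : Fin (m + 1)) :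
    (truncHom (θ j)).comp θ = θ.comp (truncHom j) :=
  OrderHom.ext _ _ (funext fun _ => (θ.monotone.map_min).symm)

theorem truncHom_comp_truncHom {n : ℕ} {i j : Fin (n + 1)} (h : i ≤ j) :
    (truncHom j).comp (truncHom i) = truncHom i :=
  OrderHom.ext _ _ (funext fun _ => min_eq_left ((min_le_right _ _).trans h))

theorem truncHom_resampling {n : ℕ} {w : stdSimplex ℝ (Fin (n + 1))} {j : Fin (n + 1)}
    (h : 1 / 2 ≤ partWeight w (· ≤ j)) (h0 : (0 : ℝ) ≤ 0 ∧ (0 : ℝ) ≤ 1 / 2) :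
    stdSimplex.map (truncHom j) (resampling 0 h0 w) = resampling 0 h0 w := by
  refine stdSimplex_map_eq_self fun i hi => min_eq_left (not_lt.1 fun hlt => ?_)
  obtain ⟨x, hx, hs⟩ := exists_inSlot_of_resample_ne_zero hi
  have h1 : partWeight w (· ≤ j) ≤ partWeight w (· < i) :=
    partWeight_mono w fun k hk => lt_of_le_of_lt hk hlt
  linarith [hs.1, hx.2]

namespace CoveringSystem.ContractionSystem

open Set

variable {A : Type} [Category.{0} A] {Y : Type} [TopologicalSpace Y] {S : CoveringSystem A Y}
  (C : S.ContractionSystem)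

/-- The end point of the contraction of a subchain, transported to a later vertex. -/
noncomputable def tip {m n : ℕ} (σ : ComposableArrows A n) (ξ : Fin (m + 1) →o Fin (n + 1))
    (i : Fin (n + 1)) (h : ξ (Fin.last m) ≤ i) (v : stdSimplex ℝ (Fin (m + 1))) : S.U (σ.obj i) :=
  S.act (chainHom σ h) (C.endPt (pullChain σ ξ) v)

section Tip

variable {m n k : ℕ} (σ : ComposableArrows A n) (ξ : Fin (m + 1) →o Fin (n + 1))
  (i : Fin (n + 1)) (h : ξ (Fin.last m) ≤ i)

theorem tip_map (θ : Fin (k + 1) →o Fin (m + 1)) (v : stdSimplex ℝ (Fin (k + 1))) :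
    C.tip σ ξ i h (stdSimplex.map θ v) =
      C.tip σ (ξ.comp θ) i ((ξ.monotone (Fin.le_last _)).trans h) v :=
  (congrArg _ (C.endPt_map θ (pullChain σ ξ) v)).trans
    (S.act_act_chainHom σ (ξ.monotone (Fin.le_last _)) h _)

theorem tip_congr {ξ' : Fin (m + 1) →o Fin (n + 1)} (hξ : ξ = ξ')
    (v : stdSimplex ℝ (Fin (m + 1))) : C.tip σ ξ i h v = C.tip σ ξ' i (hξ ▸ h) v := by
  subst hξ
  rfl

theorem act_tip {j : Fin (n + 1)} (hij : i ≤ j) (v : stdSimplex ℝ (Fin (m + 1))) :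
    S.act (chainHom σ hij) (C.tip σ ξ i h v) = C.tip σ ξ j (h.trans hij) v :=
  S.act_act_chainHom σ h hij _

theorem continuous_tip : Continuous (C.tip σ ξ i h) :=
  (S.act _).continuous.comp (C.continuous_endPt _)

theorem q_tip {ψ : C(SSet.toTop.obj (nerve A), Y)}
    (hψ : ∀ n (σ : ComposableArrows A n) w, ψ (nervePt σ w) = S.q _ (C.endPt σ w))
    (v : stdSimplex ℝ (Fin (m + 1))) :
    S.q _ (C.tip σ ξ i h v) = ψ (nervePt σ (stdSimplex.map ξ v)) := by
  rw [nervePt_map, hψ]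
  exact S.q_act _ _

end Tip

/-- The lift to a vertex of the descent map evaluated at a resampled point. -/
noncomputable def vertexPt {n : ℕ} (h0 : (0 : ℝ) ≤ 0 ∧ (0 : ℝ) ≤ 1 / 2) (σ : ComposableArrows A n)
    (j : Fin (n + 1)) (w : stdSimplex ℝ (Fin (n + 1))) : S.U (σ.obj j) :=
  C.tip σ (truncHom j) j (truncHom_le _ _) (resampling 0 h0 w)

variable {h0 : (0 : ℝ) ≤ 0 ∧ (0 : ℝ) ≤ 1 / 2}

theorem vertexPt_map {m n : ℕ} (θ : Fin (m + 1) →o Fin (n + 1)) (σ : ComposableArrows A n)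
    (j : Fin (m + 1)) (w : stdSimplex ℝ (Fin (m + 1))) :
    C.vertexPt h0 σ (θ j) (stdSimplex.map θ w) = C.vertexPt h0 (pullChain σ θ) j w := by
  unfold vertexPt
  rw [resample_map, tip_map]
  exact C.tip_congr σ _ _ _ (truncHom_comp θ j) _

theorem act_vertexPt {n : ℕ} (σ : ComposableArrows A n) {i j : Fin (n + 1)} (hij : i ≤ j)
    {w : stdSimplex ℝ (Fin (n + 1))} (hw : 1 / 2 ≤ partWeight w (· ≤ i)) :
    S.act (chainHom σ hij) (C.vertexPt h0 σ i w) = C.vertexPt h0 σ j w := by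
  unfold vertexPt
  rw [act_tip]
  refine Eq.trans ?_ (congrArg (C.tip σ (truncHom j) j _) (truncHom_resampling hw h0))
  rw [tip_map]
  exact (C.tip_congr σ _ _ _ (truncHom_comp_truncHom hij) _).symm

theorem q_vertexPt {n : ℕ} (σ : ComposableArrows A n) (j : Fin (n + 1))
    {w : stdSimplex ℝ (Fin (n + 1))} (hw : 1 / 2 ≤ partWeight w (· ≤ j))
    {ψ : C(SSet.toTop.obj (nerve A), Y)}
    (hψ : ∀ n (σ : ComposableArrows A n) w, ψ (nervePt σ w) = S.q _ (C.endPt σ w)) :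
    S.q _ (C.vertexPt h0 σ j w) = ψ (nervePt σ (resampling 0 h0 w)) := by
  unfold vertexPt
  rw [C.q_tip _ _ _ _ hψ, truncHom_resampling hw]

/-- The layered family of the vertices of a simplex. -/
theorem vertexLayered {n : ℕ} (σ : ComposableArrows A n) {ψ : C(SSet.toTop.obj (nerve A), Y)}
    (hψ : ∀ n (σ : ComposableArrows A n) w, ψ (nervePt σ w) = S.q _ (C.endPt σ w)) :
    LayeredFamily S (fun w => ψ (nervePt σ (resampling 0 h0 w))) σ.obj
      (fun j w => slotSet (1 / 2) w j) (fun _ _ => 1) (C.vertexPt h0 σ)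
      (fun j => {w | 1 / 2 ≤ partWeight w (· ≤ j)}) where
  measurable j w := measurableSet_slotSet _ w j
  contSet j w := contSetAt_slotSet _ continuous_id j w
  cont _ := continuous_const
  nonneg _ _ := zero_le_one
  locallyFinite := locallyFinite_of_finite _
  sum_eq w x hx := by
    obtain ⟨j, hj⟩ := exists_inSlot w (half_add_mem hx)
    refine ⟨Unit, fun _ => j, fun _ _ _ => rfl, fun _ => hj, fun i hi _ => ⟨(), hj.unique hi⟩, ?_⟩
    exact finsum_unique _
  isClosed j := isClosed_le continuous_const (continuous_partWeight _)
  mem j w x hx h _ := half_le_partWeight hx h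
  contOn j := ((C.continuous_tip σ _ j _).comp (continuous_resampling 0 h0)).continuousOn
  q_eq j w hw := C.q_vertexPt σ j hw hψ
  subset w i j hij _ _ _ _ _ _ _ _ := S.mono (chainHom σ hij)

theorem evalAt_vertexPt [Nonempty (SSet.toTop.obj (nerve A))] {n : ℕ} (σ : ComposableArrows A n)
    {ψ : C(SSet.toTop.obj (nerve A), Y)}
    (hψ : ∀ n (σ : ComposableArrows A n) w, ψ (nervePt σ w) = S.q _ (C.endPt σ w))
    (h1 : (0 : ℝ) ≤ 1 / 2 ∧ (1 / 2 : ℝ) ≤ 1 / 2) (w : stdSimplex ℝ (Fin (n + 1))) :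
    LayeredFamily.evalAt S.ptFamily (fun j w => slotSet (1 / 2) w j) (fun _ _ => 1)
      (C.vertexPt h0 σ) w = nervePt σ (resampling (1 / 2) h1 w) := by
  have H := (C.vertexLayered (h0 := h0) σ hψ).weighted
  obtain ⟨k, θ, v, hv, -, -, hθ⟩ := (H.isWeight w).exists_rep
  unfold LayeredFamily.evalAt
  rw [S.ptFamily.eval_eq θ v hv (NatFamily.monotone_rep (H.le w) θ hθ),
    S.ptFamily.ofChain_eq (pullChain σ θ) (fun j => C.vertexPt h0 σ (θ j) w)
      (fun {i j} hij => C.act_vertexPt σ (θ.monotone hij) (H.mem _ w (hθ i))) _ fun _ => rfl]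
  refine (nervePt_map θ σ v).symm.trans (congrArg _ ?_)
  ext i
  rw [← pushWeights_eq_map, hv]
  exact mul_one _

end CoveringSystem.ContractionSystem

namespace CoveringSystem.LayeredFamily

variable {A : Type} [Category.{0} A] {Y : Type} [TopologicalSpace Y] {S : CoveringSystem A Y}

open Set

variable {X : Type} [TopologicalSpace X] [Nonempty X] (N : S.NatFamily X)

theorem evalAt_push {Z Z' I E : Type} [TopologicalSpace Z] [LinearOrder I]
    [LinearOrder E] {y : Z → Y} {m : I → A} {R : I → Z → Set ℝ} {ρ : I → Z → ℝ}
    {u : ∀ i, Z → S.U (m i)} {D : I → Set Z} {m' : E → A} {R' : E → Z' → Set ℝ}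
    {ρ' : E → Z' → ℝ} {u' : ∀ i, Z' → S.U (m' i)} (H : LayeredFamily S y m R ρ u D) {z : Z}
    {z' : Z'} (τ : I →o E)
    (hR : ∀ e, ∀ x ∈ Ioc (0 : ℝ) 1, x ∈ R' e z' ↔ ∃ i, τ i = e ∧ x ∈ R i z)
    (hinj : ∀ i i', ∀ x ∈ Ioc (0 : ℝ) 1, x ∈ R i z → x ∈ R i' z → τ i = τ i' → i = i')
    (hρ : ∀ i, ρ' (τ i) z' = ρ i z)
    (hu : ∀ i, (⟨m' (τ i), u' (τ i) z'⟩ : S.Elt) = ⟨m i, u i z⟩) :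
    evalAt N R' ρ' u' z' = evalAt N R ρ u z := by
  classical
  have hfin := H.locallyFinite.point_finite z
  refine N.eval_push (H.weighted.isWeight z) (H.weighted.le z) τ hfin.toFinset
    (fun i hi => hfin.mem_toFinset.2 ⟨exists_mem_of_unitMass_ne_zero (left_ne_zero_of_mul hi),
      right_ne_zero_of_mul hi⟩) (fun e => ?_) fun i _ => hu i
  let Q : I → Set ℝ := fun i => {x | τ i = e ∧ x ∈ R i z}
  have h1 : ∀ i, (if τ i = e then unitMass (R i z) * ρ i z else 0) =
      unitMass (Q i) * ρ' e z' := by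
    intro i
    by_cases h : τ i = e
    · rw [if_pos h, ← h, hρ]
      exact congrArg (· * _) (unitMass_congr fun x _ => ⟨fun hx => ⟨h, hx⟩, fun hx => hx.2⟩)
    · rw [if_neg h, (unitMass_congr (Q := ∅) fun x _ => ⟨fun hx => (h hx.1).elim, fun hx =>
        hx.elim⟩).trans unitMass_empty, zero_mul]
  by_cases h0 : ρ' e z' = 0
  · rw [h0, mul_zero]
    refine (Finset.sum_eq_zero fun i _ => ?_).symm
    refine Eq.trans ?_ ((h1 i).trans (by rw [h0, mul_zero]))
    congr
  · refine Eq.trans ?_ (Finset.sum_congr rfl fun i _ => Eq.trans (h1 i).symm (by congr))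
    rw [← Finset.sum_mul]
    refine congrArg (· * _) (sum_unitMass _ Q _ (fun i => ?_) (fun x hx => ?_) ?_).symm
    · by_cases h : τ i = e
      · convert H.measurable i z using 1
        exact Set.ext fun x => ⟨fun hx => hx.2, fun hx => ⟨h, hx⟩⟩
      · convert MeasurableSet.empty using 1
        exact Set.ext fun x => ⟨fun hx => (h hx.1).elim, fun hx => hx.elim⟩
    · rw [hR e x hx]
      constructor
      · rintro ⟨i, hi, hx'⟩
        exact ⟨i, hfin.mem_toFinset.2 ⟨⟨x, hx, hx'⟩, by rw [← hρ, hi]; exact h0⟩, hi, hx'⟩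
      · rintro ⟨i, -, hi, hx'⟩
        exact ⟨i, hi, hx'⟩
    · exact fun x hx i i' h h' => hinj i i' x hx h.2 h'.2 (h.1.trans h'.1.symm)

theorem evalAt_join_push {Z Z' I E E' : Type} [TopologicalSpace Z] [LinearOrder I] [LinearOrder E]
    [LinearOrder E'] {m : I → A} {R : I → Z → Set ℝ} {ρ : I → Z → ℝ}
    {u : ∀ i, Z → S.U (m i)} {n : E → A} {Q : E → Z → Set ℝ} {π : E → Z → ℝ}
    {v : ∀ i, Z → S.U (n i)} {y : Z × unitInterval → Y} {D : I ⊕ₗ E → Set (Z × unitInterval)}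
    {R' : I → Z' → Set ℝ} {ρ' : I → Z' → ℝ}
    {u' : ∀ i, Z' → S.U (m i)} {n' : E' → A} {Q' : E' → Z' → Set ℝ} {π' : E' → Z' → ℝ}
    {v' : ∀ i, Z' → S.U (n' i)}
    (H : LayeredFamily S y (joinIdx m n) (joinLayer R Q)
      (fun i z => Sum.elim (fun i => ρ i z.1) (fun e => π e z.1) (ofLex i)) (joinPt u v) D)
    {z : Z} {z' : Z'} (l : unitInterval) (τ : E →o E')
    (hR : ∀ i, ∀ x ∈ Ioc (0 : ℝ) 1, x ∈ R' i z' ↔ x ∈ R i z)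
    (hρ : ∀ i, ρ' i z' = ρ i z) (hu : ∀ i, u' i z' = u i z)
    (hQ : ∀ e, ∀ x ∈ Ioc (0 : ℝ) 1, x ∈ Q' e z' ↔ ∃ i, τ i = e ∧ x ∈ Q i z)
    (hinj : ∀ i i', ∀ x ∈ Ioc (0 : ℝ) 1, x ∈ Q i z → x ∈ Q i' z → τ i = τ i' → i = i')
    (hπ : ∀ i, π' (τ i) z' = π i z)
    (hv : ∀ i, (⟨n' (τ i), v' (τ i) z'⟩ : S.Elt) = ⟨n i, v i z⟩) :
    evalAt N (joinLayer R' Q')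
      (fun i z => Sum.elim (fun i => ρ' i z.1) (fun e => π' e z.1) (ofLex i)) (joinPt u' v')
      (z', l) =
    evalAt N (joinLayer R Q)
      (fun i z => Sum.elim (fun i => ρ i z.1) (fun e => π e z.1) (ofLex i)) (joinPt u v)
      (z, l) := by
  refine evalAt_push N H
    ⟨fun i => toLex (Sum.map id τ (ofLex i)), ?_⟩ ?_ ?_ ?_ ?_
  · rintro (i | i) (j | j) h
    · exact Sum.Lex.inl_le_inl_iff.2 (Sum.Lex.inl_le_inl_iff.1 h)
    · exact Sum.Lex.inl_le_inr _ _
    · exact (Sum.Lex.not_inr_le_inl h).elim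
    · exact Sum.Lex.inr_le_inr_iff.2 (τ.monotone (Sum.Lex.inr_le_inr_iff.1 h))
  · rintro (i | e) x hx
    · constructor
      · rintro ⟨h1, h2⟩
        exact ⟨Sum.inl i, rfl, (hR i x hx).1 h1, h2⟩
      · rintro ⟨j | j, hj, h1, h2⟩
        · obtain rfl : j = i := Sum.inl_injective hj
          exact ⟨(hR j x hx).2 h1, h2⟩
        · exact (Sum.inr_ne_inl hj).elim
    · constructor
      · rintro ⟨h1, h2⟩
        obtain ⟨j, hj, hjx⟩ := (hQ e x hx).1 h1
        exact ⟨Sum.inr j, congrArg Sum.inr hj, hjx, h2⟩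
      · rintro ⟨j | j, hj, h1, h2⟩
        · exact (Sum.inl_ne_inr hj).elim
        · exact ⟨(hQ e x hx).2 ⟨j, Sum.inr_injective hj, h1⟩, h2⟩
  · rintro (i | i) (j | j) x hx h h' hij
    · exact congrArg Sum.inl (Sum.inl_injective hij : i = j)
    · exact (Sum.inl_ne_inr hij).elim
    · exact (Sum.inr_ne_inl hij).elim
    · exact congrArg Sum.inr (hinj i j x hx h.1 h'.1 (Sum.inr_injective hij))
  · rintro (i | i)
    · exact hρ i
    · exact hπ i
  · rintro (i | i)
    · exact congrArg (Elt.mk (m i)) (hu i)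
    · exact hv i

end CoveringSystem.LayeredFamily

namespace CoveringSystem

open Set

theorem slotLevel_map {A : Type} [Category.{0} A] {m n : ℕ} (θ : Fin (m + 1) →o Fin (n + 1))
    (σ : ComposableArrows A n) {L : Finset A → stdSimplex ℝ (Fin (n + 1)) → Set ℝ}
    {L' : Finset A → stdSimplex ℝ (Fin (m + 1)) → Set ℝ} {w : stdSimplex ℝ (Fin (m + 1))}
    (hL : ∀ T, L T (stdSimplex.map θ w) = L' T w) {S' : Finset A} {x : ℝ}
    (hx : x ∈ Ioc (0 : ℝ) 1) :
    x ∈ slotLevel σ L S' (stdSimplex.map θ w) ↔ x ∈ slotLevel (pullChain σ θ) L' S' w := by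
  classical
  rw [mem_slotLevel_iff, mem_slotLevel_iff]
  simp only [inSlot_map_iff θ w (half_add_mem hx), hL]
  constructor
  · rintro ⟨_, T, h1, ⟨j, rfl, hj⟩, h2⟩
    exact ⟨j, T, h1, hj, h2⟩
  · rintro ⟨j, T, h1, hj, h2⟩
    exact ⟨θ j, T, h1, ⟨j, rfl, hj⟩, h2⟩

end CoveringSystem

namespace CoveringSystem

open Set

variable {A : Type} [Category.{0} A] {Y : Type} [TopologicalSpace Y] {S : CoveringSystem A Y}
  {ψ : C(SSet.toTop.obj (nerve A), Y)}

theorem exists_obj_subset (S : CoveringSystem A Y) {n : ℕ} (σ : ComposableArrows A n)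
    {w : stdSimplex ℝ (Fin (n + 1))} {α : A}
    (h : 1 / 2 ≤ partWeight w fun j => S.V (σ.obj j) ⊆ S.V α) :
    ∃ j, S.V (σ.obj j) ⊆ S.V α ∧ 1 / 2 ≤ partWeight w (· ≤ j) := by
  classical
  have hne : (Finset.univ.filter fun j => S.V (σ.obj j) ⊆ S.V α).Nonempty := by
    by_contra hc
    rw [Finset.not_nonempty_iff_eq_empty, Finset.filter_eq_empty_iff] at hc
    have h0 : partWeight w (fun j => S.V (σ.obj j) ⊆ S.V α) = 0 := by
      unfold partWeight
      exact Finset.sum_eq_zero fun j _ => if_neg (hc (Finset.mem_univ j))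
    rw [h0] at h
    norm_num at h
  refine ⟨_, (Finset.mem_filter.1 (Finset.max'_mem _ hne)).2, h.trans ?_⟩
  exact partWeight_mono w fun j hj =>
    Finset.le_max' _ _ (Finset.mem_filter.2 ⟨Finset.mem_univ j, hj⟩)

theorem exists_closed_family (C : S.ContractionSystem) {h0 : (0 : ℝ) ≤ 0 ∧ (0 : ℝ) ≤ 1 / 2}
    (hψ : ∀ n (σ : ComposableArrows A n) w, ψ (nervePt σ w) = S.q _ (C.endPt σ w))
    {ψ' : C(SSet.toTop.obj (nerve A), Y)}
    (hψ' : ∀ n (σ : ComposableArrows A n) w, ψ' (nervePt σ w) = ψ (nervePt σ (resampling 0 h0 w)))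
    {T : A → Set Y} (hT : ∀ α, IsClosed (T α)) (hTV : ∀ α, T α ⊆ S.V α) :
    ∃ F : A → Set (SSet.toTop.obj (nerve A)), (∀ α, IsClosed (F α)) ∧
      (∀ α, F α ⊆ ψ' ⁻¹' S.V α) ∧ (∀ α, ψ' ⁻¹' T α ⊆ F α) ∧
      ∀ n (σ : ComposableArrows A n) j,
        {w | 1 / 2 ≤ partWeight w (· ≤ j)} ⊆ nervePt σ ⁻¹' F (σ.obj j) := by
  have hc : ∀ α, ∃ c : C(SSet.toTop.obj (nerve A), ℝ), ∀ n (σ : ComposableArrows A n) w,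
      c (nervePt σ w) = partWeight w fun j => S.V (σ.obj j) ⊆ S.V α := fun α =>
    exists_nerveDesc (fun n σ => ⟨_, continuous_partWeight fun j => S.V (σ.obj j) ⊆ S.V α⟩)
      fun θ σ w => partWeight_map θ w _
  choose c hc using hc
  refine ⟨fun α => {z | 1 / 2 ≤ c α z} ∪ ψ' ⁻¹' T α, fun α =>
    (isClosed_le continuous_const (c α).continuous).union ((hT α).preimage ψ'.continuous),
    fun α z hz => ?_, fun α => subset_union_right, fun n σ j w hw => Or.inl ?_⟩
  · rcases hz with hz | hz
    · obtain ⟨n, σ, w, rfl⟩ := exists_nervePt_eq z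
      obtain ⟨j, hj, hw⟩ := S.exists_obj_subset σ
        ((show (1 : ℝ) / 2 ≤ _ from hz).trans_eq (hc α n σ w))
      refine hj ?_
      rw [hψ', ← C.q_vertexPt (h0 := h0) σ j hw hψ]
      exact S.q_mem _ _
    · exact hTV α hz
  · refine (show (1 : ℝ) / 2 ≤ _ from hw).trans ?_
    rw [hc]
    exact partWeight_mono w fun i hi => S.mono (chainHom σ hi)

theorem exists_slotLayered [Nonempty A] (C : S.ContractionSystem)
    {h0 : (0 : ℝ) ≤ 0 ∧ (0 : ℝ) ≤ 1 / 2}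
    (hψ : ∀ n (σ : ComposableArrows A n) w, ψ (nervePt σ w) = S.q _ (C.endPt σ w))
    {ψ' : C(SSet.toTop.obj (nerve A), Y)}
    (hψ' : ∀ n (σ : ComposableArrows A n) w, ψ' (nervePt σ w) = ψ (nervePt σ (resampling 0 h0 w)))
    {g : A → Y → ℝ} (hg : S.Bumps g) :
    ∃ (κ : Type) (μ : κ → A) (s : ∀ k, SSet.toTop.obj (nerve A) → S.U (μ k))
      (ρ : ∀ n, ComposableArrows A n → κ → stdSimplex ℝ (Fin (n + 1)) → ℝ)
      (D : ∀ n, ComposableArrows A n → S.Tag κ → Set (stdSimplex ℝ (Fin (n + 1)))),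
      (∀ {m n : ℕ} (θ : Fin (m + 1) →o Fin (n + 1)) (σ : ComposableArrows A n) k w,
        ρ n σ k (stdSimplex.map θ w) = ρ m (pullChain σ θ) k w) ∧
      (∀ n (σ : ComposableArrows A n), LayeredFamily S (fun w => ψ' (nervePt σ w))
        (fun i : S.Tag κ => S.meet i.1)
        (fun i => slotLevel σ (fun T w => levelSet g T (ψ' (nervePt σ w))) i.1)
        (fun i => ρ n σ i.2)
        (fun i w => S.transfer (μ i.2) (S.meet i.1) (s i.2 (nervePt σ w))) (D n σ)) ∧
      ∀ n (σ : ComposableArrows A n) w, ∀ x ∈ Ioc (0 : ℝ) 1, ∀ T,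
        x ∈ slotLevel σ (fun T w => levelSet g T (ψ' (nervePt σ w))) T w →
        S.V (S.meet T) = S.inf T := by
  obtain ⟨F, hF, hFV, hgF, hσ⟩ := exists_closed_family C hψ hψ'
    (fun α => isClosed_tsupport (g α)) hg.subset
  obtain ⟨a⟩ := S.exists_atlas ψ'.continuous F hF hFV
  obtain ⟨ρ, hρ, hρmap⟩ := exists_nerve_partition
    (fun n (σ : ComposableArrows A n) k => nervePt σ ⁻¹' a.O k)
    (fun n σ k => (a.isOpen k).preimage (nervePt σ).continuous) (fun n σ w => a.cover _)
    (fun θ σ k => by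
      ext w
      simp only [mem_preimage, nervePt_map])
  have H : ∀ n (σ : ComposableArrows A n), S.Leveling (fun α => nervePt σ ⁻¹' F α)
      (slotLevel σ fun T w => levelSet g T (ψ' (nervePt σ w))) := fun n σ =>
    (hg.leveling.comp (ψ'.comp (nervePt σ))).slotLevel
      (fun α => preimage_mono (f := nervePt σ) (hgF α)) (hσ n σ)
  refine ⟨_, a.μ, a.s, fun n σ k => ρ n σ k, _, hρmap, fun n σ =>
    (H n σ).layered (y := fun w => ψ' (nervePt σ w))
      (fun α => preimage_mono (f := nervePt σ) (hFV α)) (a.comp (nervePt σ))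
      (hρ n σ).isPartition, fun n σ w x hx T h => ?_⟩
  exact (H n σ).V_meet (y := fun w => ψ' (nervePt σ w))
    (fun α => preimage_mono (f := nervePt σ) (hFV α)) hx h

end CoveringSystem

namespace CoveringSystem

open Set

variable {A : Type} [Category.{0} A] {Y : Type} [TopologicalSpace Y] {S : CoveringSystem A Y}
  {ψ : C(SSet.toTop.obj (nerve A), Y)}

open LayeredFamily in
/-- Natural families of layered families which can be joined give homotopic maps. -/
theorem homotopic_of_join [Nonempty (SSet.toTop.obj (nerve A))] {I : Type} [LinearOrder I]
    {E : ∀ n, ComposableArrows A n → Type} [∀ n σ, LinearOrder (E n σ)] {m : I → A}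
    {R : ∀ n, ComposableArrows A n → I → stdSimplex ℝ (Fin (n + 1)) → Set ℝ}
    {ρ : ∀ n, ComposableArrows A n → I → stdSimplex ℝ (Fin (n + 1)) → ℝ}
    {u : ∀ n, ComposableArrows A n → ∀ i, stdSimplex ℝ (Fin (n + 1)) → S.U (m i)}
    {D : ∀ n, ComposableArrows A n → I → Set (stdSimplex ℝ (Fin (n + 1)))}
    {m' : ∀ n σ, E n σ → A} {Q : ∀ n σ, E n σ → stdSimplex ℝ (Fin (n + 1)) → Set ℝ}
    {π : ∀ n σ, E n σ → stdSimplex ℝ (Fin (n + 1)) → ℝ}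
    {v : ∀ n σ (e : E n σ), stdSimplex ℝ (Fin (n + 1)) → S.U (m' n σ e)}
    {D' : ∀ n σ, E n σ → Set (stdSimplex ℝ (Fin (n + 1)))}
    {y : ∀ n, ComposableArrows A n → stdSimplex ℝ (Fin (n + 1)) → Y}
    (H : ∀ n σ, LayeredFamily S (y n σ) m (R n σ) (ρ n σ) (u n σ) (D n σ))
    (H' : ∀ n σ, LayeredFamily S (y n σ) (m' n σ) (Q n σ) (π n σ) (v n σ) (D' n σ))
    (hsub : ∀ n σ z i e, ∀ x ∈ Ioc (0 : ℝ) 1, ∀ x' ∈ Ioc (0 : ℝ) 1, x ≤ x' → x ∈ R n σ i z →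
      x' ∈ Q n σ e z → S.V (m i) ⊆ S.V (m' n σ e))
    (τ : ∀ {k n : ℕ} (θ : Fin (k + 1) →o Fin (n + 1)) (σ : ComposableArrows A n),
      E k (pullChain σ θ) →o E n σ)
    (hR : ∀ {k n : ℕ} (θ : Fin (k + 1) →o Fin (n + 1)) (σ : ComposableArrows A n) w i,
      ∀ x ∈ Ioc (0 : ℝ) 1, x ∈ R n σ i (stdSimplex.map θ w) ↔ x ∈ R k (pullChain σ θ) i w)
    (hρ : ∀ {k n : ℕ} (θ : Fin (k + 1) →o Fin (n + 1)) (σ : ComposableArrows A n) w i,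
      ρ n σ i (stdSimplex.map θ w) = ρ k (pullChain σ θ) i w)
    (hu : ∀ {k n : ℕ} (θ : Fin (k + 1) →o Fin (n + 1)) (σ : ComposableArrows A n) w i,
      u n σ i (stdSimplex.map θ w) = u k (pullChain σ θ) i w)
    (hQ : ∀ {k n : ℕ} (θ : Fin (k + 1) →o Fin (n + 1)) (σ : ComposableArrows A n) w e,
      ∀ x ∈ Ioc (0 : ℝ) 1, x ∈ Q n σ e (stdSimplex.map θ w) ↔
        ∃ i, τ θ σ i = e ∧ x ∈ Q k (pullChain σ θ) i w)
    (hinj : ∀ {k n : ℕ} (θ : Fin (k + 1) →o Fin (n + 1)) (σ : ComposableArrows A n) w i i',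
      ∀ x ∈ Ioc (0 : ℝ) 1, x ∈ Q k (pullChain σ θ) i w → x ∈ Q k (pullChain σ θ) i' w →
        τ θ σ i = τ θ σ i' → i = i')
    (hπ : ∀ {k n : ℕ} (θ : Fin (k + 1) →o Fin (n + 1)) (σ : ComposableArrows A n) w i,
      π n σ (τ θ σ i) (stdSimplex.map θ w) = π k (pullChain σ θ) i w)
    (hv : ∀ {k n : ℕ} (θ : Fin (k + 1) →o Fin (n + 1)) (σ : ComposableArrows A n) w i,
      (⟨m' n σ (τ θ σ i), v n σ (τ θ σ i) (stdSimplex.map θ w)⟩ : S.Elt) =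
        ⟨m' k (pullChain σ θ) i, v k (pullChain σ θ) i w⟩)
    {f g : C(SSet.toTop.obj (nerve A), SSet.toTop.obj (nerve A))}
    (hf : ∀ n (σ : ComposableArrows A n) w,
      evalAt S.ptFamily (Q n σ) (π n σ) (v n σ) w = f (nervePt σ w))
    (hg : ∀ n (σ : ComposableArrows A n) w,
      evalAt S.ptFamily (R n σ) (ρ n σ) (u n σ) w = g (nervePt σ w)) : f.Homotopic g := by
  have HJ := fun n (σ : ComposableArrows A n) => (H n σ).join (H' n σ)
    fun z i e x hx x' hx' hxx h h' _ _ => hsub n σ z i e x hx x' hx' hxx h h'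
  refine nerve_homotopic (fun n σ => evalAt S.ptFamily (joinLayer (R n σ) (Q n σ))
    (fun i z => Sum.elim (fun i => ρ n σ i z.1) (fun e => π n σ e z.1) (ofLex i))
    (joinPt (u n σ) (v n σ))) (fun n σ => continuous_evalAt _ (HJ n σ)) (fun θ σ w l => ?_)
    (fun n σ w => ?_) fun n σ w => ?_
  · exact evalAt_join_push _ (HJ _ _) l (τ θ σ) (hR θ σ w) (hρ θ σ w) (hu θ σ w) (hQ θ σ w)
      (hinj θ σ w) (hπ θ σ w) (hv θ σ w)
  · exact (evalAt_join_zero _ (H' n σ) w).trans (hf n σ w)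
  · exact (evalAt_join_one _ (H n σ) w).trans (hg n σ w)

end CoveringSystem

namespace CoveringSystem

open Set LayeredFamily

variable {A : Type} [Category.{0} A] {Y : Type} [TopologicalSpace Y] {S : CoveringSystem A Y}
  {ψ : C(SSet.toTop.obj (nerve A), Y)}

theorem exists_evalAt [Nonempty (SSet.toTop.obj (nerve A))] {I : Type} [LinearOrder I] {m : I → A}
    {R : ∀ n, ComposableArrows A n → I → stdSimplex ℝ (Fin (n + 1)) → Set ℝ}
    {ρ : ∀ n, ComposableArrows A n → I → stdSimplex ℝ (Fin (n + 1)) → ℝ}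
    {u : ∀ n, ComposableArrows A n → ∀ i, stdSimplex ℝ (Fin (n + 1)) → S.U (m i)}
    {D : ∀ n, ComposableArrows A n → I → Set (stdSimplex ℝ (Fin (n + 1)))}
    {y : ∀ n, ComposableArrows A n → stdSimplex ℝ (Fin (n + 1)) → Y}
    (H : ∀ n σ, LayeredFamily S (y n σ) m (R n σ) (ρ n σ) (u n σ) (D n σ))
    (hR : ∀ {k n : ℕ} (θ : Fin (k + 1) →o Fin (n + 1)) (σ : ComposableArrows A n) w i,
      ∀ x ∈ Ioc (0 : ℝ) 1, x ∈ R n σ i (stdSimplex.map θ w) ↔ x ∈ R k (pullChain σ θ) i w)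
    (hρ : ∀ {k n : ℕ} (θ : Fin (k + 1) →o Fin (n + 1)) (σ : ComposableArrows A n) w i,
      ρ n σ i (stdSimplex.map θ w) = ρ k (pullChain σ θ) i w)
    (hu : ∀ {k n : ℕ} (θ : Fin (k + 1) →o Fin (n + 1)) (σ : ComposableArrows A n) w i,
      u n σ i (stdSimplex.map θ w) = u k (pullChain σ θ) i w) :
    ∃ h : C(SSet.toTop.obj (nerve A), SSet.toTop.obj (nerve A)),
      ∀ n (σ : ComposableArrows A n) w,
        h (nervePt σ w) = evalAt S.ptFamily (R n σ) (ρ n σ) (u n σ) w :=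
  exists_nerveDesc (fun n σ => ⟨_, continuous_evalAt S.ptFamily (H n σ)⟩) fun θ σ w =>
    evalAt_push _ (H _ _) OrderHom.id
      (fun e x hx => ⟨fun h => ⟨e, rfl, (hR θ σ w e x hx).1 h⟩, by
        rintro ⟨_, rfl, h⟩
        exact (hR θ σ w _ x hx).2 h⟩)
      (fun _ _ _ _ _ _ h => h) (hρ θ σ w) fun i => congrArg (Elt.mk (m i)) (hu θ σ w i)

theorem ContractionSystem.homotopic_evalAt_comp [Nonempty A] [Nonempty (SSet.toTop.obj (nerve A))]
    (C : S.ContractionSystem)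
    {h0 : (0 : ℝ) ≤ 0 ∧ (0 : ℝ) ≤ 1 / 2} {h1 : (0 : ℝ) ≤ 1 / 2 ∧ (1 / 2 : ℝ) ≤ 1 / 2}
    (hψ : ∀ n (σ : ComposableArrows A n) w, ψ (nervePt σ w) = S.q _ (C.endPt σ w))
    {ψ' : C(SSet.toTop.obj (nerve A), Y)}
    (hψ' : ∀ n (σ : ComposableArrows A n) w, ψ' (nervePt σ w) = ψ (nervePt σ (resampling 0 h0 w)))
    {χ : C(SSet.toTop.obj (nerve A), SSet.toTop.obj (nerve A))}
    (hχ : ∀ n (σ : ComposableArrows A n) w, χ (nervePt σ w) = nervePt σ (resampling (1 / 2) h1 w))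
    {g : A → Y → ℝ} (hg : S.Bumps g) {κ : Type} {ρ : κ → Y → ℝ}
    {v : ∀ i : S.Tag κ, Y → S.U (S.meet i.1)} {D : S.Tag κ → Set Y}
    (H : LayeredFamily S (fun y => y) (fun i : S.Tag κ => S.meet i.1) (fun i => levelSet g i.1)
      (fun i => ρ i.2) v D)
    {φ : C(Y, SSet.toTop.obj (nerve A))}
    (hφ : ∀ y, φ y = evalAt S.ptFamily (fun i : S.Tag κ => levelSet g i.1) (fun i => ρ i.2) v y) :
    (φ.comp ψ').Homotopic χ := by
  classical
  obtain ⟨κ', μ, s, ρ', D', hρ', H', hV⟩ := exists_slotLayered C hψ hψ' hg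
  have hR : ∀ {k n : ℕ} (θ : Fin (k + 1) →o Fin (n + 1)) (σ : ComposableArrows A n) w
      (i : S.Tag κ'), ∀ x ∈ Ioc (0 : ℝ) 1,
        x ∈ slotLevel σ (fun T w => levelSet g T (ψ' (nervePt σ w))) i.1 (stdSimplex.map θ w) ↔
        x ∈ slotLevel (pullChain σ θ)
          (fun T w => levelSet g T (ψ' (nervePt (pullChain σ θ) w))) i.1 w :=
    fun θ σ w i x hx => slotLevel_map θ σ (fun T => by rw [nervePt_map]) hx
  have hu : ∀ {k n : ℕ} (θ : Fin (k + 1) →o Fin (n + 1)) (σ : ComposableArrows A n) w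
      (i : S.Tag κ'), S.transfer (μ i.2) (S.meet i.1) (s i.2 (nervePt σ (stdSimplex.map θ w))) =
        S.transfer (μ i.2) (S.meet i.1) (s i.2 (nervePt (pullChain σ θ) w)) :=
    fun θ σ w i => by rw [nervePt_map]
  have hρ := fun {k n : ℕ} (θ : Fin (k + 1) →o Fin (n + 1)) (σ : ComposableArrows A n) w
    (i : S.Tag κ') => hρ' θ σ i.2 w
  obtain ⟨h, hh⟩ := exists_evalAt H' hR hρ hu
  have hb : (φ.comp ψ').Homotopic h := by
    refine homotopic_of_join H' (fun n σ => H.comp (ψ'.comp (nervePt σ))) ?_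
      (fun _ _ => OrderHom.id) hR hρ hu ?_ (fun _ _ _ _ _ _ _ _ _ h => h) ?_ ?_
      (fun n σ w => (hφ _).symm) fun n σ w => (hh n σ w).symm
    · intro n σ w i e x hx x' hx' hxx hi he
      rw [hV n σ w x hx _ hi]
      obtain ⟨j, T, hT, -, hxT⟩ := mem_slotLevel_iff.1 hi
      have hle := hg.leveling.inf_subset _ x hx x' hx' hxx _ _ hxT he
      rw [hg.leveling.V_meet (y := fun y => y) hg.subset hx' he]
      refine Subset.trans (fun y hy => mem_iInter₂.2 fun α hα => ?_) hle
      exact mem_iInter₂.1 hy α (hT ▸ Finset.mem_insert_of_mem hα)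
    · intro k n θ σ w e x _
      simp only [ContinuousMap.comp_apply, nervePt_map]
      exact ⟨fun h => ⟨e, rfl, h⟩, by rintro ⟨_, rfl, h⟩; exact h⟩
    · intro k n θ σ w e
      simp only [ContinuousMap.comp_apply, nervePt_map, OrderHom.id_coe, id]
    · intro k n θ σ w e
      simp only [ContinuousMap.comp_apply, nervePt_map]
      rfl
  have hy : ∀ n (σ : ComposableArrows A n), (fun w => ψ' (nervePt σ w)) = fun w =>
      ψ (nervePt σ (resampling 0 h0 w)) := fun n σ => funext (hψ' n σ)
  have ha : χ.Homotopic h := by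
    refine homotopic_of_join (E := fun n _ => Fin (n + 1)) H'
      (fun n σ => (hy n σ).symm ▸ C.vertexLayered (h0 := h0) σ hψ) ?_
      (fun θ _ => θ) hR hρ hu ?_ ?_ (fun _ _ _ _ => rfl) ?_
      (fun n σ w => (C.evalAt_vertexPt σ hψ h1 w).trans (hχ n σ w).symm)
      fun n σ w => (hh n σ w).symm
    · intro n σ w i e x hx x' hx' hxx hi he
      rw [hV n σ w x hx _ hi]
      obtain ⟨j, T, hT, hj, hxT⟩ := mem_slotLevel_iff.1 hi
      refine Subset.trans ?_ (S.mono (chainHom σ (hj.le (by linarith) he)))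
      exact fun y hy => mem_iInter₂.1 hy _ (hT ▸ Finset.mem_insert_self _ _)
    · exact fun θ σ w e x hx => inSlot_map_iff θ w (half_add_mem hx) e
    · exact fun θ σ w i i' x hx h h' _ => h.unique h'
    · exact fun θ σ w i => congrArg (Elt.mk _) (C.vertexPt_map θ σ i w)
  exact hb.trans ha.symm

end CoveringSystem

namespace CoveringSystem

open Set LayeredFamily

variable {A : Type} [Category.{0} A] {Y : Type} [TopologicalSpace Y]

theorem nonempty_homotopyEquiv_nerve [Nonempty A] [ParacompactSpace Y] [T2Space Y]
    (S : CoveringSystem A Y) :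
    Nonempty (ContinuousMap.HomotopyEquiv Y (SSet.toTop.obj (nerve A))) := by
  obtain ⟨α₀⟩ := ‹Nonempty A›
  have : Nonempty A := ⟨α₀⟩
  have : Nonempty (SSet.toTop.obj (nerve A)) :=
    ⟨nervePt (ComposableArrows.mk₀ α₀) (Classical.arbitrary _)⟩
  have : Nonempty C(unitInterval, Y) := ⟨ContinuousMap.const _ (S.q α₀ (Classical.arbitrary _))⟩
  obtain ⟨C⟩ := nonempty_contractionSystem S
  obtain ⟨ψ, hψ⟩ := C.exists_descent
  have h0 : (0 : ℝ) ≤ 0 ∧ (0 : ℝ) ≤ 1 / 2 := by norm_num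
  have h1 : (0 : ℝ) ≤ 1 / 2 ∧ (1 / 2 : ℝ) ≤ 1 / 2 := by norm_num
  obtain ⟨χ₀, hχ₀, hχ₀id⟩ := exists_resampleMap (A := A) 0 h0
  obtain ⟨χ₁, hχ₁, hχ₁id⟩ := exists_resampleMap (A := A) (1 / 2) h1
  obtain ⟨g, hg⟩ := S.exists_bumps
  obtain ⟨a⟩ := S.exists_atlas (y := fun y => y) continuous_id (fun α => tsupport (g α))
    (fun α => isClosed_tsupport _) hg.subset
  obtain ⟨ρ, hρ⟩ := exists_isPartition a.O a.isOpen a.cover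
  have H := hg.leveling.layered (y := fun y => y) hg.subset a hρ
  let φ : C(Y, SSet.toTop.obj (nerve A)) := ⟨_, continuous_evalAt S.ptFamily H⟩
  have hψ' : ∀ n (σ : ComposableArrows A n) w,
      (ψ.comp χ₀) (nervePt σ w) = ψ (nervePt σ (resampling 0 h0 w)) :=
    fun n σ w => congrArg ψ (hχ₀ n σ w)
  have hψχ : (ψ.comp χ₀).Homotopic ψ := (ContinuousMap.Homotopic.refl ψ).comp hχ₀id
  have hY : (ContinuousMap.id Y).Homotopic (ψ.comp φ) :=
    C.homotopic_descent_evalAt H hψ (φ := φ) (fun _ => rfl) fun _ => rfl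
  have hK := C.homotopic_evalAt_comp (h1 := h1) hψ hψ' hχ₁ hg H (φ := φ) fun _ => rfl
  exact ⟨⟨φ, ψ.comp χ₀, (hψχ.comp (ContinuousMap.Homotopic.refl φ)).trans hY.symm,
    hK.trans hχ₁id⟩⟩

end CoveringSystem

section Covering

open Set

theorem IsLocalHomeomorph.locallyPathConnectedSpace {X Z : Type*} [TopologicalSpace X]
    [TopologicalSpace Z] [LocallyPathConnectedSpace Z] {f : X → Z} (hf : IsLocalHomeomorph f) :
    LocallyPathConnectedSpace X where
  path_connected_basis x := by
    rw [Filter.hasBasis_self]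
    intro W hW
    obtain ⟨e, hxe, rfl⟩ := hf x
    have h1 : e.target ∩ e.symm ⁻¹' W ∈ nhds (e x) :=
      Filter.inter_mem (e.open_target.mem_nhds (e.map_source hxe))
        (e.tendsto_symm hxe hW)
    obtain ⟨s, ⟨hs, hsp⟩, hsW⟩ :=
      (LocallyPathConnectedSpace.path_connected_basis (e x)).mem_iff.1 h1
    refine ⟨e.symm '' s, ?_, hsp.image' (e.continuousOn_symm.mono fun z hz => (hsW hz).1), ?_⟩
    · filter_upwards [e.continuousAt hxe hs, e.open_source.mem_nhds hxe] with x' hx' hx'e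
      exact ⟨e x', hx', e.left_inv hx'e⟩
    · rintro _ ⟨z, hz, rfl⟩
      exact (hsW hz).2

theorem locallyPathConnectedSpace_of_contractible {Y : Type*} [TopologicalSpace Y]
    (hloc : ∀ y : Y, ∀ W ∈ nhds y, ∃ V' ∈ nhds y, V' ⊆ W ∧ ContractibleSpace V') :
    LocallyPathConnectedSpace Y where
  path_connected_basis y := by
    rw [Filter.hasBasis_self]
    intro W hW
    obtain ⟨V', hV', hVW, hc⟩ := hloc y W hW
    exact ⟨V', hV', isPathConnected_iff_pathConnectedSpace.2 inferInstance, hVW⟩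

/-- The covering system of a family of contractible covering spaces. -/
noncomputable def coveringSystemOf {Y : Type} [TopologicalSpace Y]
    (hloc : ∀ y : Y, ∀ W ∈ nhds y, ∃ V' ∈ nhds y, V' ⊆ W ∧ ContractibleSpace V')
    {A : Type} (V : A → Set Y) (hopen : ∀ α, IsOpen (V α)) (hcover : ∀ y : Y, ∃ α, y ∈ V α)
    (hlocfin : LocallyFinite V)
    (hinter : ∀ α β, (V α ∩ V β).Nonempty → ∃ γ, V γ = V α ∩ V β)
    (U : A → Type) [∀ α, TopologicalSpace (U α)] (p : ∀ α, U α → V α)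
    (hcovering : ∀ α, IsCoveringMap (p α)) (hsurj : ∀ α, Function.Surjective (p α))
    (hcontr : ∀ α, ContractibleSpace (U α)) :
    @CoveringSystem A (coveringSpacesCategory V U p) Y _ :=
  letI := coveringSpacesCategory V U p
  have hq : ∀ α, IsLocalHomeomorph fun u => (p α u : Y) := fun α =>
    (hopen α).isOpenEmbedding_subtypeVal.isLocalHomeomorph.comp (hcovering α).isLocalHomeomorph
  { U := U
    top := inferInstance
    contr := hcontr
    V := V
    isOpen_V := hopen
    exists_mem := hcover
    locallyFinite := hlocfin
    exists_inter := hinter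
    q := fun α => ⟨fun u => p α u, (hq α).continuous⟩
    q_mem := fun α u => (p α u).2
    act := fun f => f.1
    act_id := fun _ _ => rfl
    act_comp := fun _ _ _ => rfl
    q_act := fun f u => f.2 u
    mono := fun {α β} f y hy => by
      obtain ⟨u, hu⟩ := hsurj α ⟨y, hy⟩
      have h := f.2 u
      rw [hu] at h
      exact (show (p β (f.1 u) : Y) = y from h) ▸ (p β (f.1 u)).2
    exists_hom := fun {α β} u v hV huv => by
      have := locallyPathConnectedSpace_of_contractible hloc
      have := (hq α).locallyPathConnectedSpace
      have := hcontr α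
      obtain ⟨F, ⟨hF, hpF⟩, -⟩ := (hcovering β).existsUnique_continuousMap_lifts
        ⟨fun u => inclusion hV (p α u), (continuous_inclusion hV).comp (hcovering α).continuous⟩
        u v (Subtype.ext huv.symm)
      exact ⟨⟨F, fun x => congrArg Subtype.val (congrFun hpF x)⟩, hF⟩
    hom_ext := fun {α β} f g u h => by
      have := hcontr α
      refine Subtype.ext (DFunLike.coe_injective ((hcovering β).eq_of_comp_eq f.1.continuous
        g.1.continuous (funext fun x => Subtype.ext ?_) u h))
      exact (f.2 x).trans (g.2 x).symm
    exists_section := fun α y hy => by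
      obtain ⟨u, hu⟩ := hsurj α ⟨y, hy⟩
      obtain ⟨e, hue, he⟩ := hq α u
      refine ⟨e.target, e.open_target, ?_, e.symm, e.continuousOn_symm, fun z hz => ?_⟩
      · have h := e.map_source hue
        rw [← he] at h
        change (p α u : Y) ∈ e.target at h
        rwa [hu] at h
      · exact (congrFun he _).trans (e.right_inv hz)
    exists_injOn := fun α u => by
      obtain ⟨e, hue, he⟩ := hq α u
      exact ⟨e.source, e.open_source.mem_nhds hue, fun a ha b hb hab =>
        e.injOn ha hb (by rw [← he]; exact hab)⟩ }

end Covering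

/-- **Lubkin–Sullivan.** Let `Y` be a locally contractible paracompact Hausdorff space with a
locally finite indexed open covering `(V α)` closed under finite nonempty intersections, and
suppose each `V α` carries a covering map `p α : U α → V α` with `U α` contractible. Then `Y`
is homotopy equivalent to the classifying space `|B𝔘|` of the category of these coverings. -/
theorem lubkin_sullivan {Y : Type} [TopologicalSpace Y] [ParacompactSpace Y] [T2Space Y]
    (hloc : ∀ y : Y, ∀ W ∈ nhds y, ∃ V' ∈ nhds y, V' ⊆ W ∧ ContractibleSpace V')
    {A : Type} (V : A → Set Y)
    (hopen : ∀ α, IsOpen (V α))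
    (hcover : ∀ y : Y, ∃ α, y ∈ V α)
    (hlocfin : LocallyFinite V)
    (hinter : ∀ α β, (V α ∩ V β).Nonempty → ∃ γ, V γ = V α ∩ V β)
    (U : A → Type) [∀ α, TopologicalSpace (U α)] (p : ∀ α, U α → V α)
    (hcovering : ∀ α, IsCoveringMap (p α))
    (hsurj : ∀ α, Function.Surjective (p α))
    (hcontr : ∀ α, ContractibleSpace (U α)) :
    Nonempty (ContinuousMap.HomotopyEquiv Y
      (SSet.toTop.obj (@nerve A (coveringSpacesCategory V U p)))) := by
  let _ := coveringSpacesCategory V U p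
  let S := coveringSystemOf hloc V hopen hcover hlocfin hinter U p hcovering hsurj hcontr
  cases isEmpty_or_nonempty A with
  | inr _ => exact S.nonempty_homotopyEquiv_nerve
  | inl _ =>
    have hK : IsEmpty (SSet.toTop.obj (nerve A)) := ⟨fun z => by
      obtain ⟨n, σ, -, -⟩ := exists_nervePt_eq z
      exact isEmptyElim (σ.obj 0)⟩
    have hY : IsEmpty Y := ⟨fun y => isEmptyElim (hcover y).choose⟩
    exact ⟨(Homeomorph.empty : Y ≃ₜ SSet.toTop.obj (nerve A)).toHomotopyEquiv⟩
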